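/- arXiv:1307.1980 — 4 statements merged into one kernel-verified Lean document; each statement's English description precedes it below -/
import Mathlib

section
/- Let h be a classical solution on [0,T] of the homogeneous KPZ equation ∂ₜh = νΔh + λV(∇h) with initial condition h₀ ∈ W^{1,∞}(ℝ^d). (i) If h₀ ≤ 0 everywhere, then for all t ∈ [0,T] and x ∈ ℝ^d, (e^{tνΔ}h₀)(x) ≤ h(t,x) ≤ 0. (ii) If h₀ ≥ 0 everywhere, then for all t ∈ (0,T] and x ∈ ℝ^d, 0 ≤ h(t,x) ≤ (ν/λ)·ln( (e^{tνΔ} e^{(λ/ν)h₀})(x) ). -/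
open MeasureTheory Real Set
open scoped ENNReal

noncomputable section

/-- The Laplacian of a function `f : ℝ^d → ℝ` at `x`, as the trace of the second derivative. -/
def lapl {d : ℕ} (f : EuclideanSpace ℝ (Fin d) → ℝ) (x : EuclideanSpace ℝ (Fin d)) : ℝ :=
  ∑ i : Fin d,
    iteratedFDeriv ℝ 2 f x ![EuclideanSpace.single i (1:ℝ), EuclideanSpace.single i (1:ℝ)]

/-- Standing assumptions on the deposition rate `V` (with radial profile `W`):
`V` is `C²`, isotropic, convex, `W 0 = 0`, `W ≥ 0` and `W y ≤ y²` on `[0,∞)`. -/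
structure IsDepositionRate (d : ℕ) (V : EuclideanSpace ℝ (Fin d) → ℝ) (W : ℝ → ℝ) : Prop where
  smooth : ContDiff ℝ 2 V
  isotropic : ∀ p, V p = W ‖p‖
  convex : ConvexOn ℝ Set.univ V
  zero : W 0 = 0
  nonneg : ∀ y : ℝ, 0 ≤ y → 0 ≤ W y
  quadGrowth : ∀ y : ℝ, 0 ≤ y → W y ≤ y ^ 2

/-- `h₀ ∈ W^{1,∞}(ℝ^d)`: differentiable, bounded, with bounded gradient. -/
structure MemW1inf {d : ℕ} (h₀ : EuclideanSpace ℝ (Fin d) → ℝ) : Prop where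
  diff : Differentiable ℝ h₀
  bdd : ∃ C, ∀ x, |h₀ x| ≤ C
  grad_bdd : ∃ C, ∀ x, ‖gradient h₀ x‖ ≤ C

/-- A classical solution on `[0,T]` of the homogeneous KPZ equation
`∂ₜ h = ν Δ h + λ V (∇ h)` with initial condition `h₀`: continuous on `[0,T] × ℝ^d`,
`C¹` in time and `C²` in space on `(0,T] × ℝ^d`, bounded together with its spatial
gradient, and satisfying the equation pointwise on `(0,T] × ℝ^d`. -/
structure IsClassicalSolution {d : ℕ} (ν lam T : ℝ)
    (V : EuclideanSpace ℝ (Fin d) → ℝ)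
    (h₀ : EuclideanSpace ℝ (Fin d) → ℝ)
    (h : ℝ → EuclideanSpace ℝ (Fin d) → ℝ) : Prop where
  cont : ContinuousOn (fun p : ℝ × EuclideanSpace ℝ (Fin d) => h p.1 p.2)
      (Set.Icc 0 T ×ˢ Set.univ)
  space_reg : ∀ t ∈ Set.Ioc (0:ℝ) T, ContDiff ℝ 2 (h t)
  time_reg : ∀ (x : EuclideanSpace ℝ (Fin d)), ∀ t ∈ Set.Ioc (0:ℝ) T,
      DifferentiableAt ℝ (fun s => h s x) t
  bdd : ∃ C, ∀ t ∈ Set.Icc (0:ℝ) T, ∀ x, |h t x| ≤ C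
  grad_bdd : ∃ C, ∀ t ∈ Set.Icc (0:ℝ) T, ∀ x, ‖gradient (h t) x‖ ≤ C
  pde : ∀ t ∈ Set.Ioc (0:ℝ) T, ∀ x, deriv (fun s => h s x) t
      = ν * lapl (h t) x + lam * V (gradient (h t) x)
  init : ∀ x, h 0 x = h₀ x

/-- The heat semigroup `e^{tνΔ}` acting on `f`, with the convention that at `t = 0` it is the
identity: `(e^{tνΔ}f)(x) = ∫ (4πνt)^{-d/2} e^{-|x-y|²/(4νt)} f(y) dy` for `t > 0`. -/
def heatSG {d : ℕ} (ν t : ℝ) (f : EuclideanSpace ℝ (Fin d) → ℝ)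
    (x : EuclideanSpace ℝ (Fin d)) : ℝ :=
  if t = 0 then f x
  else ∫ y, (4 * π * ν * t) ^ (-(d:ℝ)/2) * Real.exp (-‖x - y‖^2 / (4 * ν * t)) * f y


/-- `f` is differentiable everywhere, with first and second derivative `g`, `H` at `0`. -/
def D2 (f : ℝ → ℝ) (g H : ℝ) : Prop :=
  ∃ D : ℝ → ℝ, (∀ s, HasDerivAt f (D s) s) ∧ D 0 = g ∧ HasDerivAt D H 0

lemma D2.sub {f₁ f₂ : ℝ → ℝ} {g₁ g₂ H₁ H₂ : ℝ} (h1 : D2 f₁ g₁ H₁) (h2 : D2 f₂ g₂ H₂) :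
    D2 (fun s => f₁ s - f₂ s) (g₁ - g₂) (H₁ - H₂) := by
  obtain ⟨D1, a1, b1, c1⟩ := h1
  obtain ⟨D2, a2, b2, c2⟩ := h2
  exact ⟨fun s => D1 s - D2 s, fun s => (a1 s).sub (a2 s), by simp [b1, b2], c1.sub c2⟩

lemma D2.neg {f₁ : ℝ → ℝ} {g₁ H₁ : ℝ} (h1 : D2 f₁ g₁ H₁) :
    D2 (fun s => - f₁ s) (-g₁) (-H₁) := by
  obtain ⟨D1, a1, b1, c1⟩ := h1
  exact ⟨fun s => - D1 s, fun s => (a1 s).neg, by simp [b1], c1.neg⟩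

lemma D2.exp_mul {f : ℝ → ℝ} {g H : ℝ} (h1 : D2 f g H) (a : ℝ) :
    D2 (fun s => Real.exp (a * f s)) (Real.exp (a * f 0) * (a * g))
      (Real.exp (a * f 0) * (a * g) * (a * g) + Real.exp (a * f 0) * (a * H)) := by
  obtain ⟨D, hD, rfl, hH⟩ := h1
  refine ⟨fun s => Real.exp (a * f s) * (a * D s), fun s => ((hD s).const_mul a).exp, rfl, ?_⟩
  exact (((hD 0).const_mul a).exp).mul (hH.const_mul a)

lemma D2.max {f : ℝ → ℝ} {g H : ℝ} (h1 : D2 f g H) (hm : ∀ s, f s ≤ f 0) : g = 0 ∧ H ≤ 0 := by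
  obtain ⟨D, hD, rfl, hH⟩ := h1
  have hmax : IsLocalMax f 0 := Filter.Eventually.of_forall hm
  have hg : D 0 = 0 := hmax.hasDerivAt_eq_zero (hD 0)
  refine ⟨hg, ?_⟩
  by_contra hpos
  push Not at hpos
  have hdf : deriv f = D := funext fun s => (hD s).deriv
  have hmin : IsLocalMin f 0 := isLocalMin_of_deriv_deriv_pos
    (by rw [hdf, hH.deriv]; exact hpos) (by rw [hdf, hg]) (hD 0).continuousAt
  have hc : ∀ᶠ s in nhds (0:ℝ), f s = f 0 := by
    filter_upwards [hmin] with s hs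
    exact le_antisymm (hm s) hs
  have hc2 : ∀ᶠ s in nhds (0:ℝ), D s = 0 := by
    filter_upwards [hc.eventually_nhds] with s hs
    have : HasDerivAt f 0 s := (hasDerivAt_const s (f 0)).congr_of_eventuallyEq hs
    exact (hD s).unique this
  have : HasDerivAt D 0 0 := (hasDerivAt_const (0:ℝ) (0:ℝ)).congr_of_eventuallyEq hc2
  have := hH.unique this
  linarith

lemma norm_sq_line {d : ℕ} (x : EuclideanSpace ℝ (Fin d)) (i : Fin d) (s : ℝ) :
    ‖x + s • EuclideanSpace.single i (1:ℝ)‖ ^ 2 = ‖x‖ ^ 2 + 2 * s * x i + s ^ 2 := by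
  rw [norm_add_sq_real]
  simp [inner_smul_right, norm_smul, EuclideanSpace.inner_single_right]
  ring

lemma norm_sq_sum {d : ℕ} (x : EuclideanSpace ℝ (Fin d)) : ‖x‖ ^ 2 = ∑ i, x i ^ 2 := by
  rw [EuclideanSpace.norm_sq_eq]; simp

lemma deriv_nonneg_of_left_max {f : ℝ → ℝ} {f' t : ℝ} (hf : HasDerivAt f f' t) (ht : 0 < t)
    (hm : ∀ s ∈ Set.Icc 0 t, f s ≤ f t) : 0 ≤ f' := by
  have h1 := hf.hasDerivWithinAt (s := Set.Iio t)
  rw [hasDerivWithinAt_iff_tendsto_slope' (by simp)] at h1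
  refine ge_of_tendsto h1 ?_
  filter_upwards [Ioo_mem_nhdsLT ht] with s hs
  rw [slope_def_field]
  exact div_nonneg_of_nonpos (by linarith [hm s ⟨hs.1.le, hs.2.le⟩]) (by linarith [hs.2])

lemma max_principle {d : ℕ} (hd : 1 ≤ d) (ν K T M : ℝ) (hν : 0 < ν) (hK : 0 ≤ K) 
    (w : ℝ → EuclideanSpace ℝ (Fin d) → ℝ)
    (hc : ContinuousOn (fun p : ℝ × EuclideanSpace ℝ (Fin d) => w p.1 p.2)
      (Set.Icc 0 T ×ˢ Set.univ))
    (hM : ∀ t ∈ Set.Icc (0:ℝ) T, ∀ x, w t x ≤ M)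
    (h0 : ∀ x, w 0 x ≤ 0)
    (hw : ∀ t ∈ Set.Ioc (0:ℝ) T, ∀ x, ∃ (wt : ℝ) (g H : Fin d → ℝ),
      HasDerivAt (fun s => w s x) wt t ∧
      (∀ i, D2 (fun s => w t (x + s • EuclideanSpace.single i (1:ℝ))) (g i) (H i)) ∧
      wt ≤ ν * ∑ i, H i + K * ∑ i, |g i|) :
    ∀ t ∈ Set.Icc (0:ℝ) T, ∀ x, w t x ≤ 0 := by
  intro t1 ht1 x1
  by_contra hcon
  push Not at hcon
  set A : ℝ := 2 * d * ν + K * d + 1 with hA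
  have hd' : (1:ℝ) ≤ d := by exact_mod_cast hd
  have hApos : 0 < A := by positivity
  set ψ : ℝ → EuclideanSpace ℝ (Fin d) → ℝ := fun t x => Real.exp (A * t) * (1 + ‖x‖ ^ 2) with hψ
  have hψpos : ∀ t x, 0 < ψ t x := fun t x => by simp only [hψ]; positivity
  obtain ⟨ε, hε, hε1⟩ : ∃ ε > 0, ε * ψ t1 x1 < w t1 x1 := by
    refine ⟨w t1 x1 / (2 * ψ t1 x1), by have := hψpos t1 x1; positivity, ?_⟩
    have := hψpos t1 x1
    field_simp
    linarith
  set φ : ℝ → EuclideanSpace ℝ (Fin d) → ℝ := fun t x => w t x - ε * ψ t x with hφ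
  obtain ⟨R, hR0, hR⟩ : ∃ R : ℝ, 0 ≤ R ∧ M < ε * (1 + R ^ 2) := by
    refine ⟨|M| / ε + 1, by positivity, ?_⟩
    have h1 : M ≤ |M| := le_abs_self M
    have h3 : ε * (|M| / ε) = |M| := by field_simp
    have h2 : 0 ≤ |M| / ε := by positivity
    nlinarith [mul_nonneg hε.le (mul_nonneg h2 h2)]
  have hout : ∀ t ∈ Set.Icc (0:ℝ) T, ∀ x, R < ‖x‖ → φ t x < 0 := by
    intro t ht x hx
    have h1 := hM t ht x
    have h2 : 1 ≤ Real.exp (A * t) := Real.one_le_exp (mul_nonneg hApos.le ht.1)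
    have h3 : 1 + R ^ 2 ≤ 1 + ‖x‖ ^ 2 := by gcongr
    have h4 : 1 + R ^ 2 ≤ ψ t x := by
      simp only [hψ]; nlinarith [sq_nonneg ‖x‖]
    have h5 : ε * (1 + R ^ 2) ≤ ε * ψ t x := by gcongr
    simp only [hφ]; linarith
  have hφc : ContinuousOn (fun p : ℝ × EuclideanSpace ℝ (Fin d) => φ p.1 p.2)
      (Set.Icc 0 T ×ˢ Set.univ) := by
    refine hc.sub (Continuous.continuousOn ?_)
    simp only [hψ]; fun_prop
  have hx1R : ‖x1‖ ≤ R := by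
    by_contra hh
    push Not at hh
    have := hout t1 ht1 x1 hh
    simp only [hφ] at this; linarith
  have hcomp : IsCompact (Set.Icc 0 T ×ˢ Metric.closedBall (0 : EuclideanSpace ℝ (Fin d)) R) :=
    isCompact_Icc.prod (isCompact_closedBall _ _)
  obtain ⟨⟨t, x⟩, ⟨ht, hx⟩, hmax⟩ := hcomp.exists_isMaxOn
    ⟨(t1, x1), ht1, by simpa using hx1R⟩ (hφc.mono (Set.prod_mono_right (Set.subset_univ _)))
  have hφpos : 0 < φ t x := by
    have h1 : φ t1 x1 ≤ φ t x := hmax (show (t1, x1) ∈ _ from ⟨ht1, by simpa using hx1R⟩)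
    have : 0 < φ t1 x1 := by simp only [hφ]; linarith
    linarith
  have hglob : ∀ s ∈ Set.Icc (0:ℝ) T, ∀ y, φ s y ≤ φ t x := by
    intro s hs y
    by_cases hy : ‖y‖ ≤ R
    · exact hmax (show (s, y) ∈ _ from ⟨hs, by simpa using hy⟩)
    · push Not at hy
      linarith [hout s hs y hy]
  simp only at ht
  have htpos : 0 < t := by
    rcases ht.1.lt_or_eq with h | h
    · exact h
    · exfalso
      rw [← h] at hφpos
      have := h0 x
      have := mul_pos hε (hψpos 0 x)
      simp only [hφ] at hφpos; linarith
  obtain ⟨wt, g, H, hwt, hD2, hineq⟩ := hw t ⟨htpos, ht.2⟩ x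
  set E := Real.exp (A * t) with hE
  have hEpos : 0 < E := Real.exp_pos _
  have hψt : HasDerivAt (fun s => ψ s x) (E * (A * 1) * (1 + ‖x‖ ^ 2)) t :=
    (((hasDerivAt_id t).const_mul A).exp).mul_const _
  have hφt := hwt.sub (hψt.const_mul ε)
  have h1 := deriv_nonneg_of_left_max hφt htpos
    (fun s hs => hglob s ⟨hs.1, hs.2.trans ht.2⟩ x)
  have hψ2 : ∀ i, D2 (fun s => ε * ψ t (x + s • EuclideanSpace.single i (1:ℝ)))
      (ε * E * (2 * x i)) (ε * E * 2) := by
    intro i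
    refine ⟨fun s => ε * E * (2 * x i + 2 * s), fun s => ?_, by simp, ?_⟩
    · simp only [hψ, norm_sq_line]
      have : HasDerivAt (fun s : ℝ => (1 + (‖x‖ ^ 2 + 2 * s * x i + s ^ 2)))
          (2 * x i + 2 * s) s := by
        have h := ((((hasDerivAt_id s).const_mul 2).mul_const (x i)).const_add (‖x‖^2)).add
          (hasDerivAt_pow 2 s)
        exact (h.const_add 1).congr_deriv (by simp)
      exact ((this.const_mul E).const_mul ε).congr_deriv (by ring)
    · have h := ((hasDerivAt_id (0:ℝ)).const_mul 2).const_add (2 * x i)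
      exact (h.const_mul (ε * E)).congr_deriv (by ring)
  have h2 : ∀ i, g i = ε * E * (2 * x i) ∧ H i ≤ ε * E * 2 := by
    intro i
    have := ((hD2 i).sub (hψ2 i)).max (fun s => by
      have := hglob t ht (x + s • EuclideanSpace.single i (1:ℝ))
      simpa [hφ] using this)
    constructor <;> linarith [this.1, this.2]
  have h3 : ∑ i, H i ≤ d * (ε * E * 2) := by
    calc ∑ i, H i ≤ ∑ i : Fin d, ε * E * 2 := Finset.sum_le_sum fun i _ => (h2 i).2
      _ = _ := by simp
  have h4 : ∑ i, |g i| ≤ ε * E * (d + ‖x‖ ^ 2) := by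
    calc ∑ i, |g i| ≤ ∑ i : Fin d, ε * E * (1 + x i ^ 2) := by
          refine Finset.sum_le_sum fun i _ => ?_
          rw [(h2 i).1, abs_mul, abs_of_pos (by positivity : 0 < ε * E)]
          gcongr
          rw [abs_le]; constructor <;> nlinarith [sq_nonneg (x i - 1), sq_nonneg (x i + 1)]
      _ = _ := by rw [← Finset.mul_sum, Finset.sum_add_distrib, norm_sq_sum]; simp
  have h5 : ν * ∑ i, H i ≤ ν * (d * (ε * E * 2)) := by gcongr
  have h6 : K * ∑ i, |g i| ≤ K * (ε * E * (d + ‖x‖ ^ 2)) := by gcongr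
  have h7 : 0 ≤ ε * E * ((2 * d * ν) * ‖x‖ ^ 2 + K * (d - 1) * ‖x‖ ^ 2 + ‖x‖ ^ 2) := by
    have : 0 ≤ (d:ℝ) - 1 := by linarith
    positivity
  have h8 : 0 < ε * E := by positivity
  rw [hA] at h1
  nlinarith

lemma gauss_integrable {d : ℕ} {b : ℝ} (hb : 0 < b) :
    Integrable (fun z : EuclideanSpace ℝ (Fin d) => Real.exp (-b * ‖z‖ ^ 2)) := by
  apply Integrable.of_integral_ne_zero
  rw [GaussianFourier.integral_rexp_neg_mul_sq_norm hb]
  positivity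

lemma param_deriv {d : ℕ} (f : EuclideanSpace ℝ (Fin d) → ℝ) (hf : Continuous f) (F : ℝ)
    (hF : ∀ y, |f y| ≤ F) (k k' : ℝ → EuclideanSpace ℝ (Fin d) → ℝ) (s₀ δ C b : ℝ) (hδ : 0 < δ)
    (hb : 0 < b) (hk : ∀ s, Continuous (k s)) (hk' : ∀ s, Continuous (k' s))
    (hd : ∀ s ∈ Metric.ball s₀ δ, ∀ z, HasDerivAt (fun s => k s z) (k' s z) s)
    (hb0 : ∀ z, |k s₀ z| ≤ C * Real.exp (-b * ‖z‖ ^ 2))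
    (hb1 : ∀ s ∈ Metric.ball s₀ δ, ∀ z, |k' s z| ≤ C * Real.exp (-b * ‖z‖ ^ 2))
    (x : EuclideanSpace ℝ (Fin d)) :
    Integrable (fun y => k' s₀ (x - y) * f y) ∧
    HasDerivAt (fun s => ∫ y, k s (x - y) * f y) (∫ y, k' s₀ (x - y) * f y) s₀ := by
  have hint : Integrable (fun y => C * Real.exp (-b * ‖x - y‖ ^ 2) * F) :=
    (((gauss_integrable hb).comp_sub_left x).const_mul C).mul_const F
  refine hasDerivAt_integral_of_dominated_loc_of_deriv_le
    (F := fun s y => k s (x - y) * f y) (F' := fun s y => k' s (x - y) * f y)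
    (bound := fun y => C * Real.exp (-b * ‖x - y‖ ^ 2) * F) 
    (Metric.ball_mem_nhds s₀ hδ) ?_ ?_ ?_ ?_ hint ?_
  · refine Filter.Eventually.of_forall fun s => Continuous.aestronglyMeasurable ?_
    have := hk s
    fun_prop
  · refine hint.mono' (Continuous.aestronglyMeasurable ?_) (Filter.Eventually.of_forall fun y => ?_)
    · have := hk s₀
      fun_prop
    · rw [Real.norm_eq_abs, abs_mul]
      exact mul_le_mul (hb0 _) (hF _) (abs_nonneg _) ((abs_nonneg _).trans (hb0 _))
  · refine Continuous.aestronglyMeasurable ?_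
    have := hk' s₀
    fun_prop
  · refine Filter.Eventually.of_forall fun y s hs => ?_
    rw [Real.norm_eq_abs, abs_mul]
    exact mul_le_mul (hb1 s hs _) (hF _) (abs_nonneg _) ((abs_nonneg _).trans (hb1 s hs _))
  · exact Filter.Eventually.of_forall fun y s hs => (hd s hs _).mul_const _

lemma poly_exp {b q : ℝ} (hb : 0 < b) (hq : 0 ≤ q) :
    (1 + q) * Real.exp (-(2 * b) * q) ≤ (1 + 1 / b) * Real.exp (-b * q) := by
  have h1 : Real.exp (-(2 * b) * q) = Real.exp (-b * q) * Real.exp (-b * q) := by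
    rw [← Real.exp_add]; ring_nf
  have h2 : Real.exp (b * q) * Real.exp (-b * q) = 1 := by
    rw [← Real.exp_add]; simp
  have h3 : b * q + 1 ≤ Real.exp (b * q) := Real.add_one_le_exp _
  have h4 : 1 + q ≤ (1 + 1 / b) * Real.exp (b * q) := by
    have : (1 + 1 / b) * (b * q + 1) ≤ (1 + 1 / b) * Real.exp (b * q) := by gcongr
    have h5 : (1 + 1 / b) * (b * q + 1) = b * q + 1 + q + 1 / b := by field_simp; ring
    have : 0 ≤ b * q := by positivity
    have : 0 ≤ 1 / b := by positivity
    linarith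
  have := mul_le_mul_of_nonneg_right h4
    (mul_pos (Real.exp_pos (-b * q)) (Real.exp_pos (-b * q))).le
  rw [h1]
  calc _ ≤ _ := this
    _ = (1 + 1 / b) * (Real.exp (b * q) * Real.exp (-b * q)) * Real.exp (-b * q) := by ring
    _ = _ := by rw [h2]; ring

lemma coord_sq_le {d : ℕ} (z : EuclideanSpace ℝ (Fin d)) (i : Fin d) : z i ^ 2 ≤ ‖z‖ ^ 2 := by
  rw [norm_sq_sum]
  exact Finset.single_le_sum (f := fun i => z i ^ 2) (fun j _ => sq_nonneg _) (Finset.mem_univ i)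

lemma shift_bound {d : ℕ} {a : ℝ} (ha : 0 < a) (z : EuclideanSpace ℝ (Fin d)) (i : Fin d) (s : ℝ)
    (hs : |s| < 1) :
    (1 + (‖z‖ ^ 2 + 2 * s * z i + s ^ 2)) * Real.exp (-a * (‖z‖ ^ 2 + 2 * s * z i + s ^ 2))
      ≤ (1 + 1 / (a / 2)) * Real.exp (a / 2) * Real.exp (-(a / 4) * ‖z‖ ^ 2) := by
  have hz := coord_sq_le z i
  have hs2 : s ^ 2 ≤ 1 := by rw [sq_le_one_iff_abs_le_one]; exact hs.le
  set Q := ‖z‖ ^ 2 + 2 * s * z i + s ^ 2 with hQ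
  have h1 : ‖z‖ ^ 2 / 2 - 1 ≤ Q := by
    nlinarith [sq_nonneg (z i + 2 * s)]
  have h0 : 0 ≤ Q := by nlinarith [sq_nonneg (z i + s)]
  have h2 := poly_exp (b := a / 2) (by positivity) h0
  have e1 : -(2 * (a / 2)) * Q = -a * Q := by ring
  rw [e1] at h2
  refine h2.trans ?_
  rw [mul_assoc, ← Real.exp_add]
  gcongr
  nlinarith

lemma space_deriv {d : ℕ} (f : EuclideanSpace ℝ (Fin d) → ℝ) (hf : Continuous f) (F : ℝ)
    (hF : ∀ y, |f y| ≤ F) {a : ℝ} (ha : 0 < a) (i : Fin d) (x : EuclideanSpace ℝ (Fin d)) :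
    HasDerivAt (fun s : ℝ => ∫ y, Real.exp (-a * ‖x + s • EuclideanSpace.single i (1:ℝ) - y‖ ^ 2)
        * f y)
      (∫ y, (-2 * a * (x - y) i) * Real.exp (-a * ‖x - y‖ ^ 2) * f y) 0 ∧
    HasDerivAt (fun s : ℝ => ∫ y, (-2 * a * (x + s • EuclideanSpace.single i (1:ℝ) - y) i)
        * Real.exp (-a * ‖x + s • EuclideanSpace.single i (1:ℝ) - y‖ ^ 2) * f y)
      (∫ y, (4 * a ^ 2 * ((x - y) i) ^ 2 - 2 * a) * Real.exp (-a * ‖x - y‖ ^ 2) * f y) 0 ∧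
    Integrable (fun y => 
      (4 * a ^ 2 * ((x - y) i) ^ 2 - 2 * a) * Real.exp (-a * ‖x - y‖ ^ 2) * f y) := by
  let Q : ℝ → EuclideanSpace ℝ (Fin d) → ℝ := fun s z => ‖z‖ ^ 2 + 2 * s * z i + s ^ 2
  have hQ : ∀ s z, HasDerivAt (fun s => Real.exp (-a * Q s z))
      (-2 * a * (z i + s) * Real.exp (-a * Q s z)) s := by
    intro s z
    have h := ((((hasDerivAt_id s).const_mul 2).mul_const (z i)).const_add (‖z‖^2)).add
          (hasDerivAt_pow 2 s)
    refine ((h.const_mul (-a)).exp).congr_deriv ?_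
    simp [Q]; ring
  have hQ2 : ∀ s z, HasDerivAt (fun s => -2 * a * (z i + s) * Real.exp (-a * Q s z))
      ((4 * a ^ 2 * (z i + s) ^ 2 - 2 * a) * Real.exp (-a * Q s z)) s := by
    intro s z
    have h := ((hasDerivAt_id s).const_add (z i)).const_mul (-2 * a)
    refine (h.mul (hQ s z)).congr_deriv ?_
    simp; ring
  have hQc : ∀ s, Continuous (Q s) := fun s => by simp only [Q]; fun_prop
  set C0 := (1 + 1 / (a / 2)) * Real.exp (a / 2) with hC0
  have hC0p : 0 ≤ C0 := by positivity
  have hbd : ∀ s, |s| < 1 → ∀ z, ∀ m L : ℝ, 0 ≤ L → |m| ≤ L * (1 + Q s z) →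
      |m * Real.exp (-a * Q s z)| ≤ L * C0 * Real.exp (-(a / 4) * ‖z‖ ^ 2) := by
    intro s hs z m L hL hm
    rw [abs_mul, Real.abs_exp]
    calc |m| * Real.exp (-a * Q s z) ≤ L * (1 + Q s z) * Real.exp (-a * Q s z) := by gcongr
      _ = L * ((1 + Q s z) * Real.exp (-a * Q s z)) := by ring
      _ ≤ L * (C0 * Real.exp (-(a / 4) * ‖z‖ ^ 2)) :=
        mul_le_mul_of_nonneg_left (shift_bound ha z i s hs) hL
      _ = _ := by ring
  have hsq : ∀ s z, (z i + s) ^ 2 ≤ Q s z := fun s z => by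
    have := coord_sq_le z i
    simp only [Q]; nlinarith
  set L := 4 * a ^ 2 + 2 * a + 1 with hL
  have hLp : 0 ≤ L := by positivity
  have B0 : ∀ s, |s| < 1 → ∀ z, |Real.exp (-a * Q s z)| ≤
      L * C0 * Real.exp (-(a / 4) * ‖z‖ ^ 2) := by
    intro s hs z
    have h := hbd s hs z 1 L hLp (by
      have := (sq_nonneg _).trans (hsq s z)
      rw [abs_one]; nlinarith [mul_nonneg hLp this, sq_nonneg a])
    simpa using h
  have B1 : ∀ s, |s| < 1 → ∀ z, |-2 * a * (z i + s) * Real.exp (-a * Q s z)| ≤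
      L * C0 * Real.exp (-(a / 4) * ‖z‖ ^ 2) := by
    intro s hs z
    refine hbd s hs z _ L hLp ?_
    have h1 := hsq s z
    have h0 := (sq_nonneg _).trans (hsq s z)
    have h2 : |z i + s| ≤ 1 + Q s z := by
      rw [abs_le]; constructor <;> nlinarith [sq_nonneg (z i + s - 1), sq_nonneg (z i + s + 1)]
    rw [abs_mul, abs_mul, abs_of_pos ha]
    norm_num
    have : 2 * a ≤ L := by nlinarith [sq_nonneg a]
    gcongr
  have B2 : ∀ s, |s| < 1 → ∀ z,
      |(4 * a ^ 2 * (z i + s) ^ 2 - 2 * a) * Real.exp (-a * Q s z)| ≤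
      L * C0 * Real.exp (-(a / 4) * ‖z‖ ^ 2) := by
    intro s hs z
    refine hbd s hs z _ L hLp ?_
    have h1 := hsq s z
    have h0 := (sq_nonneg _).trans (hsq s z)
    have h2 : 4 * a ^ 2 * (z i + s) ^ 2 ≤ 4 * a ^ 2 * Q s z := by gcongr
    have h3 : 0 ≤ 4 * a ^ 2 * (z i + s) ^ 2 := by positivity
    have h4 : 0 ≤ a * Q s z := by positivity
    have h5 : 0 ≤ a ^ 2 * Q s z := by positivity
    have h6 := sq_nonneg a
    rw [abs_le, hL]; constructor <;> nlinarith
  have mem : ∀ s, s ∈ Metric.ball (0:ℝ) 1 → |s| < 1 := fun s hs => by simpa using hs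
  have P1 := param_deriv f hf F hF (fun s z => Real.exp (-a * Q s z))
    (fun s z => -2 * a * (z i + s) * Real.exp (-a * Q s z)) 0 1 (L * C0) (a / 4) one_pos
    (by positivity) (fun s => by have := hQc s; fun_prop) (fun s => by have := hQc s; fun_prop)
    (fun s _ z => hQ s z) (B0 0 (by simp)) (fun s hs => B1 s (mem s hs)) x
  have P2 := param_deriv f hf F hF (fun s z => -2 * a * (z i + s) * Real.exp (-a * Q s z))
    (fun s z => (4 * a ^ 2 * (z i + s) ^ 2 - 2 * a) * Real.exp (-a * Q s z)) 0 1
    (L * C0) (a / 4) one_pos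
    (by positivity) (fun s => by have := hQc s; fun_prop) (fun s => by have := hQc s; fun_prop)
    (fun s _ z => hQ2 s z) (B1 0 (by simp)) (fun s hs => B2 s (mem s hs)) x
  have hsh : ∀ (s : ℝ) (y : EuclideanSpace ℝ (Fin d)), x + s • EuclideanSpace.single i (1:ℝ) - y
      = (x - y) + s • EuclideanSpace.single i (1:ℝ) := fun s y => by abel
  refine ⟨?_, ?_, ?_⟩
  · simp only [hsh, norm_sq_line]
    simpa [Q] using P1.2
  · simp only [hsh, norm_sq_line]
    simpa [Q] using P2.2
  · simpa [Q] using P2.1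

lemma time_deriv {d : ℕ} (f : EuclideanSpace ℝ (Fin d) → ℝ) (hf : Continuous f) (F : ℝ)
    (hF : ∀ y, |f y| ≤ F) {ν t : ℝ} (hν : 0 < ν) (ht : 0 < t) (x : EuclideanSpace ℝ (Fin d)) :
    Integrable (fun y => 
      (‖x - y‖ ^ 2 / (4 * ν * t ^ 2)) * Real.exp (-‖x - y‖ ^ 2 / (4 * ν * t)) * f y) ∧
    HasDerivAt (fun s : ℝ => ∫ y, Real.exp (-‖x - y‖ ^ 2 / (4 * ν * s)) * f y)
      (∫ y, (‖x - y‖ ^ 2 / (4 * ν * t ^ 2)) * Real.exp (-‖x - y‖ ^ 2 / (4 * ν * t)) * f y) t := by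
  set b := 1 / (12 * ν * t) with hb
  have hbp : 0 < b := by positivity
  set L := 1 + 1 / (ν * t ^ 2) with hL
  have hLp : 0 < L := by positivity
  have mem : ∀ s, s ∈ Metric.ball t (t / 2) → t / 2 < s ∧ s < 3 * t / 2 := fun s hs => by
    rw [Metric.mem_ball, Real.dist_eq, abs_lt] at hs
    constructor <;> linarith
  have hexp : ∀ s, s ∈ Metric.ball t (t / 2) → ∀ z : EuclideanSpace ℝ (Fin d),
      Real.exp (-‖z‖ ^ 2 / (4 * ν * s)) ≤ Real.exp (-(2 * b) * ‖z‖ ^ 2) := by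
    intro s hs z
    obtain ⟨h1, h2⟩ := mem s hs
    have hs0 : 0 < s := by linarith
    gcongr
    have : 2 * b ≤ 1 / (4 * ν * s) := by
      rw [hb, mul_one_div, div_le_div_iff₀ (by positivity) (by positivity)]
      nlinarith
    have := mul_le_mul_of_nonneg_right this (sq_nonneg ‖z‖)
    rw [neg_div, neg_mul, neg_le_neg_iff]
    calc _ ≤ _ := this
      _ = _ := by ring
  have hall : ∀ s, s ∈ Metric.ball t (t / 2) → ∀ z : EuclideanSpace ℝ (Fin d), ∀ m : ℝ,
      |m| ≤ L * (1 + ‖z‖ ^ 2) → |m * Real.exp (-‖z‖ ^ 2 / (4 * ν * s))| ≤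
      L * (1 + 1 / b) * Real.exp (-b * ‖z‖ ^ 2) := by
    intro s hs z m hm
    rw [abs_mul, Real.abs_exp]
    calc _ ≤ L * (1 + ‖z‖ ^ 2) * Real.exp (-(2 * b) * ‖z‖ ^ 2) :=
          mul_le_mul hm (hexp s hs z) (Real.exp_pos _).le (by positivity)
      _ = L * ((1 + ‖z‖ ^ 2) * Real.exp (-(2 * b) * ‖z‖ ^ 2)) := by ring
      _ ≤ L * ((1 + 1 / b) * Real.exp (-b * ‖z‖ ^ 2)) := by
          have := poly_exp hbp (sq_nonneg ‖z‖)
          gcongr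
      _ = _ := by ring
  refine param_deriv f hf F hF (fun s z => Real.exp (-‖z‖ ^ 2 / (4 * ν * s)))
    (fun s z => (‖z‖ ^ 2 / (4 * ν * s ^ 2)) * Real.exp (-‖z‖ ^ 2 / (4 * ν * s))) t (t / 2)
    (L * (1 + 1 / b)) b (by positivity) hbp (fun s => by fun_prop) (fun s => by fun_prop)
    ?_ ?_ ?_ x
  · intro s hs z
    have hs0 : 0 < s := by linarith [(mem s hs).1]
    have h := ((hasDerivAt_id s).const_mul (4 * ν)).inv (by simp; constructor <;> positivity)
    have h2 := (h.const_mul (-‖z‖ ^ 2)).exp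
    refine (h2.congr_of_eventuallyEq ?_).congr_deriv ?_
    · exact Filter.Eventually.of_forall fun r => by simp [div_eq_mul_inv]
    · simp [div_eq_mul_inv]; field_simp
  · intro z
    have := hall t (Metric.mem_ball_self (by positivity)) z 1 (by
      have : 0 ≤ 1 / (ν * t ^ 2) := by positivity
      rw [abs_one, hL]; nlinarith [sq_nonneg ‖z‖, mul_nonneg this (sq_nonneg ‖z‖)])
    simpa using this
  · intro s hs z
    refine hall s hs z _ ?_
    have h1 := (mem s hs).1
    have hs0 : 0 < s := by linarith
    rw [abs_of_nonneg (by positivity)]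
    have h3 : ν * t ^ 2 ≤ 4 * ν * s ^ 2 := by
      have : t ^ 2 ≤ (2 * s) ^ 2 := by gcongr; linarith
      nlinarith
    calc ‖z‖ ^ 2 / (4 * ν * s ^ 2) ≤ ‖z‖ ^ 2 / (ν * t ^ 2) := by gcongr
      _ = (1 / (ν * t ^ 2)) * ‖z‖ ^ 2 := by ring
      _ ≤ L * (1 + ‖z‖ ^ 2) := by
        have : 1 / (ν * t ^ 2) ≤ L := by rw [hL]; linarith
        gcongr
        linarith

lemma heat_eq {d : ℕ} (f : EuclideanSpace ℝ (Fin d) → ℝ) (hf : Continuous f) (F : ℝ)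
    (hF : ∀ y, |f y| ≤ F) {ν t : ℝ} (hν : 0 < ν) (ht : 0 < t) (x : EuclideanSpace ℝ (Fin d)) :
    ∃ (wt : ℝ) (g H : Fin d → ℝ), HasDerivAt (fun s => heatSG ν s f x) wt t ∧
      (∀ i, D2 (fun s => heatSG ν t f (x + s • EuclideanSpace.single i (1:ℝ))) (g i) (H i)) ∧
      wt = ν * ∑ i, H i := by
  set c : ℝ := (4 * π * ν * t) ^ (-(d:ℝ)/2) with hc
  set a : ℝ := 1 / (4 * ν * t) with ha
  have hap : 0 < a := by positivity
  have hform : ∀ s, 0 < s → ∀ x, heatSG ν s f x = (4 * π * ν * s) ^ (-(d:ℝ)/2) *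
      ∫ y, Real.exp (-‖x - y‖ ^ 2 / (4 * ν * s)) * f y := by
    intro s hs x
    rw [heatSG, if_neg hs.ne', ← integral_const_mul]
    congr 1; ext y; ring
  have hea : ∀ q : ℝ, -q / (4 * ν * t) = -a * q := fun q => by rw [ha]; ring
  have hform2 : ∀ x, heatSG ν t f x = c * ∫ y, Real.exp (-a * ‖x - y‖ ^ 2) * f y := by
    intro x; rw [hform t ht x]; simp only [hea, hc]
  obtain ⟨hi, hJ⟩ := time_deriv f hf F hF hν ht x
  have hcd : HasDerivAt (fun s => (4 * π * ν * s) ^ (-(d:ℝ)/2)) (c * (-(d:ℝ) / (2 * t))) t := by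
    have h := ((hasDerivAt_id t).const_mul (4 * π * ν)).rpow_const (p := -(d:ℝ)/2)
      (Or.inl (by simp only [id]; positivity))
    refine h.congr_deriv ?_
    simp only [id]
    rw [Real.rpow_sub_one (by positivity), ← hc]
    field_simp
  have hG0 : Integrable (fun y => Real.exp (-a * ‖x - y‖ ^ 2) * f y) := by
    refine ((((gauss_integrable hap).comp_sub_left x)).mul_const F).mono'
      (Continuous.aestronglyMeasurable (by fun_prop)) (Filter.Eventually.of_forall fun y => ?_)
    rw [Real.norm_eq_abs, abs_mul, Real.abs_exp]
    exact mul_le_mul_of_nonneg_left (hF y) (Real.exp_pos _).le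
  refine ⟨_, fun i => c * ∫ y, (-2 * a * (x - y) i) * Real.exp (-a * ‖x - y‖ ^ 2) * f y,
    fun i => c * ∫ y, (4 * a ^ 2 * ((x - y) i) ^ 2 - 2 * a) * Real.exp (-a * ‖x - y‖ ^ 2) * f y,
    (hcd.mul hJ).congr_of_eventuallyEq ?_, fun i => ?_, ?_⟩
  · filter_upwards [lt_mem_nhds ht] with s hs
    rw [hform s hs]; rfl
  · refine ⟨fun s => c * ∫ y, (-2 * a * (x + s • EuclideanSpace.single i (1:ℝ) - y) i)
        * Real.exp (-a * ‖x + s • EuclideanSpace.single i (1:ℝ) - y‖ ^ 2) * f y,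
      fun s => ?_, by simp, (space_deriv f hf F hF hap i x).2.1.const_mul c⟩
    simp only [hform2]
    have h := (space_deriv f hf F hF hap i (x + s • EuclideanSpace.single i (1:ℝ))).1
    rw [← sub_self s] at h
    have h2 := (h.comp_sub_const s s).const_mul c
    refine h2.congr_of_eventuallyEq (Filter.Eventually.of_forall fun r => ?_)
    have : ∀ y, x + s • EuclideanSpace.single i (1:ℝ) + (r - s) • EuclideanSpace.single i (1:ℝ) - y
        = x + r • EuclideanSpace.single i (1:ℝ) - y := fun y => by
      rw [sub_smul]; abel
    simp only [this]
  · rw [← Finset.mul_sum, ← integral_finsetSum _ fun i _ => (space_deriv f hf F hF hap i x).2.2]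
    simp only [hea] at hi ⊢
    rw [mul_left_comm ν c, ← hc, mul_assoc c, ← mul_add, ← integral_const_mul, ← integral_const_mul,
      ← integral_add (hG0.const_mul _) hi]
    refine congrArg (fun r => c * r)
      (integral_congr_ae (Filter.Eventually.of_forall fun y => ?_))
    simp only
    rw [← Finset.sum_mul, ← Finset.sum_mul, Finset.sum_sub_distrib, ← Finset.mul_sum,
      ← norm_sq_sum]
    simp only [Finset.sum_const, Finset.card_univ, Fintype.card_fin, nsmul_eq_mul, ha]
    field_simp
    ring

lemma heat_form {d : ℕ} (f : EuclideanSpace ℝ (Fin d) → ℝ) {ν t : ℝ} (hν : 0 < ν) (ht : 0 ≤ t)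
    (x : EuclideanSpace ℝ (Fin d)) :
    heatSG ν t f x = π ^ (-(d:ℝ)/2) *
      ∫ z, Real.exp (-1 * ‖z‖ ^ 2) * f (x + Real.sqrt (4 * ν * t) • z) := by
  have hpi : π ^ (-(d:ℝ)/2) * π ^ ((d:ℝ)/2) = 1 := by
    rw [← Real.rpow_add Real.pi_pos]; ring_nf; simp
  rcases ht.eq_or_lt with h | h
  · subst h
    simp only [heatSG, if_true, mul_zero, Real.sqrt_zero, zero_smul, add_zero]
    rw [integral_mul_const, GaussianFourier.integral_rexp_neg_mul_sq_norm one_pos, ← mul_assoc]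
    simp [hpi]
  · have hr2 : Real.sqrt (4 * ν * t) ^ 2 = 4 * ν * t := Real.sq_sqrt (by positivity)
    have hr : 0 < Real.sqrt (4 * ν * t) := Real.sqrt_pos.2 (by positivity)
    set r := Real.sqrt (4 * ν * t) with hrdef
    have h1 := Measure.integral_comp_smul (volume : Measure (EuclideanSpace ℝ (Fin d)))
      (fun w => Real.exp (-‖w‖ ^ 2 / r ^ 2) * f (x + w)) r
    have h2 : ∀ z : EuclideanSpace ℝ (Fin d), Real.exp (-‖r • z‖ ^ 2 / r ^ 2) * f (x + r • z)
        = Real.exp (-1 * ‖z‖ ^ 2) * f (x + r • z) := by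
      intro z
      congr 2
      rw [norm_smul, Real.norm_of_nonneg hr.le]
      field_simp
    simp only [h2] at h1
    rw [h1, heatSG, if_neg h.ne']
    have h3 : ∫ w, Real.exp (-‖w‖ ^ 2 / r ^ 2) * f (x + w)
        = ∫ y, Real.exp (-‖x - y‖ ^ 2 / r ^ 2) * f y := by
      rw [← integral_add_left_eq_self (fun y => Real.exp (-‖x - y‖ ^ 2 / r ^ 2) * f y) x]
      simp
    rw [h3, hr2]
    have h4 : (4 * π * ν * t) ^ (-(d:ℝ)/2) = π ^ (-(d:ℝ)/2) * (r ^ d)⁻¹ := by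
      have : 4 * π * ν * t = π * r ^ 2 := by rw [hr2]; ring
      rw [this, Real.mul_rpow Real.pi_pos.le (by positivity)]
      congr 1
      rw [← Real.rpow_natCast, ← Real.rpow_natCast, ← Real.rpow_mul hr.le, ← Real.rpow_neg hr.le]
      congr 1; push_cast; ring
    simp only [mul_assoc (((4:ℝ) * π * ν * t) ^ (-(d:ℝ)/2))]
    rw [integral_const_mul, h4]
    rw [finrank_euclideanSpace_fin, abs_of_pos (by positivity), smul_eq_mul]
    ring

lemma heat_cont {d : ℕ} (f : EuclideanSpace ℝ (Fin d) → ℝ) (hf : Continuous f) (F : ℝ)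
    (hF : ∀ y, |f y| ≤ F) {ν T : ℝ} (hν : 0 < ν) :
    ContinuousOn (fun p : ℝ × EuclideanSpace ℝ (Fin d) => heatSG ν p.1 f p.2)
      (Set.Icc 0 T ×ˢ Set.univ) := by
  have : Continuous (fun p : ℝ × EuclideanSpace ℝ (Fin d) => π ^ (-(d:ℝ)/2) *
      ∫ z, Real.exp (-1 * ‖z‖ ^ 2) * f (p.2 + Real.sqrt (4 * ν * p.1) • z)) := by
    refine Continuous.mul continuous_const ?_
    refine continuous_of_dominated (bound := fun z => Real.exp (-1 * ‖z‖ ^ 2) * F) ?_ ?_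
      ((gauss_integrable one_pos).mul_const F) ?_
    · intro p
      exact Continuous.aestronglyMeasurable (by fun_prop)
    · intro p
      refine Filter.Eventually.of_forall fun y => ?_
      rw [Real.norm_eq_abs, abs_mul, Real.abs_exp]
      exact mul_le_mul_of_nonneg_left (hF _) (Real.exp_pos _).le
    · exact Filter.Eventually.of_forall fun z => by fun_prop
  refine this.continuousOn.congr fun p hp => ?_
  exact heat_form f hν hp.1.1 p.2

lemma heat_nonneg {d : ℕ} (f : EuclideanSpace ℝ (Fin d) → ℝ) (hf : ∀ y, 0 ≤ f y) {ν t : ℝ}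
    (hν : 0 < ν) (ht : 0 ≤ t) (x : EuclideanSpace ℝ (Fin d)) : 0 ≤ heatSG ν t f x := by
  rw [heat_form f hν ht x]
  exact mul_nonneg (by positivity) (integral_nonneg fun z => mul_nonneg (Real.exp_pos _).le (hf _))

lemma heat_nonpos {d : ℕ} (f : EuclideanSpace ℝ (Fin d) → ℝ) (hf : ∀ y, f y ≤ 0) {ν t : ℝ}
    (hν : 0 < ν) (ht : 0 ≤ t) (x : EuclideanSpace ℝ (Fin d)) : heatSG ν t f x ≤ 0 := by
  rw [heat_form f hν ht x]
  exact mul_nonpos_of_nonneg_of_nonpos (by positivity)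
    (integral_nonpos fun z => mul_nonpos_of_nonneg_of_nonpos (Real.exp_pos _).le (hf _))

lemma contDiff_D2 {d : ℕ} {u : EuclideanSpace ℝ (Fin d) → ℝ} (hu : ContDiff ℝ 2 u)
    (x : EuclideanSpace ℝ (Fin d)) (i : Fin d) :
    D2 (fun s => u (x + s • EuclideanSpace.single i (1:ℝ))) (gradient u x i)
      (iteratedFDeriv ℝ 2 u x ![EuclideanSpace.single i (1:ℝ), EuclideanSpace.single i (1:ℝ)]) := by
  set e : EuclideanSpace ℝ (Fin d) := EuclideanSpace.single i (1:ℝ) with he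
  have hl : ∀ s : ℝ, HasDerivAt (fun s : ℝ => x + s • e) e s := fun s => by
    simpa using ((hasDerivAt_id s).smul_const e).const_add x
  have hu1 : Differentiable ℝ u := hu.differentiable (by norm_num)
  have hu2 : Differentiable ℝ (fderiv ℝ u) :=
    (hu.fderiv_right (m := 1) (by norm_num)).differentiable (by norm_num)
  refine ⟨fun s => fderiv ℝ u (x + s • e) e, fun s => ?_, ?_, ?_⟩
  · exact (hu1 _).hasFDerivAt.comp_hasDerivAt s (hl s)
  · simp only [zero_smul, add_zero]
    have : inner ℝ (gradient u x) e = fderiv ℝ u x e := by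
      simp [gradient]
    rw [← this, he, EuclideanSpace.inner_single_right]; simp
  · rw [iteratedFDeriv_two_apply]
    have h := (hu2 (x + (0:ℝ) • e)).hasFDerivAt.comp_hasDerivAt 0 (hl 0)
    have h2 := h.clm_apply (hasDerivAt_const (0:ℝ) e)
    simpa using h2

theorem statement1 {d : ℕ} (hd : 1 ≤ d)
    (V : EuclideanSpace ℝ (Fin d) → ℝ) (W : ℝ → ℝ) (hV : IsDepositionRate d V W)
    (ν lam T : ℝ) (hν : 0 < ν) (hlam : 0 < lam) (hT : 0 < T)
    (h₀ : EuclideanSpace ℝ (Fin d) → ℝ) (h : ℝ → EuclideanSpace ℝ (Fin d) → ℝ)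
    (hh₀ : MemW1inf h₀) (hsol : IsClassicalSolution ν lam T V h₀ h) :
    ((∀ x, h₀ x ≤ 0) → ∀ t ∈ Set.Icc (0:ℝ) T, ∀ x,
        heatSG ν t h₀ x ≤ h t x ∧ h t x ≤ 0) ∧
    ((∀ x, 0 ≤ h₀ x) → ∀ t ∈ Set.Ioc (0:ℝ) T, ∀ x,
        0 ≤ h t x ∧
        h t x ≤ (ν / lam) *
          Real.log (heatSG ν t (fun y => Real.exp ((lam / ν) * h₀ y)) x)) := by
  have hV0 : ∀ p, 0 ≤ V p := fun p => by
    rw [hV.isotropic]; exact hV.nonneg _ (norm_nonneg _)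
  have hV2 : ∀ p, V p ≤ ‖p‖ ^ 2 := fun p => by
    rw [hV.isotropic]; exact hV.quadGrowth _ (norm_nonneg _)
  obtain ⟨C, hC⟩ := hsol.bdd
  obtain ⟨G, hG⟩ := hsol.grad_bdd
  obtain ⟨F, hF⟩ := hh₀.bdd
  have hcont0 : Continuous h₀ := hh₀.diff.continuous
  have hGp : 0 ≤ G := (norm_nonneg _).trans (hG 0 ⟨le_rfl, hT.le⟩ 0)
  have hht : ∀ t ∈ Set.Ioc (0:ℝ) T, ∀ x, HasDerivAt (fun s => h s x)
      (ν * lapl (h t) x + lam * V (gradient (h t) x)) t := fun t ht x => by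
    rw [← hsol.pde t ht x]; exact (hsol.time_reg x t ht).hasDerivAt
  refine ⟨fun hneg t ht x => ⟨?_, ?_⟩, fun hpos t ht x => ⟨?_, ?_⟩⟩
  · have := max_principle hd ν 0 T C hν le_rfl (fun t x => heatSG ν t h₀ x - h t x)
      ((heat_cont h₀ hcont0 F hF hν).sub hsol.cont)
      (fun t ht x => by
        have h1 := heat_nonpos h₀ hneg hν ht.1 x
        have h2 := (abs_le.1 (hC t ht x)).1
        linarith)
      (fun x => by simp [heatSG, hsol.init])
      (fun t ht x => by
        obtain ⟨wt, g, H, a1, a2, a3⟩ := heat_eq h₀ hcont0 F hF hν ht.1 x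
        refine ⟨_, _, _, a1.sub (hht t ht x), fun i =>
          (a2 i).sub (contDiff_D2 (hsol.space_reg t ht) x i), ?_⟩
        rw [Finset.sum_sub_distrib, a3]
        have := mul_nonneg hlam.le (hV0 (gradient (h t) x))
        simp only [lapl]
        linarith) t ht x
    linarith
  · exact max_principle hd ν (lam * G) T C hν (by positivity) h hsol.cont
      (fun t ht x => (abs_le.1 (hC t ht x)).2)
      (fun x => by rw [hsol.init]; exact hneg x)
      (fun t ht x => by
        refine ⟨_, _, _, hht t ht x, fun i => contDiff_D2 (hsol.space_reg t ht) x i, ?_⟩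
        have h1 := hG t ⟨ht.1.le, ht.2⟩ x
        have h2 : ‖gradient (h t) x‖ ≤ ∑ i, |gradient (h t) x i| := by
          refine abs_le_of_sq_le_sq' ?_ (Finset.sum_nonneg fun i _ => abs_nonneg _) |>.2
          rw [norm_sq_sum]
          calc ∑ i, gradient (h t) x i ^ 2 = ∑ i, |gradient (h t) x i| ^ 2 := by simp
            _ ≤ _ := Finset.sum_sq_le_sq_sum_of_nonneg fun i _ => abs_nonneg _
        have h3 : V (gradient (h t) x) ≤ G * ∑ i, |gradient (h t) x i| := by
          refine (hV2 _).trans ?_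
          rw [sq]
          exact mul_le_mul h1 h2 (norm_nonneg _) hGp
        have := mul_le_mul_of_nonneg_left h3 hlam.le
        simp only [lapl]
        linarith) t ht x
  · have := max_principle hd ν 0 T C hν le_rfl (fun t x => - h t x)
      hsol.cont.neg
      (fun t ht x => by
        have h2 := (abs_le.1 (hC t ht x)).1
        linarith)
      (fun x => by simpa [hsol.init] using hpos x)
      (fun t ht x => by
        refine ⟨_, _, _, (hht t ht x).neg, fun i =>
          (contDiff_D2 (hsol.space_reg t ht) x i).neg, ?_⟩
        rw [Finset.sum_neg_distrib]
        have := mul_nonneg hlam.le (hV0 (gradient (h t) x))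
        simp only [lapl]
        linarith) t ⟨ht.1.le, ht.2⟩ x
    linarith
  · set a := lam / ν with ha
    have hap : 0 < a := by positivity
    have haν : a * ν = lam := by rw [ha]; field_simp
    have hfc : Continuous (fun y => Real.exp (a * h₀ y)) := by fun_prop
    have hfF : ∀ y, |Real.exp (a * h₀ y)| ≤ Real.exp (a * F) := fun y => by
      rw [Real.abs_exp]
      have := (abs_le.1 (hF y)).2
      gcongr
    have key := max_principle hd ν 0 T (Real.exp (a * C)) hν le_rfl
      (fun t x => Real.exp (a * h t x) - heatSG ν t (fun y => Real.exp (a * h₀ y)) x)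
      ((hsol.cont.const_smul a).rexp.sub (heat_cont _ hfc _ hfF hν))
      (fun t ht x => by
        have h1 := heat_nonneg (fun y => Real.exp (a * h₀ y)) (fun y => (Real.exp_pos _).le)
          hν ht.1 x
        have h2 := (abs_le.1 (hC t ht x)).2
        have : Real.exp (a * h t x) ≤ Real.exp (a * C) := by gcongr
        linarith)
      (fun x => by simp [heatSG, hsol.init])
      (fun t ht x => by
        obtain ⟨wt, g, H, a1, a2, a3⟩ := heat_eq _ hfc _ hfF hν ht.1 x
        refine ⟨_, _, _, (((hht t ht x).const_mul a).exp).sub a1, fun i =>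
          ((contDiff_D2 (hsol.space_reg t ht) x i).exp_mul a).sub (a2 i), ?_⟩
        simp only [zero_smul, add_zero, zero_mul]
        rw [Finset.sum_sub_distrib, a3, Finset.sum_add_distrib]
        have e1 : ∑ i, Real.exp (a * h t x) * (a * gradient (h t) x i) * (a * gradient (h t) x i)
            = Real.exp (a * h t x) * a ^ 2 * ‖gradient (h t) x‖ ^ 2 := by
          rw [norm_sq_sum, Finset.mul_sum]
          exact Finset.sum_congr rfl fun i _ => by ring
        rw [e1, ← Finset.mul_sum, ← Finset.mul_sum]
        change _ ≤ ν * (_ + Real.exp (a * h t x) * (a * lapl (h t) x) - _)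
        have h5 : Real.exp (a * h t x) * a * lam * V (gradient (h t) x)
          ≤ Real.exp (a * h t x) * a * lam * ‖gradient (h t) x‖ ^ 2 :=
          mul_le_mul_of_nonneg_left (hV2 _) (by positivity)
        have h6 : ν * (Real.exp (a * h t x) * a ^ 2 * ‖gradient (h t) x‖ ^ 2)
          = Real.exp (a * h t x) * a * lam * ‖gradient (h t) x‖ ^ 2 := by rw [← haν]; ring
        nlinarith) t ⟨ht.1.le, ht.2⟩ x
    have k1 : Real.exp (a * h t x) ≤ heatSG ν t (fun y => Real.exp (a * h₀ y)) x := by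
      linarith
    have k2 := Real.log_le_log (Real.exp_pos _) k1
    rw [Real.log_exp] at k2
    have k3 : ν / lam * (a * h t x) = h t x := by rw [ha]; field_simp
    calc h t x = ν / lam * (a * h t x) := k3.symm
      _ ≤ _ := by gcongr
end
end

section
/- There is a constant C > 0 depending only on the dimension d such that the following holds. Let h be a classical solution on [0,T] of the homogeneous KPZ equation ∂ₜh = νΔh + λV(∇h) with initial condition h₀ ∈ W^{1,∞}(ℝ^d) ∩ L¹(ℝ^d), and set Ī := ‖h₀⁻‖₁ + ‖h₀⁺‖₁·e^{(λ/ν)‖h₀⁺‖_∞}. Then for every t ∈ [0,T], ‖h(t,·)‖₁ ≤ C·Ī, and for every t ∈ (0,T], ‖h(t,·)‖_∞ ≤ C·Ī·(νt)^{−d/2}. -/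
open MeasureTheory Real Set
open scoped ENNReal

noncomputable section

/-- pointwise subsolution data for the heat equation -/
def SubAt {d : ℕ} (ν : ℝ) (f : ℝ → EuclideanSpace ℝ (Fin d) → ℝ) (t : ℝ)
    (x : EuclideanSpace ℝ (Fin d)) : Prop :=
  ∃ (ft : ℝ) (g : Fin d → ℝ → ℝ) (a : Fin d → ℝ),
    HasDerivAt (fun s => f s x) ft t ∧
    (∀ i r, HasDerivAt (fun r : ℝ => f t (x + r • EuclideanSpace.single i (1:ℝ))) (g i r) r) ∧
    (∀ i, HasDerivAt (g i) (a i) 0) ∧ ft ≤ ν * ∑ i, a i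

lemma SubAt.add {d : ℕ} {ν : ℝ} {f k : ℝ → EuclideanSpace ℝ (Fin d) → ℝ} {t : ℝ}
    {x : EuclideanSpace ℝ (Fin d)} (hf : SubAt ν f t x) (hk : SubAt ν k t x) {c : ℝ}
    (hc : 0 ≤ c) : SubAt ν (fun t x => f t x + c * k t x) t x := by
  obtain ⟨ft, g, a, h1, h2, h3, h4⟩ := hf
  obtain ⟨kt, g', a', h1', h2', h3', h4'⟩ := hk
  refine ⟨ft + c * kt, fun i r => g i r + c * g' i r, fun i => a i + c * a' i,
    h1.add (h1'.const_mul c), fun i r => (h2 i r).add ((h2' i r).const_mul c),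
    fun i => (h3 i).add ((h3' i).const_mul c), ?_⟩
  rw [Finset.sum_add_distrib, ← Finset.mul_sum]
  nlinarith [mul_le_mul_of_nonneg_left h4' hc]

lemma second_test {g g' : ℝ → ℝ} {a : ℝ} (h1 : ∀ r, HasDerivAt g (g' r) r)
    (h2 : HasDerivAt g' a 0) (hm : ∀ r, g r ≤ g 0) : a ≤ 0 := by
  by_contra! ha
  have hd : deriv g = g' := funext fun r => (h1 r).deriv
  have hmax : IsLocalMax g 0 := Filter.Eventually.of_forall hm
  have h0 : deriv g 0 = 0 := hmax.deriv_eq_zero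
  have hmin : IsLocalMin g 0 := isLocalMin_of_deriv_deriv_pos
    (by rw [hd, h2.deriv]; exact ha) h0 (h1 0).continuousAt
  have hc : g =ᶠ[nhds 0] fun _ => g 0 := by
    filter_upwards [hmin] with r hr
    exact le_antisymm (hm r) hr
  have := hc.deriv
  rw [hd] at this
  have h3 := this.deriv_eq
  rw [h2.deriv] at h3
  simp at h3
  linarith

lemma left_test {g : ℝ → ℝ} {a t : ℝ} (ht : 0 < t) (h1 : HasDerivAt g a t)
    (hm : ∀ s ∈ Icc 0 t, g s ≤ g t) : 0 ≤ a := by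
  have h2 := h1.hasDerivWithinAt (s := Iio t)
  rw [hasDerivWithinAt_iff_tendsto_slope' (by simp)] at h2
  refine ge_of_tendsto h2 ?_
  have : Ioo 0 t ∈ nhdsWithin t (Iio t) := Ioo_mem_nhdsLT ht
  filter_upwards [this] with s hs
  rw [slope_def_field]
  have := hm s ⟨hs.1.le, hs.2.le⟩
  exact div_nonneg_of_nonpos (by linarith) (by linarith [hs.2])

lemma max_principle_s2 {d : ℕ} {ν T M : ℝ} (hν : 0 < ν) (hT : 0 < T)
    {f : ℝ → EuclideanSpace ℝ (Fin d) → ℝ}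
    (hc : ContinuousOn (fun p : ℝ × EuclideanSpace ℝ (Fin d) => f p.1 p.2) (Icc 0 T ×ˢ univ))
    (hM : ∀ t ∈ Icc 0 T, ∀ x, f t x ≤ M) (h0 : ∀ x, f 0 x ≤ 0)
    (hs : ∀ t ∈ Ioc 0 T, ∀ x, SubAt ν f t x) :
    ∀ t ∈ Icc 0 T, ∀ x, f t x ≤ 0 := by
  intro t ht x
  have key : ∀ ε > 0, f t x - ε * (‖x‖ ^ 2 + (2 * d * ν + 1) * t) ≤ 0 := by
    intro ε hε
    by_contra! hpos
    set v : ℝ × EuclideanSpace ℝ (Fin d) → ℝ :=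
      fun p => f p.1 p.2 - ε * (‖p.2‖ ^ 2 + (2 * d * ν + 1) * p.1) with hv
    have hvc : ContinuousOn v (Icc 0 T ×ˢ univ) :=
      hc.sub (Continuous.continuousOn (by fun_prop))
    set R := √(|M| / ε) + ‖x‖ with hR
    have hRn : 0 ≤ R := by positivity
    have hxR : ‖x‖ ≤ R := by rw [hR]; linarith [Real.sqrt_nonneg (|M| / ε)]
    obtain ⟨⟨t', x'⟩, hp, hmax⟩ := (isCompact_Icc.prod
      (isCompact_closedBall (0 : EuclideanSpace ℝ (Fin d)) R)).exists_isMaxOn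
      ⟨(t, x), ht, by simpa using hxR⟩
      (hvc.mono (prod_mono_right (subset_univ _)))
    have ht' : t' ∈ Icc 0 T := hp.1
    have hvpos : 0 < v (t', x') :=
      lt_of_lt_of_le hpos (hmax (show (t, x) ∈ _ from ⟨ht, by simpa using hxR⟩))
    have hglob : ∀ s ∈ Icc 0 T, ∀ y, v (s, y) ≤ v (t', x') := by
      intro s hs y
      by_cases hy : ‖y‖ ≤ R
      · exact hmax (show (s, y) ∈ _ from ⟨hs, by simpa using hy⟩)
      · push Not at hy
        refine le_trans ?_ hvpos.le
        have h1 := hM s hs y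
        have h2 : |M| / ε ≤ ‖y‖ ^ 2 := by
          rw [← Real.sqrt_le_left (norm_nonneg _)]
          linarith [norm_nonneg x]
        rw [div_le_iff₀ hε] at h2
        have h3 : 0 ≤ ε * ((2 * d * ν + 1) * s) := by
          have := hs.1
          positivity
        simp only [hv]
        nlinarith [le_abs_self M]
    rcases eq_or_lt_of_le ht'.1 with h | h
    · have := h0 x'
      simp only [hv, ← h] at hvpos
      have : 0 ≤ ε * (‖x'‖ ^ 2 + (2 * d * ν + 1) * 0) := by positivity
      linarith
    · obtain ⟨ft, g, a, h1, h2, h3, h4⟩ := hs t' ⟨h, ht'.2⟩ x'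
      have e1 : 0 ≤ ft - ε * (2 * d * ν + 1) := by
        refine left_test (g := fun s => v (s, x')) h ?_ (fun s hs => hglob s ⟨hs.1, hs.2.trans ht'.2⟩ x')
        have h5 : HasDerivAt (fun s : ℝ => (2 * d * ν + 1) * s) (2 * d * ν + 1) t' := by
          simpa using (hasDerivAt_id t').const_mul (2 * d * ν + 1)
        have h6 := (h5.const_add (‖x'‖ ^ 2)).const_mul ε
        exact h1.sub h6
      have e2 : ∀ i, a i - ε * 2 ≤ 0 := by
        intro i
        set e : EuclideanSpace ℝ (Fin d) := EuclideanSpace.single i (1:ℝ) with he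
        have hl : ∀ r : ℝ, HasDerivAt (fun r : ℝ => x' + r • e) e r := fun r => by
          simpa using ((hasDerivAt_id r).smul_const e).const_add x'
        refine second_test (g := fun r => v (t', x' + r • e))
          (g' := fun r => g i r - ε * (2 * (inner ℝ (x' + r • e) e))) ?_ ?_
          (fun r => by simpa using hglob t' ht' _)
        · intro r
          have h6 := ((hl r).norm_sq.add_const ((2 * d * ν + 1) * t')).const_mul ε
          exact (h2 i r).sub h6
        · refine (h3 i).sub (HasDerivAt.const_mul ε ?_)
          have := ((hl 0).inner ℝ (hasDerivAt_const (0:ℝ) e)).const_mul 2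
          simpa [he] using this
      have e3 : ∑ i, a i ≤ d * (ε * 2) := by
        calc ∑ i, a i ≤ ∑ i : Fin d, ε * 2 := Finset.sum_le_sum fun i _ => by linarith [e2 i]
          _ = d * (ε * 2) := by simp
      nlinarith [mul_le_mul_of_nonneg_left e3 hν.le]
  set B := ‖x‖ ^ 2 + (2 * d * ν + 1) * t with hB
  have hB0 : 0 ≤ B := by have := ht.1; positivity
  refine le_of_forall_pos_le_add fun δ hδ => ?_
  have := key (δ / (B + 1)) (by positivity)
  have h2 : δ / (B + 1) * B ≤ δ := by
    rw [div_mul_eq_mul_div, div_le_iff₀ (by positivity)]; nlinarith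
  linarith

lemma exp_bd {q : ℝ} (hq : 0 ≤ q) : q * exp (-q) ≤ 1 ∧ exp (-q) ≤ 1 := by
  constructor
  · have := Real.add_one_le_exp q
    rw [Real.exp_neg, ← div_eq_mul_inv, div_le_one (exp_pos q)]; linarith
  · simpa using hq

def Kc (d : ℕ) (s : ℝ) : ℝ := (π * s) ^ (-(d:ℝ) / 2)

def Kf {d : ℕ} (s : ℝ) (z : EuclideanSpace ℝ (Fin d)) : ℝ := Kc d s * exp (-(‖z‖ ^ 2 / s))

def Kt {d : ℕ} (s : ℝ) (z : EuclideanSpace ℝ (Fin d)) : ℝ :=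
  (‖z‖ ^ 2 / s ^ 2 - d / (2 * s)) * Kf s z

def K1 {d : ℕ} (i : Fin d) (s : ℝ) (z : EuclideanSpace ℝ (Fin d)) : ℝ :=
  (-(2 * z i) / s) * Kf s z

def K2 {d : ℕ} (i : Fin d) (s : ℝ) (z : EuclideanSpace ℝ (Fin d)) : ℝ :=
  (4 * z i ^ 2 / s ^ 2 - 2 / s) * Kf s z

lemma Kc_pos (d : ℕ) {s : ℝ} (hs : 0 < s) : 0 < Kc d s := by
  unfold Kc; positivity

lemma Kc_anti (d : ℕ) {s t : ℝ} (hs : 0 < s) (h : s ≤ t) : Kc d t ≤ Kc d s := by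
  unfold Kc
  refine Real.rpow_le_rpow_of_nonpos (by positivity) (by gcongr) ?_
  have : (0:ℝ) ≤ d := by positivity
  linarith

lemma sum_K2 {d : ℕ} {s : ℝ} (hs : 0 < s) (z : EuclideanSpace ℝ (Fin d)) :
    ∑ i, K2 i s z = 4 * Kt s z := by
  unfold K2 Kt
  rw [← Finset.sum_mul, EuclideanSpace.real_norm_sq_eq, Finset.sum_sub_distrib, ← Finset.sum_div,
    ← Finset.mul_sum]
  simp
  field_simp
  ring

lemma Kf_bd {d : ℕ} {s : ℝ} (hs : 0 < s) (z : EuclideanSpace ℝ (Fin d)) :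
    |Kf s z| ≤ Kc d s := by
  unfold Kf
  have := Kc_pos d hs
  rw [abs_of_pos (by positivity)]
  have := (exp_bd (q := ‖z‖ ^ 2 / s) (by positivity)).2
  nlinarith

lemma Kt_bd {d : ℕ} {s : ℝ} (hs : 0 < s) (z : EuclideanSpace ℝ (Fin d)) :
    |Kt s z| ≤ (d / 2 + 1) / s * Kc d s := by
  have hK := Kc_pos d hs
  obtain ⟨h1, h2⟩ := exp_bd (q := ‖z‖ ^ 2 / s) (by positivity)
  have e : Kt s z = (‖z‖ ^ 2 / s * exp (-(‖z‖ ^ 2 / s)) - d / 2 * exp (-(‖z‖ ^ 2 / s))) / s * Kc d s := by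
    unfold Kt Kf; field_simp
  rw [e, abs_mul, abs_div, abs_of_pos hK, abs_of_pos hs]
  gcongr
  have h3 : 0 ≤ ‖z‖ ^ 2 / s * exp (-(‖z‖ ^ 2 / s)) := by positivity
  have h4 := exp_pos (-(‖z‖ ^ 2 / s))
  have h5 : (0:ℝ) ≤ d / 2 := by positivity
  rw [abs_le]
  constructor <;> nlinarith

lemma sq_le_norm {d : ℕ} (i : Fin d) (z : EuclideanSpace ℝ (Fin d)) : z i ^ 2 ≤ ‖z‖ ^ 2 := by
  rw [EuclideanSpace.real_norm_sq_eq]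
  exact Finset.single_le_sum (f := fun i => z i ^ 2) (fun j _ => sq_nonneg _) (Finset.mem_univ i)

lemma K1_bd {d : ℕ} {s : ℝ} (hs : 0 < s) (i : Fin d) (z : EuclideanSpace ℝ (Fin d)) :
    |K1 i s z| ≤ 2 * (1 + s) / s * Kc d s := by
  have hK := Kc_pos d hs
  obtain ⟨h1, h2⟩ := exp_bd (q := ‖z‖ ^ 2 / s) (by positivity)
  unfold K1 Kf
  have h4 := exp_pos (-(‖z‖ ^ 2 / s))
  rw [abs_mul, abs_div, abs_of_pos hs, abs_of_pos (by positivity : 0 < Kc d s * exp (-(‖z‖ ^ 2 / s))),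
    abs_neg, abs_mul, abs_two]
  have h5 : |z i| ≤ 1 + ‖z‖ ^ 2 := by
    have := sq_le_norm i z
    rw [← sq_abs] at this
    nlinarith [sq_nonneg (|z i| - 1)]
  have h6 : ‖z‖ ^ 2 * exp (-(‖z‖ ^ 2 / s)) ≤ s := by
    rw [div_mul_eq_mul_div, div_le_one hs] at h1; exact h1
  have h7 : |z i| * exp (-(‖z‖ ^ 2 / s)) ≤ 1 + s := by nlinarith
  calc 2 * |z i| / s * (Kc d s * exp (-(‖z‖ ^ 2 / s)))
      = 2 * (|z i| * exp (-(‖z‖ ^ 2 / s))) / s * Kc d s := by ring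
    _ ≤ _ := by gcongr

lemma K2_bd {d : ℕ} {s : ℝ} (hs : 0 < s) (i : Fin d) (z : EuclideanSpace ℝ (Fin d)) :
    |K2 i s z| ≤ 6 / s * Kc d s := by
  have hK := Kc_pos d hs
  obtain ⟨h1, h2⟩ := exp_bd (q := ‖z‖ ^ 2 / s) (by positivity)
  have e : K2 i s z = (4 * (z i ^ 2 / s * exp (-(‖z‖ ^ 2 / s))) - 2 * exp (-(‖z‖ ^ 2 / s))) / s * Kc d s := by
    unfold K2 Kf; field_simp
  rw [e, abs_mul, abs_div, abs_of_pos hK, abs_of_pos hs]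
  gcongr
  have h3 : 0 ≤ z i ^ 2 / s * exp (-(‖z‖ ^ 2 / s)) := by positivity
  have h4 := exp_pos (-(‖z‖ ^ 2 / s))
  have h5 : z i ^ 2 / s * exp (-(‖z‖ ^ 2 / s)) ≤ 1 := le_trans
    (mul_le_mul_of_nonneg_right (div_le_div_of_nonneg_right (sq_le_norm i z) hs.le) h4.le) h1
  rw [abs_le]
  constructor <;> nlinarith

lemma Kf_cont {d : ℕ} (s : ℝ) : Continuous (fun z : EuclideanSpace ℝ (Fin d) => Kf s z) := by
  unfold Kf; fun_prop

lemma Kt_cont {d : ℕ} (s : ℝ) : Continuous (fun z : EuclideanSpace ℝ (Fin d) => Kt s z) := by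
  unfold Kt; have := Kf_cont (d := d) s; fun_prop

lemma K1_cont {d : ℕ} (i : Fin d) (s : ℝ) :
    Continuous (fun z : EuclideanSpace ℝ (Fin d) => K1 i s z) := by
  unfold K1; have := Kf_cont (d := d) s; fun_prop

lemma K2_cont {d : ℕ} (i : Fin d) (s : ℝ) :
    Continuous (fun z : EuclideanSpace ℝ (Fin d) => K2 i s z) := by
  unfold K2; have := Kf_cont (d := d) s; fun_prop

lemma Kf_dt {d : ℕ} {s : ℝ} (hs : 0 < s) (z : EuclideanSpace ℝ (Fin d)) :
    HasDerivAt (fun s => Kf s z) (Kt s z) s := by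
  have hπ := Real.pi_pos
  have h1 : HasDerivAt (fun s => Kc d s) (-d / (2 * s) * Kc d s) s := by
    have := ((hasDerivAt_id s).const_mul π).rpow_const (p := -(d:ℝ) / 2)
      (Or.inl (mul_pos hπ hs).ne')
    refine this.congr_deriv ?_
    simp only [id, Kc, mul_one]
    rw [Real.rpow_sub_one (by positivity)]
    field_simp
  have h2 : HasDerivAt (fun s => exp (-(‖z‖ ^ 2 / s)))
      (exp (-(‖z‖ ^ 2 / s)) * (‖z‖ ^ 2 / s ^ 2)) s := by
    refine HasDerivAt.exp ?_
    have := ((hasDerivAt_inv hs.ne').const_mul (‖z‖ ^ 2)).neg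
    refine this.congr_deriv ?_
    field_simp
  refine (h1.mul h2).congr_deriv ?_
  unfold Kt Kf
  ring

lemma Kf_d1 {d : ℕ} (s : ℝ) (i : Fin d) (z : EuclideanSpace ℝ (Fin d)) (r : ℝ) :
    HasDerivAt (fun r : ℝ => Kf s (z + r • EuclideanSpace.single i (1:ℝ)))
      (K1 i s (z + r • EuclideanSpace.single i (1:ℝ))) r := by
  have hl : HasDerivAt (fun r : ℝ => z + r • EuclideanSpace.single i (1:ℝ))
      (EuclideanSpace.single i (1:ℝ)) r := by
    simpa using ((hasDerivAt_id r).smul_const (EuclideanSpace.single i (1:ℝ))).const_add z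
  have := ((hl.norm_sq.div_const s).neg.exp).const_mul (Kc d s)
  refine this.congr_deriv ?_
  unfold K1 Kf
  rw [EuclideanSpace.inner_single_right]
  simp
  ring

lemma Kf_d2 {d : ℕ} {s : ℝ} (hs : 0 < s) (i : Fin d) (z : EuclideanSpace ℝ (Fin d)) (r : ℝ) :
    HasDerivAt (fun r : ℝ => K1 i s (z + r • EuclideanSpace.single i (1:ℝ)))
      (K2 i s (z + r • EuclideanSpace.single i (1:ℝ))) r := by
  have h1 : HasDerivAt (fun r : ℝ => -(2 * (z + r • EuclideanSpace.single i (1:ℝ)) i) / s)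
      (-2 / s) r := by
    have := ((((hasDerivAt_id r).const_add (z i)).const_mul 2).neg).div_const s
    simpa using this
  refine (h1.mul (Kf_d1 s i z r)).congr_deriv ?_
  unfold K2 K1
  field_simp
  ring

lemma bdd_int {d : ℕ} {φ : EuclideanSpace ℝ (Fin d) → ℝ} (hφ : Integrable φ)
    {k : EuclideanSpace ℝ (Fin d) → ℝ} (hk : Continuous k) {B : ℝ} (hB : ∀ z, |k z| ≤ B)
    (x : EuclideanSpace ℝ (Fin d)) : Integrable (fun y => k (x - y) * φ y) :=
  hφ.bdd_mul (c := B) (Continuous.aestronglyMeasurable (by fun_prop))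
    (Filter.Eventually.of_forall fun y => hB _)

def Uf {d : ℕ} (φ : EuclideanSpace ℝ (Fin d) → ℝ) (s : ℝ) (x : EuclideanSpace ℝ (Fin d)) : ℝ :=
  ∫ y, Kf s (x - y) * φ y

lemma Uf_dt {d : ℕ} {φ : EuclideanSpace ℝ (Fin d) → ℝ} (hφ : Integrable φ) {s : ℝ} (hs : 0 < s)
    (x : EuclideanSpace ℝ (Fin d)) :
    HasDerivAt (fun s => Uf φ s x) (∫ y, Kt s (x - y) * φ y) s := by
  refine (hasDerivAt_integral_of_dominated_loc_of_deriv_le (s := Ioi (s / 2))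
    (bound := fun y => ((d / 2 + 1) / (s / 2) * Kc d (s / 2)) * |φ y|)
    (F' := fun s y => Kt s (x - y) * φ y)
    (Ioi_mem_nhds (by linarith)) ?_ (bdd_int hφ (Kf_cont s) (Kf_bd hs) x)
    (bdd_int hφ (Kt_cont s) (Kt_bd hs) x).aestronglyMeasurable ?_ (hφ.abs.const_mul _) ?_).2
  · filter_upwards [Ioi_mem_nhds hs] with r hr
    exact (bdd_int hφ (Kf_cont r) (Kf_bd hr) x).aestronglyMeasurable
  · refine Filter.Eventually.of_forall fun y r hr => ?_
    have hr' : s / 2 < r := hr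
    have hr0 : 0 < r := by linarith
    rw [Real.norm_eq_abs, abs_mul]
    refine mul_le_mul_of_nonneg_right ((Kt_bd hr0 _).trans ?_) (abs_nonneg _)
    have := Kc_pos d hr0
    have := Kc_anti d (by linarith : 0 < s / 2) hr'.le
    gcongr
  · refine Filter.Eventually.of_forall fun y r hr => ?_
    have hr' : s / 2 < r := hr
    exact (Kf_dt (by linarith) _).mul_const _

lemma int_d {d : ℕ} {φ : EuclideanSpace ℝ (Fin d) → ℝ} (hφ : Integrable φ)
    {k k' : EuclideanSpace ℝ (Fin d) → ℝ} (hk : Continuous k) (hk' : Continuous k') {B B' : ℝ}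
    (hB : ∀ z, |k z| ≤ B) (hB' : ∀ z, |k' z| ≤ B') (e : EuclideanSpace ℝ (Fin d))
    (hd : ∀ z (r : ℝ), HasDerivAt (fun r : ℝ => k (z + r • e)) (k' (z + r • e)) r)
    (x : EuclideanSpace ℝ (Fin d)) (r : ℝ) :
    HasDerivAt (fun r : ℝ => ∫ y, k (x + r • e - y) * φ y) (∫ y, k' (x + r • e - y) * φ y) r := by
  refine (hasDerivAt_integral_of_dominated_loc_of_deriv_le (s := univ)
    (bound := fun y => B' * |φ y|)
    (F' := fun r y => k' (x + r • e - y) * φ y)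
    Filter.univ_mem ?_ (bdd_int hφ hk hB _)
    (bdd_int hφ hk' hB' _).aestronglyMeasurable ?_ (hφ.abs.const_mul _) ?_).2
  · exact Filter.Eventually.of_forall fun r => (bdd_int hφ hk hB _).aestronglyMeasurable
  · refine Filter.Eventually.of_forall fun y r _ => ?_
    rw [Real.norm_eq_abs, abs_mul]
    exact mul_le_mul_of_nonneg_right (hB' _) (abs_nonneg _)
  · refine Filter.Eventually.of_forall fun y r _ => ?_
    have := (hd (x - y) r).mul_const (φ y)
    simpa only [sub_add_eq_add_sub] using this

/-- Heat flow in rescaled form. -/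
def Hf {d : ℕ} (φ : EuclideanSpace ℝ (Fin d) → ℝ) (s : ℝ) (x : EuclideanSpace ℝ (Fin d)) : ℝ :=
  ∫ z, Kf 1 z * φ (x + √s • z)

lemma Hf_eq {d : ℕ} (φ : EuclideanSpace ℝ (Fin d) → ℝ) {s : ℝ} (hs : 0 < s)
    (x : EuclideanSpace ℝ (Fin d)) : Hf φ s x = Uf φ s x := by
  have hsq : 0 < √s := Real.sqrt_pos.2 hs
  have h1 : Uf φ s x = ∫ y, Kf s y * φ (x + y) := by
    unfold Uf
    rw [← integral_add_left_eq_self _ x]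
    refine integral_congr_ae (Filter.Eventually.of_forall fun y => ?_)
    simp [Kf]
  have h2 := Measure.integral_comp_smul (volume : Measure (EuclideanSpace ℝ (Fin d)))
    (fun y => Kf s y * φ (x + y)) (√s)
  rw [h1]
  have h3 : ∫ y, Kf s y * φ (x + y) =
      √s ^ d * ∫ z : EuclideanSpace ℝ (Fin d), Kf s (√s • z) * φ (x + √s • z) := by
    rw [h2, abs_of_pos (by positivity)]
    simp
    field_simp
  rw [h3, ← integral_const_mul]
  unfold Hf
  refine integral_congr_ae (Filter.Eventually.of_forall fun z => ?_)
  have h4 : √s ^ d * Kc d s = Kc d 1 := by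
    unfold Kc
    rw [Real.mul_rpow Real.pi_pos.le hs.le, Real.mul_rpow Real.pi_pos.le zero_le_one, Real.one_rpow,
      Real.sqrt_eq_rpow, ← Real.rpow_natCast, ← Real.rpow_mul hs.le, mul_left_comm,
      ← Real.rpow_add hs]
    ring_nf
    simp
  simp only [Kf]
  rw [← mul_assoc, ← mul_assoc, h4, norm_smul, mul_pow, Real.norm_eq_abs, sq_abs, Real.sq_sqrt hs.le]
  congr 4
  field_simp

lemma K_int {d : ℕ} : Integrable (fun z : EuclideanSpace ℝ (Fin d) => Kf 1 z) ∧
    ∫ z : EuclideanSpace ℝ (Fin d), Kf 1 z = 1 := by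
  have h := GaussianFourier.integral_rexp_neg_mul_sq_norm
    (V := EuclideanSpace ℝ (Fin d)) (b := 1) one_pos
  have e : (fun z : EuclideanSpace ℝ (Fin d) => Kf 1 z) =
      fun z => Kc d 1 * exp (-1 * ‖z‖ ^ 2) := by
    funext z; simp [Kf]
  have h1 : ∫ z : EuclideanSpace ℝ (Fin d), Kf 1 z = 1 := by
    rw [e, integral_const_mul, h]
    simp [Kc]
    rw [← Real.rpow_add Real.pi_pos]
    ring_nf; simp
  exact ⟨not_imp_comm.1 integral_undef (by rw [h1]; exact one_ne_zero), h1⟩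

lemma Kf_nonneg {d : ℕ} {s : ℝ} (hs : 0 < s) (z : EuclideanSpace ℝ (Fin d)) : 0 ≤ Kf s z := by
  have := Kc_pos d hs
  unfold Kf; positivity

lemma Hf_zero {d : ℕ} (φ : EuclideanSpace ℝ (Fin d) → ℝ) (x : EuclideanSpace ℝ (Fin d)) :
    Hf φ 0 x = φ x := by
  simp [Hf, integral_mul_const, K_int.2]

lemma Hf_nonneg {d : ℕ} {φ : EuclideanSpace ℝ (Fin d) → ℝ} (h : ∀ x, 0 ≤ φ x) (s : ℝ)
    (x : EuclideanSpace ℝ (Fin d)) : 0 ≤ Hf φ s x :=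
  integral_nonneg fun z => mul_nonneg (Kf_nonneg one_pos z) (h _)

lemma Hf_cont {d : ℕ} {φ : EuclideanSpace ℝ (Fin d) → ℝ} (h : Continuous φ) {B : ℝ}
    (hB : ∀ x, |φ x| ≤ B) :
    Continuous (fun p : ℝ × EuclideanSpace ℝ (Fin d) => Hf φ p.1 p.2) := by
  have hK := Kf_cont (d := d) 1
  refine continuous_of_dominated (bound := fun z => Kf 1 z * B) ?_ ?_ (K_int.1.mul_const _) ?_
  · intro p
    exact Continuous.aestronglyMeasurable (by fun_prop)
  · intro p
    refine Filter.Eventually.of_forall fun z => ?_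
    rw [norm_mul, Real.norm_eq_abs, Real.norm_eq_abs, abs_of_nonneg (Kf_nonneg one_pos z)]
    exact mul_le_mul_of_nonneg_left (hB _) (Kf_nonneg one_pos z)
  · refine Filter.Eventually.of_forall fun z => ?_
    fun_prop

lemma Hf_L1 {d : ℕ} {φ : EuclideanSpace ℝ (Fin d) → ℝ} (h : Continuous φ) {B : ℝ}
    (hB : ∀ x, |φ x| ≤ B) (h0 : ∀ x, 0 ≤ φ x) (hi : Integrable φ) (s : ℝ) :
    ∫⁻ x, ENNReal.ofReal (Hf φ s x) = ENNReal.ofReal (∫ x, φ x) := by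
  have hK := Kf_cont (d := d) 1
  have e1 : ∀ x, ENNReal.ofReal (Hf φ s x) =
      ∫⁻ z : EuclideanSpace ℝ (Fin d), ENNReal.ofReal (Kf 1 z) * ENNReal.ofReal (φ (x + √s • z)) := by
    intro x
    unfold Hf
    rw [ofReal_integral_eq_lintegral_ofReal]
    · simp_rw [ENNReal.ofReal_mul (Kf_nonneg one_pos _)]
    · refine K_int.1.mul_bdd (c := B) (Continuous.aestronglyMeasurable (by fun_prop)) ?_
      exact Filter.Eventually.of_forall fun y => hB _
    · exact Filter.Eventually.of_forall fun z => mul_nonneg (Kf_nonneg one_pos z) (h0 _)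
  simp_rw [e1]
  rw [lintegral_lintegral_swap]
  · have e2 : ∀ z : EuclideanSpace ℝ (Fin d),
        ∫⁻ x, ENNReal.ofReal (Kf 1 z) * ENNReal.ofReal (φ (x + √s • z)) =
        ENNReal.ofReal (Kf 1 z) * ENNReal.ofReal (∫ x, φ x) := by
      intro z
      rw [lintegral_const_mul' _ _ ENNReal.ofReal_ne_top,
        lintegral_add_right_eq_self (fun x => ENNReal.ofReal (φ x)),
        ofReal_integral_eq_lintegral_ofReal hi (Filter.Eventually.of_forall h0)]
    simp_rw [e2]
    rw [lintegral_mul_const' _ _ ENNReal.ofReal_ne_top, ← ofReal_integral_eq_lintegral_ofReal K_int.1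
      (Filter.Eventually.of_forall fun z => Kf_nonneg one_pos z), K_int.2]
    simp
  · refine Measurable.aemeasurable (Continuous.measurable ?_)
    have h1 : Continuous fun p : EuclideanSpace ℝ (Fin d) × EuclideanSpace ℝ (Fin d) =>
        Kf 1 p.2 := hK.comp continuous_snd
    have h2 : Continuous fun p : EuclideanSpace ℝ (Fin d) × EuclideanSpace ℝ (Fin d) =>
        φ (p.1 + √s • p.2) := h.comp (by fun_prop)
    have h3 := ENNReal.continuous_ofReal.comp (h1.mul h2)
    refine h3.congr fun p => ?_
    exact ENNReal.ofReal_mul (Kf_nonneg one_pos _)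

lemma Hf_sup {d : ℕ} {φ : EuclideanSpace ℝ (Fin d) → ℝ}
    (h0 : ∀ x, 0 ≤ φ x) (hi : Integrable φ) {s : ℝ} (hs : 0 < s) (x : EuclideanSpace ℝ (Fin d)) :
    Hf φ s x ≤ Kc d s * ∫ x, φ x := by
  rw [Hf_eq φ hs, Uf, ← integral_const_mul]
  refine integral_mono (bdd_int hi (Kf_cont s) (Kf_bd hs) x) (hi.const_mul _) fun y => ?_
  exact mul_le_mul_of_nonneg_right ((le_abs_self _).trans (Kf_bd hs _)) (h0 y)

lemma Hf_sub {d : ℕ} {φ : EuclideanSpace ℝ (Fin d) → ℝ} (hi : Integrable φ) {ν t : ℝ} (hν : 0 < ν)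
    (ht : 0 < t) (x : EuclideanSpace ℝ (Fin d)) : SubAt ν (fun t x => -Hf φ (4 * ν * t) x) t x := by
  have hs : 0 < 4 * ν * t := by positivity
  set s := 4 * ν * t with hsd
  refine ⟨-((∫ y, Kt s (x - y) * φ y) * (4 * ν)),
    fun i r => -∫ y, K1 i s (x + r • EuclideanSpace.single i (1:ℝ) - y) * φ y,
    fun i => -∫ y, K2 i s (x - y) * φ y, ?_, ?_, ?_, ?_⟩
  · have h1 : HasDerivAt (fun t => 4 * ν * t) (4 * ν) t := by
      simpa using (hasDerivAt_id t).const_mul (4 * ν)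
    have h2 := (HasDerivAt.comp t (Uf_dt hi hs x) h1).neg
    refine h2.congr_of_eventuallyEq ?_
    filter_upwards [Ioi_mem_nhds ht] with r hr
    have : 0 < 4 * ν * r := by have : 0 < r := hr; positivity
    exact congrArg Neg.neg (Hf_eq φ this x)
  · intro i r
    simp only [← hsd, Hf_eq φ hs]
    exact (int_d hi (Kf_cont s) (K1_cont i s) (Kf_bd hs) (K1_bd hs i) _ (Kf_d1 s i) x r).neg
  · intro i
    have := (int_d hi (K1_cont i s) (K2_cont i s) (K1_bd hs i) (K2_bd hs i) _ (Kf_d2 hs i) x 0).neg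
    simp only [zero_smul, add_zero] at this
    exact this
  · rw [Finset.sum_neg_distrib, ← integral_finsetSum]
    · simp_rw [← Finset.sum_mul, sum_K2 hs, mul_assoc]
      rw [integral_const_mul]
      apply le_of_eq
      ring
    · intro i _
      exact bdd_int hi (K2_cont i s) (K2_bd hs i) x

lemma line_d1 {d : ℕ} {f : EuclideanSpace ℝ (Fin d) → ℝ} (hf : ContDiff ℝ 2 f)
    (x e : EuclideanSpace ℝ (Fin d)) (r : ℝ) :
    HasDerivAt (fun r : ℝ => f (x + r • e)) (fderiv ℝ f (x + r • e) e) r := by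
  have hl : HasDerivAt (fun r : ℝ => x + r • e) e r := by
    simpa using ((hasDerivAt_id r).smul_const e).const_add x
  exact ((hf.differentiable (by norm_num)) (x + r • e)).hasFDerivAt.comp_hasDerivAt r hl

lemma line_d2 {d : ℕ} {f : EuclideanSpace ℝ (Fin d) → ℝ} (hf : ContDiff ℝ 2 f)
    (x e : EuclideanSpace ℝ (Fin d)) :
    HasDerivAt (fun r : ℝ => fderiv ℝ f (x + r • e) e) (iteratedFDeriv ℝ 2 f x ![e, e]) 0 := by
  have hl : HasDerivAt (fun r : ℝ => x + r • e) e 0 := by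
    simpa using ((hasDerivAt_id (0:ℝ)).smul_const e).const_add x
  have h1 : Differentiable ℝ (fderiv ℝ f) :=
    (hf.fderiv_right (m := 1) (by norm_num)).differentiable (by norm_num)
  have h2 := (h1 (x + (0:ℝ) • e)).hasFDerivAt.comp_hasDerivAt (0:ℝ) hl
  have h3 := h2.clm_apply (hasDerivAt_const (0:ℝ) e)
  rw [iteratedFDeriv_two_apply]
  simpa using h3

lemma neg_subAt {d : ℕ} {ν lam T : ℝ} {V : EuclideanSpace ℝ (Fin d) → ℝ} {W : ℝ → ℝ}
    {h₀ : EuclideanSpace ℝ (Fin d) → ℝ} {h : ℝ → EuclideanSpace ℝ (Fin d) → ℝ}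
    (hV : IsDepositionRate d V W) (hl : 0 < lam)
    (hh : IsClassicalSolution ν lam T V h₀ h) {t : ℝ} (ht : t ∈ Ioc 0 T)
    (x : EuclideanSpace ℝ (Fin d)) : SubAt ν (fun t x => -h t x) t x := by
  have hc := hh.space_reg t ht
  refine ⟨_, _, _, (hh.time_reg x t ht).hasDerivAt.neg, fun i r => (line_d1 hc x _ r).neg,
    fun i => (line_d2 hc x _).neg, ?_⟩
  rw [hh.pde t ht x, Finset.sum_neg_distrib, lapl]
  have : 0 ≤ V (gradient (h t) x) := by
    rw [hV.isotropic]; exact hV.nonneg _ (norm_nonneg _)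
  nlinarith [mul_nonneg hl.le this]

lemma exp_sub {d : ℕ} {ν lam T : ℝ} {V : EuclideanSpace ℝ (Fin d) → ℝ} {W : ℝ → ℝ}
    {h₀ : EuclideanSpace ℝ (Fin d) → ℝ} {h : ℝ → EuclideanSpace ℝ (Fin d) → ℝ}
    (hV : IsDepositionRate d V W) (hν : 0 < ν) (hl : 0 < lam)
    (hh : IsClassicalSolution ν lam T V h₀ h) {t : ℝ} (ht : t ∈ Ioc 0 T)
    (x : EuclideanSpace ℝ (Fin d)) : SubAt ν (fun t x => exp (lam / ν * h t x) - 1) t x := by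
  have hc := hh.space_reg t ht
  refine ⟨_, _, _, (((hh.time_reg x t ht).hasDerivAt.const_mul (lam / ν)).exp).sub_const 1,
    fun i r => (((line_d1 hc x _ r).const_mul (lam / ν)).exp).sub_const 1,
    fun i => ((((line_d1 hc x _ 0).const_mul (lam / ν)).exp).mul
      ((line_d2 hc x _).const_mul (lam / ν))), ?_⟩
  rw [hh.pde t ht x]
  have h1 : V (gradient (h t) x) ≤ ∑ i, (fderiv ℝ (h t) x (EuclideanSpace.single i (1:ℝ))) ^ 2 := by
    rw [hV.isotropic]
    refine (hV.quadGrowth _ (norm_nonneg _)).trans (le_of_eq ?_)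
    rw [EuclideanSpace.real_norm_sq_eq]
    refine Finset.sum_congr rfl fun i _ => ?_
    rw [← inner_gradient_left, EuclideanSpace.inner_single_right]
    simp
  simp only [zero_smul, add_zero]
  have h2 : ν * ∑ i : Fin d, (exp (lam / ν * h t x) *
        (lam / ν * fderiv ℝ (h t) x (EuclideanSpace.single i (1:ℝ))) *
        (lam / ν * fderiv ℝ (h t) x (EuclideanSpace.single i (1:ℝ))) +
      exp (lam / ν * h t x) * (lam / ν * iteratedFDeriv ℝ 2 (h t) x
        ![EuclideanSpace.single i (1:ℝ), EuclideanSpace.single i (1:ℝ)])) =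
      exp (lam / ν * h t x) * (lam / ν * (ν * lapl (h t) x + lam *
        ∑ i, (fderiv ℝ (h t) x (EuclideanSpace.single i (1:ℝ))) ^ 2)) := by
    rw [lapl]
    simp only [mul_add, Finset.mul_sum]
    rw [← Finset.sum_add_distrib]
    refine Finset.sum_congr rfl fun i _ => ?_
    field_simp
    ring
  rw [h2]
  gcongr

lemma lower {d : ℕ} {ν lam T : ℝ} {V : EuclideanSpace ℝ (Fin d) → ℝ} {W : ℝ → ℝ}
    {h₀ : EuclideanSpace ℝ (Fin d) → ℝ} {h : ℝ → EuclideanSpace ℝ (Fin d) → ℝ}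
    (hV : IsDepositionRate d V W) (hν : 0 < ν) (hl : 0 < lam) (hT : 0 < T)
    (hW : MemW1inf h₀) (hi : Integrable h₀)
    (hh : IsClassicalSolution ν lam T V h₀ h) {t : ℝ} (ht : t ∈ Icc 0 T)
    (x : EuclideanSpace ℝ (Fin d)) :
    -h t x ≤ Hf (fun x => max (-h₀ x) 0) (4 * ν * t) x := by
  obtain ⟨B, hB⟩ := hW.bdd
  obtain ⟨M, hM⟩ := hh.bdd
  have hc0 := hW.diff.continuous
  have hφc : Continuous (fun x => max (-h₀ x) 0) := by fun_prop
  have hφB : ∀ x, |max (-h₀ x) 0| ≤ B := fun x => by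
    rw [abs_of_nonneg (le_max_right _ _)]
    exact max_le ((neg_le_abs _).trans (hB x)) ((abs_nonneg _).trans (hB x))
  have hφi : Integrable (fun x => max (-h₀ x) 0) := hi.neg.pos_part
  have := max_principle_s2 (f := fun t x => -h t x + 1 * -Hf (fun x => max (-h₀ x) 0) (4 * ν * t) x)
    (M := M) hν hT ?_ ?_ ?_ (fun t ht x => (neg_subAt hV hl hh ht x).add (Hf_sub hφi hν ht.1 x)
      zero_le_one) t ht x
  · linarith
  · have hH := (Hf_cont hφc hφB).comp
      (by fun_prop : Continuous fun p : ℝ × EuclideanSpace ℝ (Fin d) => (4 * ν * p.1, p.2))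
    exact hh.cont.neg.add (hH.neg.const_mul 1 : Continuous _).continuousOn
  · intro t ht x
    have h1 := Hf_nonneg (fun x => le_max_right (-h₀ x) 0) (4 * ν * t) x
    have h2 := (neg_le_abs _).trans (hM t ht x)
    linarith
  · intro x
    simp only [mul_zero, Hf_zero, hh.init]
    linarith [le_max_left (-h₀ x) 0]

lemma upper {d : ℕ} {ν lam T : ℝ} {V : EuclideanSpace ℝ (Fin d) → ℝ} {W : ℝ → ℝ}
    {h₀ : EuclideanSpace ℝ (Fin d) → ℝ} {h : ℝ → EuclideanSpace ℝ (Fin d) → ℝ}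
    (hV : IsDepositionRate d V W) (hν : 0 < ν) (hl : 0 < lam) (hT : 0 < T)
    (hW : MemW1inf h₀) (hi : Integrable h₀)
    (hh : IsClassicalSolution ν lam T V h₀ h) {t : ℝ} (ht : t ∈ Icc 0 T)
    (x : EuclideanSpace ℝ (Fin d)) :
    h t x ≤ exp (lam / ν * ⨆ x, max (h₀ x) 0) * Hf (fun x => max (h₀ x) 0) (4 * ν * t) x := by
  obtain ⟨B, hB⟩ := hW.bdd
  obtain ⟨M, hM⟩ := hh.bdd
  have hc0 := hW.diff.continuous
  have hφc : Continuous (fun x => max (h₀ x) 0) := by fun_prop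
  have hφB' : ∀ x, max (h₀ x) 0 ≤ B := fun x =>
    max_le ((le_abs_self _).trans (hB x)) ((abs_nonneg _).trans (hB x))
  have hφB : ∀ x, |max (h₀ x) 0| ≤ B := fun x => by
    rw [abs_of_nonneg (le_max_right _ _)]
    exact hφB' x
  have hφi : Integrable (fun x => max (h₀ x) 0) := hi.pos_part
  set S := ⨆ x, max (h₀ x) 0 with hS
  have hle : ∀ x, max (h₀ x) 0 ≤ S := fun x =>
    le_ciSup (f := fun x => max (h₀ x) 0) ⟨B, by rintro _ ⟨y, rfl⟩; exact hφB' y⟩ x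
  set c := lam / ν with hcd
  have hcp : 0 < c := by positivity
  have hk : 0 ≤ c * exp (c * S) := by positivity
  have := max_principle_s2
    (f := fun t x => (exp (c * h t x) - 1) +
      (c * exp (c * S)) * -Hf (fun x => max (h₀ x) 0) (4 * ν * t) x)
    (M := exp (c * M)) hν hT ?_ ?_ ?_
    (fun t ht x => (exp_sub hV hν hl hh ht x).add (Hf_sub hφi hν ht.1 x) hk) t ht x
  · have h2 := Real.add_one_le_exp (c * h t x)
    have h3 : c * h t x ≤ c * (exp (c * S) * Hf (fun x => max (h₀ x) 0) (4 * ν * t) x) := by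
      linarith
    exact le_of_mul_le_mul_left h3 hcp
  · have hH := (Hf_cont hφc hφB).comp
      (by fun_prop : Continuous fun p : ℝ × EuclideanSpace ℝ (Fin d) => (4 * ν * p.1, p.2))
    exact ((continuousOn_const.mul hh.cont).rexp.sub continuousOn_const).add
      (hH.neg.const_mul _ : Continuous _).continuousOn
  · intro t ht x
    have h1 := mul_nonneg hk (Hf_nonneg (fun x => le_max_right (h₀ x) 0) (4 * ν * t) x)
    have h2 := (le_abs_self _).trans (hM t ht x)
    have h3 : exp (c * h t x) ≤ exp (c * M) := by gcongr
    linarith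
  · intro x
    simp only [mul_zero, Hf_zero, hh.init]
    set m := max (h₀ x) 0 with hm
    have h1 : exp (c * h₀ x) ≤ exp (c * m) := by gcongr; exact le_max_left _ _
    have h2 : exp (c * m) ≤ exp (c * S) := by gcongr; exact hle x
    have h3 := Real.add_one_le_exp (-(c * m))
    have h4 : exp (c * m) * exp (-(c * m)) = 1 := by rw [← Real.exp_add]; simp
    have h5 : exp (c * m) - 1 ≤ c * m * exp (c * m) := by
      nlinarith [exp_pos (c * m)]
    have h6 : c * m * exp (c * m) ≤ c * m * exp (c * S) := by
      have : 0 ≤ m := le_max_right _ _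
      gcongr
    linarith

/-- There is `C > 0` depending only on `d` such that, for every classical
solution `h` of the homogeneous KPZ equation with `h₀ ∈ W^{1,∞} ∩ L¹`, setting
`Ī = ‖h₀⁻‖₁ + ‖h₀⁺‖₁ e^{(λ/ν)‖h₀⁺‖_∞}`, one has `‖h(t,·)‖₁ ≤ C Ī` on `[0,T]` and
`‖h(t,·)‖_∞ ≤ C Ī (νt)^{-d/2}` on `(0,T]`. -/
theorem statement2 {d : ℕ} (hd : 1 ≤ d) :
    ∃ C > (0:ℝ),
      ∀ (V : EuclideanSpace ℝ (Fin d) → ℝ) (W : ℝ → ℝ), IsDepositionRate d V W →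
      ∀ (ν lam T : ℝ), 0 < ν → 0 < lam → 0 < T →
      ∀ (h₀ : EuclideanSpace ℝ (Fin d) → ℝ) (h : ℝ → EuclideanSpace ℝ (Fin d) → ℝ),
        MemW1inf h₀ → Integrable h₀ (volume : Measure (EuclideanSpace ℝ (Fin d))) →
        IsClassicalSolution ν lam T V h₀ h →
        (∀ t ∈ Set.Icc (0:ℝ) T,
          (∫⁻ x, ENNReal.ofReal |h t x|) ≤
            ENNReal.ofReal (C * ((∫ x, max (-h₀ x) 0) +
              (∫ x, max (h₀ x) 0) *
                Real.exp ((lam / ν) * ⨆ x, max (h₀ x) 0)))) ∧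
        (∀ t ∈ Set.Ioc (0:ℝ) T,
          (⨆ x, |h t x|) ≤
            C * ((∫ x, max (-h₀ x) 0) +
              (∫ x, max (h₀ x) 0) *
                Real.exp ((lam / ν) * ⨆ x, max (h₀ x) 0)) * (ν * t) ^ (-(d:ℝ)/2)) := by
  refine ⟨1, one_pos, ?_⟩
  intro V W hV ν lam T hν hl hT h₀ h hW hi hh
  obtain ⟨B, hB⟩ := hW.bdd
  have hc0 := hW.diff.continuous
  have hpc : Continuous (fun x => max (h₀ x) 0) := by fun_prop
  have hnc : Continuous (fun x => max (-h₀ x) 0) := by fun_prop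
  have hpB : ∀ x, |max (h₀ x) 0| ≤ B := fun x => by
    rw [abs_of_nonneg (le_max_right _ _)]
    exact max_le ((le_abs_self _).trans (hB x)) ((abs_nonneg _).trans (hB x))
  have hnB : ∀ x, |max (-h₀ x) 0| ≤ B := fun x => by
    rw [abs_of_nonneg (le_max_right _ _)]
    exact max_le ((neg_le_abs _).trans (hB x)) ((abs_nonneg _).trans (hB x))
  have hpi : Integrable (fun x => max (h₀ x) 0) := hi.pos_part
  have hni : Integrable (fun x => max (-h₀ x) 0) := hi.neg.pos_part
  have hp0 : ∀ x, 0 ≤ max (h₀ x) 0 := fun x => le_max_right _ _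
  have hn0 : ∀ x, 0 ≤ max (-h₀ x) 0 := fun x => le_max_right _ _
  set E := exp (lam / ν * ⨆ x, max (h₀ x) 0) with hE
  have hE0 : 0 < E := exp_pos _
  have habs : ∀ t ∈ Icc 0 T, ∀ x, |h t x| ≤ Hf (fun x => max (-h₀ x) 0) (4 * ν * t) x +
      E * Hf (fun x => max (h₀ x) 0) (4 * ν * t) x := by
    intro t ht x
    have h1 := lower hV hν hl hT hW hi hh ht x
    have h2 := upper hV hν hl hT hW hi hh ht x
    rw [← hE] at h2
    have h3 := Hf_nonneg hn0 (4 * ν * t) x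
    have h4 := mul_nonneg hE0.le (Hf_nonneg hp0 (4 * ν * t) x)
    rw [abs_le]
    constructor <;> linarith
  constructor
  · intro t ht
    have hm : Measurable fun x => ENNReal.ofReal (Hf (fun x => max (-h₀ x) 0) (4 * ν * t) x) := by
      refine ENNReal.measurable_ofReal.comp (Continuous.measurable ?_)
      exact (Hf_cont hnc hnB).comp (by fun_prop : Continuous fun x : EuclideanSpace ℝ (Fin d) =>
        ((4 * ν * t, x) : ℝ × EuclideanSpace ℝ (Fin d)))
    calc ∫⁻ x, ENNReal.ofReal |h t x|
        ≤ ∫⁻ x, (ENNReal.ofReal (Hf (fun x => max (-h₀ x) 0) (4 * ν * t) x) +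
            ENNReal.ofReal E * ENNReal.ofReal (Hf (fun x => max (h₀ x) 0) (4 * ν * t) x)) := by
          refine lintegral_mono fun x => ?_
          rw [← ENNReal.ofReal_mul hE0.le, ← ENNReal.ofReal_add (Hf_nonneg hn0 _ x)
            (mul_nonneg hE0.le (Hf_nonneg hp0 _ x))]
          exact ENNReal.ofReal_le_ofReal (habs t ht x)
      _ = _ := by
          rw [lintegral_add_left hm, lintegral_const_mul' _ _ ENNReal.ofReal_ne_top,
            Hf_L1 hnc hnB hn0 hni, Hf_L1 hpc hpB hp0 hpi, ← ENNReal.ofReal_mul hE0.le,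
            ← ENNReal.ofReal_add (integral_nonneg hn0)
              (mul_nonneg hE0.le (integral_nonneg hp0)), one_mul, mul_comm E]
  · intro t ht
    refine ciSup_le fun x => ?_
    have hνt : 0 < ν * t := mul_pos hν ht.1
    have hs : 0 < 4 * ν * t := by rw [mul_assoc]; positivity
    have h1 := habs t ⟨ht.1.le, ht.2⟩ x
    have h2 := Hf_sup hn0 hni hs x
    have h3 := mul_le_mul_of_nonneg_left (Hf_sup hp0 hpi hs x) hE0.le
    have h4 : Kc d (4 * ν * t) ≤ (ν * t) ^ (-(d:ℝ) / 2) := by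
      unfold Kc
      refine Real.rpow_le_rpow_of_nonpos hνt ?_ ?_
      · nlinarith [Real.pi_gt_three]
      · have : (0:ℝ) ≤ d := by positivity
        linarith
    have h5 : 0 ≤ (∫ x, max (-h₀ x) 0) + (∫ x, max (h₀ x) 0) * E :=
      add_nonneg (integral_nonneg hn0) (mul_nonneg (integral_nonneg hp0) hE0.le)
    have h6 := mul_le_mul_of_nonneg_left h4 h5
    linarith
end
end

section
/- Assume in addition that y·W′(y) − W(y) ≥ 0 for all y ≥ 0. There is a constant C > 0 depending only on the dimension d (in particular independent of ν and λ) such that for every classical solution h on [0,T] of the homogeneous KPZ equation ∂ₜh = νΔh + λV(∇h) with h₀ ∈ W^{1,∞}(ℝ^d), and every t ∈ (0,T], ‖∇h(t,·)‖_∞ ≤ C·‖h₀‖_∞·(νt)^{−1/2}. -/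
open MeasureTheory Real Set
open scoped ENNReal

noncomputable section

def gErf (u : ℝ) : ℝ := ∫ v in (0:ℝ)..u, Real.exp (-v ^ 2 / 2)

lemma gErf_hasDerivAt (u : ℝ) : HasDerivAt gErf (Real.exp (-u ^ 2 / 2)) u := by
  have hc : Continuous (fun v : ℝ => Real.exp (-v ^ 2 / 2)) := by fun_prop
  exact intervalIntegral.integral_hasDerivAt_right (hc.intervalIntegrable _ _)
    (hc.stronglyMeasurableAtFilter _ _) hc.continuousAt

lemma gErf_continuous : Continuous gErf :=
  continuous_iff_continuousAt.2 fun u => (gErf_hasDerivAt u).continuousAt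

lemma gErf_zero : gErf 0 = 0 := by simp [gErf]

lemma gErf_mono : Monotone gErf := by
  apply monotone_of_deriv_nonneg
  · exact fun u => (gErf_hasDerivAt u).differentiableAt
  · intro u
    rw [(gErf_hasDerivAt u).deriv]
    positivity

lemma gErf_nonneg {u : ℝ} (hu : 0 ≤ u) : 0 ≤ gErf u := by
  rw [← gErf_zero]; exact gErf_mono hu

lemma gErf_le {u : ℝ} (hu : 0 ≤ u) : gErf u ≤ u := by
  have : Monotone (fun u => u - gErf u) := by
    apply monotone_of_deriv_nonneg
    · exact fun u => differentiableAt_id.sub (gErf_hasDerivAt u).differentiableAt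
    · intro u
      rw [((hasDerivAt_id' u).fun_sub (gErf_hasDerivAt u)).deriv]
      have : Real.exp (-u ^ 2 / 2) ≤ 1 := Real.exp_le_one_iff.2 (by nlinarith [sq_nonneg u])
      linarith
  have h := this hu
  simp only [gErf_zero] at h
  linarith

lemma gErf_ge {u : ℝ} (hu : 0 ≤ u) (hu1 : u ≤ 1) : u / 2 ≤ gErf u := by
  have : MonotoneOn (fun u => gErf u - u / 2) (Icc 0 1) := by
    apply monotoneOn_of_deriv_nonneg (convex_Icc 0 1)
    · exact (gErf_continuous.sub (by fun_prop)).continuousOn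
    · exact fun u _ => ((gErf_hasDerivAt u).differentiableAt.sub
        (by fun_prop)).differentiableWithinAt
    · intro u hu
      rw [interior_Icc] at hu
      rw [((gErf_hasDerivAt u).fun_sub ((hasDerivAt_id' u).div_const 2)).deriv]
      have := Real.add_one_le_exp (-u ^ 2 / 2)
      nlinarith [hu.1, hu.2]
  have h := this (by simp) ⟨hu, hu1⟩ hu
  simp only [gErf_zero] at h
  linarith

lemma gErf_half {u : ℝ} (hu : 1 ≤ u) : 1 / 2 ≤ gErf u :=
  (gErf_ge zero_le_one le_rfl).trans (gErf_mono hu)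

lemma second_deriv_nonpos (g g' : ℝ → ℝ) (c : ℝ) (hg : ∀ r, HasDerivAt g (g' r) r)
    (hg' : HasDerivAt g' c 0) (hmax : IsLocalMax g 0) : g' 0 = 0 ∧ c ≤ 0 := by
  have hd : deriv g = g' := funext fun r => (hg r).deriv
  have h0 : g' 0 = 0 := by rw [← hd]; exact hmax.deriv_eq_zero
  refine ⟨h0, ?_⟩
  by_contra! hc
  have hmin : IsLocalMin g 0 := isLocalMin_of_deriv_deriv_pos (by rw [hd, hg'.deriv]; exact hc)
    (by rw [hd, h0]) (hg 0).continuousAt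
  have heq : g =ᶠ[nhds 0] fun _ => g 0 := by
    filter_upwards [hmax, hmin] with r h1 h2 using le_antisymm h1 h2
  have h2 : g' =ᶠ[nhds 0] fun _ => 0 := by
    have := heq.deriv
    rw [hd] at this
    simpa using this
  have := h2.deriv_eq
  rw [hg'.deriv] at this
  simp at this
  linarith

lemma left_deriv_nonneg (g : ℝ → ℝ) (c t : ℝ) (ht : 0 < t) (hg : HasDerivAt g c t)
    (hmax : ∀ s ∈ Icc 0 t, g s ≤ g t) : 0 ≤ c := by
  have h1 : Filter.Tendsto (slope g t) (nhdsWithin t (Iio t)) (nhds c) :=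
    (hasDerivWithinAt_iff_tendsto_slope' (by simp)).1 hg.hasDerivWithinAt
  apply ge_of_tendsto h1
  filter_upwards [Ioo_mem_nhdsLT ht] with s hs
  rw [slope_def_field]
  exact div_nonneg_of_nonpos (by linarith [hmax s ⟨hs.1.le, hs.2.le⟩]) (by linarith [hs.2])

lemma line_derivs {d : ℕ} (u : EuclideanSpace ℝ (Fin d) → ℝ) (hu : ContDiff ℝ 2 u)
    (x v : EuclideanSpace ℝ (Fin d)) :
    (∀ r : ℝ, HasDerivAt (fun r : ℝ => u (x + r • v)) (fderiv ℝ u (x + r • v) v) r) ∧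
    HasDerivAt (fun r : ℝ => fderiv ℝ u (x + r • v) v) (iteratedFDeriv ℝ 2 u x ![v, v]) 0 := by
  have hl : ∀ r : ℝ, HasDerivAt (fun r : ℝ => x + r • v) v r := fun r => by
    simpa using ((hasDerivAt_id' r).smul_const v).const_add x
  constructor
  · intro r
    exact ((hu.differentiable (by norm_num)) (x + r • v)).hasFDerivAt.comp_hasDerivAt r (hl r)
  · have h1 : ContDiff ℝ 1 (fderiv ℝ u) := hu.fderiv_right (by norm_num)
    have h2 := ((h1.differentiable (by norm_num)) (x + (0:ℝ) • v)).hasFDerivAt.comp_hasDerivAt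
      (0:ℝ) (hl 0)
    have h3 := h2.clm_apply (hasDerivAt_const (0:ℝ) v)
    rw [iteratedFDeriv_two_apply]
    simpa using h3

lemma sq_derivs {d : ℕ} (x v : EuclideanSpace ℝ (Fin d)) :
    (∀ r : ℝ, HasDerivAt (fun r : ℝ => ‖x + r • v‖ ^ 2)
      (2 * inner ℝ x v + 2 * r * ‖v‖ ^ 2) r) := by
  intro r
  have h : (fun r : ℝ => ‖x + r • v‖ ^ 2)
      = fun r : ℝ => ‖x‖ ^ 2 + 2 * (r * inner ℝ x v) + r ^ 2 * ‖v‖ ^ 2 := by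
    funext r
    rw [norm_add_sq_real, inner_smul_right, norm_smul, mul_pow, Real.norm_eq_abs, sq_abs]
  rw [h]
  have := ((((hasDerivAt_id' r).mul_const (inner ℝ x v)).const_mul 2).const_add (‖x‖ ^ 2)).fun_add
    (((hasDerivAt_id' r).fun_pow 2).mul_const (‖v‖ ^ 2))
  refine this.congr_deriv ?_
  push_cast
  ring

lemma two_point {d : ℕ} (u : EuclideanSpace ℝ (Fin d) → ℝ) (hu : ContDiff ℝ 2 u)
    (x y v w : EuclideanSpace ℝ (Fin d)) (η c : ℝ) (P P' : ℝ → ℝ)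
    (hP : ∀ r, HasDerivAt P (P' r) r) (hP' : HasDerivAt P' c 0)
    (hmax : IsLocalMax (fun r : ℝ => u (x + r • v) - u (y + r • w) - P r
      - η * (‖x + r • v‖ ^ 2 + ‖y + r • w‖ ^ 2)) 0) :
    fderiv ℝ u x v - fderiv ℝ u y w - P' 0 - 2 * η * (inner ℝ x v + inner ℝ y w) = 0 ∧
    iteratedFDeriv ℝ 2 u x ![v, v] - iteratedFDeriv ℝ 2 u y ![w, w]
      ≤ c + 2 * η * (‖v‖ ^ 2 + ‖w‖ ^ 2) := by
  obtain ⟨a1, a2⟩ := line_derivs u hu x v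
  obtain ⟨b1, b2⟩ := line_derivs u hu y w
  have key := second_deriv_nonpos _ (fun r : ℝ => fderiv ℝ u (x + r • v) v
      - fderiv ℝ u (y + r • w) w - P' r
      - η * ((2 * inner ℝ x v + 2 * r * ‖v‖ ^ 2) + (2 * inner ℝ y w + 2 * r * ‖w‖ ^ 2)))
    (iteratedFDeriv ℝ 2 u x ![v, v] - iteratedFDeriv ℝ 2 u y ![w, w] - c
      - η * (2 * ‖v‖ ^ 2 + 2 * ‖w‖ ^ 2))
    (fun r => (((a1 r).sub (b1 r)).sub (hP r)).sub
      (((sq_derivs x v r).add (sq_derivs y w r)).const_mul η))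
    (by
      have l : ∀ k m : ℝ, HasDerivAt (fun r : ℝ => k + 2 * r * m) (2 * m) 0 := fun k m => by
        simpa using (((hasDerivAt_id' (0:ℝ)).const_mul 2).mul_const m).const_add k
      exact ((a2.sub b2).sub hP').sub (((l _ _).add (l _ _)).const_mul η)) hmax
  obtain ⟨k1, k2⟩ := key
  simp only [zero_smul, add_zero] at k1
  constructor
  · linear_combination k1
  · linarith

lemma lapl_onb {d : ℕ} (b : OrthonormalBasis (Fin d) ℝ (EuclideanSpace ℝ (Fin d)))
    (f : EuclideanSpace ℝ (Fin d) → ℝ) (x : EuclideanSpace ℝ (Fin d)) :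
    lapl f x = ∑ i, iteratedFDeriv ℝ 2 f x ![b i, b i] := by
  have h1 := congrFun
    (InnerProductSpace.laplacian_eq_iteratedFDeriv_orthonormalBasis f b) x
  have h2 := congrFun (InnerProductSpace.laplacian_eq_iteratedFDeriv_orthonormalBasis f
    (EuclideanSpace.basisFun (Fin d) ℝ)) x
  simp only [EuclideanSpace.basisFun_apply] at h2
  rw [← h1, h2, lapl]

lemma lapl_diff {d : ℕ} (hd : 1 ≤ d) (u : EuclideanSpace ℝ (Fin d) → ℝ) (hu : ContDiff ℝ 2 u)
    (x y : EuclideanSpace ℝ (Fin d)) (hxy : x ≠ y) (η q M : ℝ) (hq : 0 < q)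
    (hmax : ∀ x' y', u x' - u y' - 4 * M * gErf (‖x' - y'‖ / q) - η * (‖x'‖ ^ 2 + ‖y'‖ ^ 2)
      ≤ u x - u y - 4 * M * gErf (‖x - y‖ / q) - η * (‖x‖ ^ 2 + ‖y‖ ^ 2)) :
    lapl u x - lapl u y
      ≤ -16 * M * ‖x - y‖ * Real.exp (-(‖x - y‖ / q) ^ 2 / 2) / q ^ 3 + 4 * η * d ∧
    gradient u x - gradient u y = (2 * η) • (x + y) := by
  have hs : 0 < ‖x - y‖ := norm_pos_iff.2 (sub_ne_zero.2 hxy)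
  set s := ‖x - y‖ with hsdef
  set e : EuclideanSpace ℝ (Fin d) := s⁻¹ • (x - y) with he
  have hen : ‖e‖ = 1 := by
    rw [he, norm_smul, norm_inv, Real.norm_of_nonneg hs.le, ← hsdef, inv_mul_cancel₀ hs.ne']
  have hxe : x - y = s • e := by rw [he, smul_inv_smul₀ hs.ne']
  -- parallel directions
  have par : ∀ v : EuclideanSpace ℝ (Fin d), _ := fun v =>
    two_point u hu x y v v η 0 (fun _ => 4 * M * gErf (s / q)) (fun _ => 0)
      (fun r => hasDerivAt_const _ _) (hasDerivAt_const _ _)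
      (by
        refine Filter.Eventually.of_forall fun r => ?_
        have := hmax (x + r • v) (y + r • v)
        rw [add_sub_add_right_eq_sub, ← hsdef] at this
        simpa using this)
  constructor
  · let i0 : Fin d := ⟨0, hd⟩
    obtain ⟨b, hb⟩ := Orthonormal.exists_orthonormalBasis_extension_of_card_eq (𝕜 := ℝ)
      (E := EuclideanSpace ℝ (Fin d)) (ι := Fin d) (by simp) (v := fun _ => e) (s := {i0})
      (by
        refine ⟨fun i => by simpa using hen, fun i j hij => ?_⟩
        exact absurd (Subsingleton.elim i j) hij)
    have hb0 : b i0 = e := hb i0 rfl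
    rw [lapl_onb b, lapl_onb b, ← Finset.sum_sub_distrib]
    have hP : ∀ r : ℝ, HasDerivAt (fun r => 4 * M * gErf ((s + 2 * r) / q))
        (4 * M * (Real.exp (-((s + 2 * r) / q) ^ 2 / 2) * (2 / q))) r := by
      intro r
      have h1 : HasDerivAt (fun r : ℝ => (s + 2 * r) / q) (2 / q) r := by
        simpa using (((hasDerivAt_id' r).const_mul 2).const_add s).div_const q
      exact ((gErf_hasDerivAt _).comp r h1).const_mul _
    have hP' : HasDerivAt (fun r : ℝ => 4 * M * (Real.exp (-((s + 2 * r) / q) ^ 2 / 2) * (2 / q)))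
        (-16 * M * s * Real.exp (-(s / q) ^ 2 / 2) / q ^ 3) 0 := by
      have h1 : HasDerivAt (fun r : ℝ => (s + 2 * r) / q) (2 / q) 0 := by
        simpa using (((hasDerivAt_id' (0:ℝ)).const_mul 2).const_add s).div_const q
      have h2 := (((((h1.fun_pow 2).fun_neg).div_const 2).exp).mul_const (2 / q)).const_mul (4 * M)
      refine h2.congr_deriv ?_
      have hq' := hq.ne'
      simp only [mul_zero, add_zero, Nat.add_one_sub_one, pow_one, Nat.cast_ofNat]
      field_simp
      ring
    have refl := (two_point u hu x y e (-e) η _ _ _ hP hP' (by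
      have hev : ∀ᶠ r : ℝ in nhds 0, 0 < s + 2 * r := by
        have : ContinuousAt (fun r : ℝ => s + 2 * r) 0 := by fun_prop
        exact this.eventually (lt_mem_nhds (by simpa using hs))
      filter_upwards [hev] with r hr
      have := hmax (x + r • e) (y + r • (-e))
      have h3 : x + r • e - (y + r • (-e)) = (s + 2 * r) • e := by
        rw [add_smul, ← hxe, smul_neg, mul_comm, mul_two, add_smul]; abel
      rw [h3, norm_smul, hen, Real.norm_of_nonneg hr.le, mul_one] at this
      simpa using this)).2
    have hneg : iteratedFDeriv ℝ 2 u y ![-e, -e] = iteratedFDeriv ℝ 2 u y ![e, e] := by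
      simp [iteratedFDeriv_two_apply]
    rw [hneg, norm_neg, hen] at refl
    have hle : ∀ i, iteratedFDeriv ℝ 2 u x ![b i, b i] - iteratedFDeriv ℝ 2 u y ![b i, b i]
        ≤ (if i = i0 then -16 * M * s * Real.exp (-(s / q) ^ 2 / 2) / q ^ 3 else 0) + 4 * η := by
      intro i
      split_ifs with hi
      · rw [hi, hb0]; linarith
      · have := (par (b i)).2
        rw [b.norm_eq_one] at this
        linarith
    refine (Finset.sum_le_sum fun i _ => hle i).trans ?_
    rw [Finset.sum_add_distrib]
    simp
    linarith
  · apply ext_inner_right ℝ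
    intro v
    have := (par v).1
    rw [inner_sub_left, gradient, gradient, InnerProductSpace.toDual_symm_apply,
      InnerProductSpace.toDual_symm_apply, inner_smul_left, inner_add_left]
    simp only [conj_trivial]
    linarith

lemma ev_small (a b : ℝ) (hb : 0 < b) : ∀ᶠ η : ℝ in nhdsWithin 0 (Ioi 0), a * η < b := by
  have : ContinuousAt (fun η : ℝ => a * η) 0 := by fun_prop
  exact (this.eventually (gt_mem_nhds (by simpa using hb))).filter_mono nhdsWithin_le_nhds

set_option maxHeartbeats 1000000 in
lemma main_compare {d : ℕ} (hd : 1 ≤ d) (V : EuclideanSpace ℝ (Fin d) → ℝ) (hV : Continuous V)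
    (ν lam T : ℝ) (hν : 0 < ν) (hlam : 0 < lam)
    (h₀ : EuclideanSpace ℝ (Fin d) → ℝ) (h : ℝ → EuclideanSpace ℝ (Fin d) → ℝ)
    (sol : IsClassicalSolution ν lam T V h₀ h) (M L : ℝ) (hM : 0 < M) (hL : 0 < L)
    (h0M : ∀ x, |h₀ x| ≤ M) (h0L : ∀ x y, |h₀ x - h₀ y| ≤ L * ‖x - y‖) :
    ∃ δ > 0, ∀ ε > 0, ∀ t ∈ Icc 0 T, ∀ x y,
      h t x - h t y ≤ 4 * M * gErf (‖x - y‖ / √(ν * (t + δ))) + ε * (1 + t) := by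
  refine ⟨(2 * M / L) ^ 2 / ν, by positivity, ?_⟩
  set δ := (2 * M / L) ^ 2 / ν with hδ
  have hδ0 : 0 < δ := by positivity
  intro ε hε
  by_contra! hcon
  obtain ⟨t1, ht1, x1, y1, hlt⟩ := hcon
  obtain ⟨C0, hC0⟩ := sol.bdd
  obtain ⟨G, hG⟩ := sol.grad_bdd
  set C := |C0| + 1 with hC
  have hCpos : 0 < C := by positivity
  have hbd : ∀ t ∈ Icc (0:ℝ) T, ∀ x, |h t x| ≤ C := fun t ht x =>
    (hC0 t ht x).trans (by rw [hC]; linarith [le_abs_self C0])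
  -- uniform continuity of V
  have hVu := (isCompact_closedBall (0 : EuclideanSpace ℝ (Fin d)) G).uniformContinuousOn_of_continuous
    hV.continuousOn
  rw [Metric.uniformContinuousOn_iff] at hVu
  obtain ⟨δ', hδ', hVδ⟩ := hVu (ε / (4 * lam)) (by positivity)
  obtain ⟨η, ⟨⟨hη1, hη2⟩, hη3⟩, hη⟩ := (((ev_small (‖x1‖ ^ 2 + ‖y1‖ ^ 2)
      (h t1 x1 - h t1 y1 - (4 * M * gErf (‖x1 - y1‖ / √(ν * (t1 + δ))) + ε * (1 + t1)))
      (by linarith)).and (ev_small (16 * C) (δ' ^ 2) (by positivity))).and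
      (ev_small (4 * ν * d) (ε / 4) (by positivity))).and self_mem_nhdsWithin |>.exists
  have hη0 : 0 < η := hη
  set Z : ℝ × EuclideanSpace ℝ (Fin d) × EuclideanSpace ℝ (Fin d) → ℝ := fun p =>
    h p.1 p.2.1 - h p.1 p.2.2 - 4 * M * gErf (‖p.2.1 - p.2.2‖ / √(ν * (p.1 + δ)))
      - ε * (1 + p.1) - η * (‖p.2.1‖ ^ 2 + ‖p.2.2‖ ^ 2) with hZ
  have hZ1 : 0 < Z (t1, x1, y1) := by simp only [hZ]; linarith
  have hup : ∀ t ∈ Icc (0:ℝ) T, ∀ x y, Z (t, x, y) ≤ 2 * C - η * (‖x‖ ^ 2 + ‖y‖ ^ 2) := by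
    intro t ht x y
    simp only [hZ]
    have a1 := (abs_le.1 (hbd t ht x)).2
    have a2 := (abs_le.1 (hbd t ht y)).1
    have a3 : 0 ≤ 4 * M * gErf (‖x - y‖ / √(ν * (t + δ))) :=
      mul_nonneg (by positivity) (gErf_nonneg (by positivity))
    have a4 : 0 ≤ ε * (1 + t) := mul_nonneg hε.le (by linarith [ht.1])
    linarith
  -- existence of a maximum
  obtain ⟨t0, x0, y0, ht0, hZ0, hmax⟩ : ∃ t0 x0 y0, t0 ∈ Icc (0:ℝ) T ∧ 0 < Z (t0, x0, y0) ∧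
      ∀ t ∈ Icc (0:ℝ) T, ∀ x y, Z (t, x, y) ≤ Z (t0, x0, y0) := by
    obtain ⟨R, hR1, hR2, hR3⟩ : ∃ R : ℝ, 2 * C ≤ η * R ^ 2 ∧ ‖x1‖ ≤ R ∧ ‖y1‖ ≤ R := by
      refine ⟨2 * C / η + 1 + ‖x1‖ + ‖y1‖, ?_, ?_, ?_⟩
      · have k : 0 ≤ 2 * C / η := by positivity
        have k2 : 2 * C = η * (2 * C / η) := by field_simp
        rw [k2]
        apply mul_le_mul_of_nonneg_left _ hη0.le
        rw [← k2]
        nlinarith [norm_nonneg x1, norm_nonneg y1, mul_nonneg k (norm_nonneg x1), mul_nonneg k (norm_nonneg y1), mul_nonneg (norm_nonneg x1) (norm_nonneg y1)]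
      · have k : 0 ≤ 2 * C / η := by positivity
        linarith [norm_nonneg y1]
      · have k : 0 ≤ 2 * C / η := by positivity
        linarith [norm_nonneg x1]
    have hR0 : 0 ≤ R := (norm_nonneg _).trans hR2
    have hK : IsCompact (Icc (0:ℝ) T ×ˢ (Metric.closedBall (0 : EuclideanSpace ℝ (Fin d)) R ×ˢ
        Metric.closedBall (0 : EuclideanSpace ℝ (Fin d)) R)) :=
      isCompact_Icc.prod ((isCompact_closedBall _ _).prod (isCompact_closedBall _ _))
    have hmem1 : (t1, x1, y1) ∈ (Icc (0:ℝ) T ×ˢ (Metric.closedBall (0 : EuclideanSpace ℝ (Fin d)) R ×ˢ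
        Metric.closedBall (0 : EuclideanSpace ℝ (Fin d)) R)) :=
      ⟨ht1, by simpa using hR2, by simpa using hR3⟩
    have hcont : ContinuousOn Z (Icc (0:ℝ) T ×ˢ (Metric.closedBall (0 : EuclideanSpace ℝ (Fin d)) R ×ˢ
        Metric.closedBall (0 : EuclideanSpace ℝ (Fin d)) R)) := by
      have c1 := sol.cont.comp (s := (Icc (0:ℝ) T ×ˢ (Metric.closedBall (0 : EuclideanSpace ℝ (Fin d)) R ×ˢ
        Metric.closedBall (0 : EuclideanSpace ℝ (Fin d)) R)))
        (f := fun p : ℝ × EuclideanSpace ℝ (Fin d) × EuclideanSpace ℝ (Fin d) => (p.1, p.2.1))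
        (by fun_prop) (fun p hp => ⟨hp.1, trivial⟩)
      have c2 := sol.cont.comp (s := (Icc (0:ℝ) T ×ˢ (Metric.closedBall (0 : EuclideanSpace ℝ (Fin d)) R ×ˢ
        Metric.closedBall (0 : EuclideanSpace ℝ (Fin d)) R)))
        (f := fun p : ℝ × EuclideanSpace ℝ (Fin d) × EuclideanSpace ℝ (Fin d) => (p.1, p.2.2))
        (by fun_prop) (fun p hp => ⟨hp.1, trivial⟩)
      have c3 : ContinuousOn (fun p : ℝ × EuclideanSpace ℝ (Fin d) × EuclideanSpace ℝ (Fin d) =>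
          ‖p.2.1 - p.2.2‖ / √(ν * (p.1 + δ))) (Icc (0:ℝ) T ×ˢ (Metric.closedBall (0 : EuclideanSpace ℝ (Fin d)) R ×ˢ
        Metric.closedBall (0 : EuclideanSpace ℝ (Fin d)) R)) := by
        apply ContinuousOn.div (by fun_prop) (by fun_prop)
        intro p hp
        have : 0 ≤ p.1 := hp.1.1
        have : 0 < ν * (p.1 + δ) := by positivity
        positivity
      have c4 := gErf_continuous.comp_continuousOn c3
      exact (((c1.sub c2).sub (c4.const_mul (4 * M) )).sub (by fun_prop)).sub (by fun_prop)
    obtain ⟨⟨t0, x0, y0⟩, hm, hmx⟩ := hK.exists_isMaxOn ⟨_, hmem1⟩ hcont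
    refine ⟨t0, x0, y0, hm.1, hZ1.trans_le (hmx hmem1), ?_⟩
    intro t ht x y
    by_cases hin : ‖x‖ ≤ R ∧ ‖y‖ ≤ R
    · have hmem : (t, x, y) ∈ (Icc (0:ℝ) T ×ˢ
          (Metric.closedBall (0 : EuclideanSpace ℝ (Fin d)) R ×ˢ
          Metric.closedBall (0 : EuclideanSpace ℝ (Fin d)) R)) :=
        ⟨ht, by simpa using hin.1, by simpa using hin.2⟩
      exact hmx hmem
    · refine le_trans ?_ (hZ1.le.trans (hmx hmem1))
      refine (hup t ht x y).trans ?_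
      have : R ^ 2 ≤ ‖x‖ ^ 2 + ‖y‖ ^ 2 := by
        by_cases hx : ‖x‖ ≤ R
        · have : R < ‖y‖ := by
            by_contra! hy
            exact hin ⟨hx, hy⟩
          nlinarith [sq_nonneg ‖x‖]
        · push Not at hx
          nlinarith [sq_nonneg ‖y‖]
      nlinarith [mul_le_mul_of_nonneg_left this hη0.le]
  -- t0 > 0
  have ht0pos : 0 < t0 := by
    rcases ht0.1.eq_or_lt with h0 | h0
    · exfalso
      rw [← h0] at hZ0
      simp only [hZ, sol.init, zero_add, add_zero, mul_one] at hZ0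
      have hq : √(ν * δ) = 2 * M / L := by
        rw [hδ, mul_div_cancel₀ _ hν.ne', Real.sqrt_sq (by positivity)]
      rw [hq] at hZ0
      have k0 : 0 ≤ η * (‖x0‖ ^ 2 + ‖y0‖ ^ 2) := by positivity
      set s := ‖x0 - y0‖ with hs
      have hs0 : 0 ≤ s := norm_nonneg _
      have hu0 : 0 ≤ s / (2 * M / L) := by positivity
      rcases le_total (s / (2 * M / L)) 1 with hu | hu
      · have k1 := gErf_ge hu0 hu
        have k2 := (le_abs_self _).trans (h0L x0 y0)
        have k3 : L * s = 4 * M * (s / (2 * M / L) / 2) := by field_simp; ring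
        rw [← hs, k3] at k2
        have := mul_le_mul_of_nonneg_left k1 (by positivity : 0 ≤ 4 * M)
        linarith
      · have k1 := gErf_half hu
        have k2 := (abs_le.1 (h0M x0)).2
        have k3 := (abs_le.1 (h0M y0)).1
        have := mul_le_mul_of_nonneg_left k1 (by positivity : 0 ≤ 4 * M)
        linarith
    · exact h0
  have hxy : x0 ≠ y0 := by
    rintro rfl
    simp only [hZ, sub_self, norm_zero, zero_div, gErf_zero, mul_zero] at hZ0
    have k0 : 0 ≤ η * (‖x0‖ ^ 2 + ‖x0‖ ^ 2) := by positivity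
    have : 0 < ε * (1 + t0) := by positivity
    linarith
  have hmt : t0 ∈ Ioc (0:ℝ) T := ⟨ht0pos, ht0.2⟩
  have hqpos : 0 < √(ν * (t0 + δ)) := by positivity
  set q := √(ν * (t0 + δ)) with hq
  obtain ⟨hlap, hgrad⟩ := lapl_diff hd (h t0) (sol.space_reg t0 hmt) x0 y0 hxy η q M hqpos (by
    intro x' y'
    have := hmax t0 ht0 x' y'
    simp only [hZ] at this
    linarith)
  set s := ‖x0 - y0‖ with hs
  have hs0 : 0 ≤ s := norm_nonneg _
  -- time derivative
  have htime : 0 ≤ deriv (fun s => h s x0) t0 - deriv (fun s => h s y0) t0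
      + 2 * M * s * ν * Real.exp (-(s / q) ^ 2 / 2) / q ^ 3 - ε := by
    apply left_deriv_nonneg (fun t => h t x0 - h t y0 - 4 * M * gErf (s / √(ν * (t + δ)))
      - ε * (1 + t)) _ t0 ht0pos
    · have d1 : HasDerivAt (fun t : ℝ => ν * (t + δ)) ν t0 := by
        simpa using ((hasDerivAt_id' t0).add_const δ).const_mul ν
      have d2 := d1.sqrt (by positivity)
      have d3 := (hasDerivAt_const t0 s).fun_div d2 hqpos.ne'
      have d4 := ((gErf_hasDerivAt _).comp t0 d3).const_mul (4 * M)
      have d5 : HasDerivAt (fun t : ℝ => ε * (1 + t)) ε t0 := by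
        simpa using ((hasDerivAt_id' t0).const_add 1).const_mul ε
      refine ((((sol.time_reg x0 t0 hmt).hasDerivAt.sub (sol.time_reg y0 t0 hmt).hasDerivAt).sub
        d4).sub d5).congr_deriv ?_
      rw [← hq]
      have hq' := hqpos.ne'
      field_simp
      ring
    · intro t ht
      have := hmax t ⟨ht.1, ht.2.trans ht0.2⟩ x0 y0
      simp only [hZ] at this
      linarith
  rw [sol.pde t0 hmt, sol.pde t0 hmt] at htime
  -- the nonlinearity
  have hVd : V (gradient (h t0) x0) - V (gradient (h t0) y0) < ε / (4 * lam) := by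
    refine (le_abs_self _).trans_lt (hVδ _ (by simpa using hG t0 ht0 x0) _
      (by simpa using hG t0 ht0 y0) ?_)
    rw [dist_eq_norm, hgrad, norm_smul, Real.norm_of_nonneg (by positivity)]
    have b1 : η * (‖x0‖ ^ 2 + ‖y0‖ ^ 2) ≤ 2 * C := by linarith [hup t0 ht0 x0 y0]
    have b2 := norm_add_le x0 y0
    refine (mul_le_mul_of_nonneg_left b2 (by positivity)).trans_lt ?_
    apply lt_of_pow_lt_pow_left₀ 2 hδ'.le
    have b3 := mul_le_mul_of_nonneg_left b1 (by positivity : 0 ≤ 8 * η)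
    have b4 := mul_nonneg (sq_nonneg η) (sq_nonneg (‖x0‖ - ‖y0‖))
    have b5 : (2 * η * (‖x0‖ + ‖y0‖)) ^ 2 + 4 * (η ^ 2 * (‖x0‖ - ‖y0‖) ^ 2)
      = 8 * η * (η * (‖x0‖ ^ 2 + ‖y0‖ ^ 2)) := by ring
    have b6 : 8 * η * (2 * C) = 16 * C * η := by ring
    linarith
  have hVd' : lam * (V (gradient (h t0) x0) - V (gradient (h t0) y0)) < ε / 4 := by
    calc _ < lam * (ε / (4 * lam)) := mul_lt_mul_of_pos_left hVd hlam
      _ = ε / 4 := by field_simp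
  have hlap' := mul_le_mul_of_nonneg_left hlap hν.le
  have hX : 0 ≤ M * s * ν * Real.exp (-(s / q) ^ 2 / 2) / q ^ 3 := by positivity
  have e1 : ν * (-16 * M * s * Real.exp (-(s / q) ^ 2 / 2) / q ^ 3 + 4 * η * d)
    = -16 * (M * s * ν * Real.exp (-(s / q) ^ 2 / 2) / q ^ 3) + 4 * ν * d * η := by ring
  have e2 : 2 * M * s * ν * Real.exp (-(s / q) ^ 2 / 2) / q ^ 3
    = 2 * (M * s * ν * Real.exp (-(s / q) ^ 2 / 2) / q ^ 3) := by ring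
  rw [e1] at hlap'
  rw [e2] at htime
  linarith

lemma grad_norm {d : ℕ} (f : EuclideanSpace ℝ (Fin d) → ℝ) (x : EuclideanSpace ℝ (Fin d)) :
    ‖gradient f x‖ = ‖fderiv ℝ f x‖ := by
  rw [gradient, LinearIsometryEquiv.norm_map]

/-- If moreover `y W'(y) - W(y) ≥ 0` for `y ≥ 0`, there is a constant `C > 0`
depending only on `d` (independent of `ν` and `λ`) with
`‖∇h(t,·)‖_∞ ≤ C ‖h₀‖_∞ (νt)^{-1/2}` for every `t ∈ (0,T]`. -/
theorem statement3 {d : ℕ} (hd : 1 ≤ d) :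
    ∃ C > (0:ℝ),
      ∀ (V : EuclideanSpace ℝ (Fin d) → ℝ) (W : ℝ → ℝ), IsDepositionRate d V W →
      (∀ y : ℝ, 0 ≤ y → 0 ≤ y * deriv W y - W y) →
      ∀ (ν lam T : ℝ), 0 < ν → 0 < lam → 0 < T →
      ∀ (h₀ : EuclideanSpace ℝ (Fin d) → ℝ) (h : ℝ → EuclideanSpace ℝ (Fin d) → ℝ),
        MemW1inf h₀ → IsClassicalSolution ν lam T V h₀ h →
        ∀ t ∈ Set.Ioc (0:ℝ) T,
          (⨆ x, ‖gradient (h t) x‖) ≤ C * (⨆ x, |h₀ x|) * (ν * t) ^ (-(1:ℝ)/2) := by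
  refine ⟨4, by norm_num, ?_⟩
  intro V W hV _ ν lam T hν hlam hT h₀ h hh₀ sol t ht
  have hνt : 0 < ν * t := mul_pos hν ht.1
  obtain ⟨B, hB⟩ := hh₀.bdd
  obtain ⟨G, hG⟩ := hh₀.grad_bdd
  have hle : ∀ x, |h₀ x| ≤ ⨆ x, |h₀ x| :=
    fun x => le_ciSup (f := fun x => |h₀ x|) ⟨B, by rintro _ ⟨x, rfl⟩; exact hB x⟩ x
  have hS0 : 0 ≤ ⨆ x, |h₀ x| := (abs_nonneg _).trans (hle 0)
  have hpow : (ν * t) ^ (-(1:ℝ) / 2) = 1 / √(ν * t) := by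
    rw [neg_div, Real.rpow_neg hνt.le, Real.sqrt_eq_rpow, one_div ((ν * t) ^ (1 / 2 : ℝ))]
  have hL : ∀ x y, |h₀ x - h₀ y| ≤ (|G| + 1) * ‖x - y‖ := by
    intro x y
    have := Convex.norm_image_sub_le_of_norm_fderiv_le (𝕜 := ℝ) (f := h₀) (s := univ)
      (C := |G| + 1) (x := y) (y := x)
      (fun z _ => hh₀.diff z) (fun z _ => by
        rw [← grad_norm]; linarith [hG z, le_abs_self G]) convex_univ trivial trivial
    simpa using this
  have hsq : 0 < √(ν * t) := Real.sqrt_pos.2 hνt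
  rw [hpow]
  apply ciSup_le
  intro x
  apply le_of_forall_pos_le_add
  intro κ hκ
  set M := (⨆ x, |h₀ x|) + κ * √(ν * t) / 4 with hM
  have hMpos : 0 < M := by positivity
  obtain ⟨δ, hδ, hcmp⟩ := main_compare hd V hV.smooth.continuous ν lam T hν hlam h₀ h sol M
    (|G| + 1) hMpos (by positivity) (fun x => (hle x).trans (by
      rw [hM]; linarith [(by positivity : 0 ≤ κ * √(ν * t) / 4)])) hL
  have hlip1 : ∀ x y, h t x - h t y ≤ 4 * M / √(ν * t) * ‖x - y‖ := by
    intro x y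
    have h1 : h t x - h t y ≤ 4 * M * gErf (‖x - y‖ / √(ν * (t + δ))) := by
      apply le_of_forall_pos_le_add
      intro ε hε
      have ht' : 0 < 1 + t := by linarith [ht.1]
      have := hcmp (ε / (1 + t)) (by positivity) t ⟨ht.1.le, ht.2⟩ x y
      rwa [div_mul_cancel₀ _ ht'.ne'] at this
    have h2 : gErf (‖x - y‖ / √(ν * (t + δ))) ≤ ‖x - y‖ / √(ν * t) := by
      refine (gErf_le (by positivity)).trans ?_
      apply div_le_div_of_nonneg_left (norm_nonneg _) hsq
      exact Real.sqrt_le_sqrt (by nlinarith)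
    calc _ ≤ _ := h1
      _ ≤ 4 * M * (‖x - y‖ / √(ν * t)) := mul_le_mul_of_nonneg_left h2 (by positivity)
      _ = _ := by ring
  have hlip : ‖fderiv ℝ (h t) x‖ ≤ 4 * M / √(ν * t) := by
    apply norm_fderiv_le_of_lip' ℝ (by positivity)
    refine Filter.Eventually.of_forall fun z => ?_
    rw [Real.norm_eq_abs, abs_le]
    have a := hlip1 z x
    have b := hlip1 x z
    rw [norm_sub_rev] at b
    constructor <;> linarith
  rw [grad_norm]
  refine hlip.trans (le_of_eq ?_)
  rw [hM]
  field_simp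
end
end

section
/- Assume in addition that there are C₀ > 0 and q ∈ (1,2] with y·W′(y) − W(y) ≥ C₀·min(y², y^q) for all y ≥ 0. There is a constant C > 0 depending only on d, q and C₀ (in particular independent of ν and λ) such that for every classical solution h on [0,T] of the homogeneous KPZ equation ∂ₜh = νΔh + λV(∇h) with h₀ ∈ W^{1,∞}(ℝ^d): for every t ∈ (0,T] with t ≤ ‖h₀‖_∞/λ, ‖∇h(t,·)‖_∞ ≤ C·(‖h₀‖_∞/(λt))^{1/q}, and for every t ∈ (0,T] with t ≥ ‖h₀‖_∞/λ, ‖∇h(t,·)‖_∞ ≤ C·(‖h₀‖_∞/(λt))^{1/2}. -/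
open MeasureTheory Real Set
open scoped ENNReal

noncomputable section

abbrev EE (d : ℕ) := EuclideanSpace ℝ (Fin d)

lemma line1 {d : ℕ} {f : EE d → ℝ} (hf : ContDiff ℝ 2 f) (x e : EE d) (s : ℝ) :
    HasDerivAt (fun s : ℝ => f (x + s • e)) (fderiv ℝ f (x + s • e) e) s := by
  have h1 : HasFDerivAt f (fderiv ℝ f (x + s • e)) (x + s • e) :=
    ((hf.differentiable (by norm_num)) _).hasFDerivAt
  have h2 : HasDerivAt (fun s : ℝ => x + s • e) e s := by
    simpa using ((hasDerivAt_id s).smul_const e).const_add x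
  exact h1.comp_hasDerivAt s h2

lemma line2 {d : ℕ} {f : EE d → ℝ} (hf : ContDiff ℝ 2 f) (x e : EE d) :
    HasDerivAt (fun s : ℝ => fderiv ℝ f (x + s • e) e) (iteratedFDeriv ℝ 2 f x ![e, e]) 0 := by
  have h0 : ContDiff ℝ 1 (fderiv ℝ f) := hf.fderiv_right (by norm_num)
  have h1 : HasFDerivAt (fderiv ℝ f) (fderiv ℝ (fderiv ℝ f) (x + (0:ℝ) • e)) (x + (0:ℝ) • e) :=
    ((h0.differentiable (by norm_num)) _).hasFDerivAt
  have h2 : HasDerivAt (fun s : ℝ => x + s • e) e 0 := by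
    simpa using ((hasDerivAt_id (0:ℝ)).smul_const e).const_add x
  have h3 : HasDerivAt (fun s : ℝ => fderiv ℝ f (x + s • e))
      (fderiv ℝ (fderiv ℝ f) (x + (0:ℝ) • e) e) 0 := h1.comp_hasDerivAt (0:ℝ) h2
  have h4 := (ContinuousLinearMap.apply ℝ ℝ e).hasFDerivAt.comp_hasDerivAt (0:ℝ) h3
  refine h4.congr_deriv ?_
  rw [iteratedFDeriv_two_apply, zero_smul, add_zero]
  rfl

lemma second_test_s4 {f f' : ℝ → ℝ} {c : ℝ} (h1 : ∀ s, HasDerivAt f (f' s) s)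
    (h2 : HasDerivAt f' c 0) (hm : IsLocalMax f 0) : f' 0 = 0 ∧ c ≤ 0 := by
  have h0 : f' 0 = 0 := hm.hasDerivAt_eq_zero (h1 0)
  refine ⟨h0, ?_⟩
  by_contra hc
  push Not at hc
  have hd : deriv f = f' := funext fun s => (h1 s).deriv
  have hmin : IsLocalMin f 0 := by
    apply isLocalMin_of_deriv_deriv_pos
    · rw [hd, h2.deriv]; exact hc
    · rw [hd, h0]
    · exact (h1 0).continuousAt
  have hev : f =ᶠ[nhds 0] fun _ => f 0 := by
    filter_upwards [hm, hmin] with s a b using le_antisymm a b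
  have h3 : f' =ᶠ[nhds 0] fun _ => 0 := by
    have := hev.deriv
    rw [hd] at this
    simpa using this
  have h4 := h3.deriv_eq
  rw [h2.deriv] at h4
  simp at h4
  linarith

lemma time_test {f : ℝ → ℝ} {c t0 t : ℝ} (h1 : HasDerivAt f c t) (ht : t0 < t)
    (hm : ∀ s ∈ Set.Icc t0 t, f s ≤ f t) : 0 ≤ c := by
  have h2 := (hasDerivAt_iff_tendsto_slope_left_right.1 h1).1
  refine ge_of_tendsto h2 ?_
  filter_upwards [Ioo_mem_nhdsLT ht] with s hs
  rw [slope_def_field]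
  exact div_nonneg_of_nonpos (by linarith [hm s ⟨hs.1.le, hs.2.le⟩]) (by linarith [hs.2])

lemma line_sq {d : ℕ} (y e : EE d) (s : ℝ) :
    HasDerivAt (fun s : ℝ => ‖y + s • e‖ ^ 2) (2 * inner ℝ y e + 2 * s * ‖e‖ ^ 2) s := by
  have : (fun s : ℝ => ‖y + s • e‖ ^ 2) =
      fun s : ℝ => ‖y‖ ^ 2 + 2 * (s * inner ℝ y e) + s ^ 2 * ‖e‖ ^ 2 := by
    funext s
    rw [norm_add_sq_real, inner_smul_right, norm_smul, mul_pow]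
    simp
  rw [this]
  have h := ((((hasDerivAt_id s).mul_const (inner ℝ y e : ℝ)).const_mul 2).const_add (‖y‖ ^ 2)).add
    ((hasDerivAt_pow 2 s).mul_const (‖e‖ ^ 2))
  refine (h.congr_deriv ?_)
  simp

/-- translation test for a doubled function -/
lemma trans_test {d : ℕ} {f g : EE d → ℝ} (hf : ContDiff ℝ 2 f) (hg : ContDiff ℝ 2 g)
    (a ε : ℝ) (x y : EE d)
    (hm : ∀ z, f (y + z) + a * g (x + z) - ε * ‖y + z‖ ^ 2 ≤ f y + a * g x - ε * ‖y‖ ^ 2) :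
    gradient f y + a • gradient g x = (2 * ε) • y ∧ lapl f y + a * lapl g x ≤ 2 * ε * d := by
  have key : ∀ e : EE d, (fderiv ℝ f y e + a * fderiv ℝ g x e - ε * (2 * inner ℝ y e) = 0) ∧
      iteratedFDeriv ℝ 2 f y ![e, e] + a * iteratedFDeriv ℝ 2 g x ![e, e]
        - ε * (2 * ‖e‖ ^ 2) ≤ 0 := by
    intro e
    have h1 : ∀ s : ℝ, HasDerivAt (fun s : ℝ => f (y + s • e) + a * g (x + s • e)
        - ε * ‖y + s • e‖ ^ 2) (fderiv ℝ f (y + s • e) e + a * fderiv ℝ g (x + s • e) e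
        - ε * (2 * inner ℝ y e + 2 * s * ‖e‖ ^ 2)) s := fun s =>
      ((line1 hf y e s).add ((line1 hg x e s).const_mul a)).sub ((line_sq y e s).const_mul ε)
    have h2 : HasDerivAt (fun s : ℝ => fderiv ℝ f (y + s • e) e + a * fderiv ℝ g (x + s • e) e
        - ε * (2 * inner ℝ y e + 2 * s * ‖e‖ ^ 2)) (iteratedFDeriv ℝ 2 f y ![e, e]
          + a * iteratedFDeriv ℝ 2 g x ![e, e] - ε * (2 * ‖e‖ ^ 2)) 0 := by
      refine ((line2 hf y e).add ((line2 hg x e).const_mul a)).sub (HasDerivAt.const_mul ε ?_)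
      have := (((hasDerivAt_id (0:ℝ)).const_mul 2).mul_const (‖e‖ ^ 2)).const_add
        (2 * inner ℝ y e)
      simpa using this
    have h3 := second_test_s4 h1 h2 (Filter.Eventually.of_forall fun s => by
      simpa using hm (s • e))
    simpa using h3
  constructor
  · apply ext_inner_right ℝ
    intro e
    have := (key e).1
    rw [inner_add_left, inner_smul_left, inner_smul_left, gradient, gradient,
      InnerProductSpace.toDual_symm_apply, InnerProductSpace.toDual_symm_apply]
    simp
    linarith
  · have h := Finset.sum_nonpos (fun i (_ : i ∈ Finset.univ) =>
      (key (EuclideanSpace.single i (1:ℝ))).2)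
    simp only [Finset.sum_sub_distrib, Finset.sum_add_distrib, ← Finset.mul_sum] at h
    simp at h
    unfold lapl
    linarith

lemma lapl_neg' {d : ℕ} (f : EE d → ℝ) (x : EE d) : lapl (fun z => - f z) x = - lapl f x := by
  unfold lapl
  have : iteratedFDeriv ℝ 2 (fun z => - f z) x = - iteratedFDeriv ℝ 2 f x :=
    iteratedFDeriv_neg_apply
  rw [this]
  simp

lemma grad_neg' {d : ℕ} (f : EE d → ℝ) (x : EE d) :
    gradient (fun z => - f z) x = - gradient f x := by
  unfold gradient
  have : fderiv ℝ (fun z => - f z) x = - fderiv ℝ f x := fderiv_neg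
  rw [this]; simp

lemma lapl_zero' {d : ℕ} (x : EE d) : lapl (fun _ : EE d => (0:ℝ)) x = 0 := by
  unfold lapl
  simp

lemma maxprin {d : ℕ} {ν lam T M C : ℝ} (hν : 0 < ν) (hl : 0 < lam)
    {u : ℝ → EE d → ℝ}
    (hc : ContinuousOn (fun p : ℝ × EE d => u p.1 p.2) (Set.Icc 0 T ×ˢ Set.univ))
    (hs : ∀ t ∈ Set.Ioc (0:ℝ) T, ContDiff ℝ 2 (u t))
    (ht : ∀ x, ∀ t ∈ Set.Ioc (0:ℝ) T, DifferentiableAt ℝ (fun s => u s x) t)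
    (hb : ∀ t ∈ Set.Icc (0:ℝ) T, ∀ x, |u t x| ≤ C)
    (hp : ∀ t ∈ Set.Ioc (0:ℝ) T, ∀ x, deriv (fun s => u s x) t ≤
      ν * lapl (u t) x + lam * ‖gradient (u t) x‖ ^ 2)
    (h0 : ∀ x, u 0 x ≤ M) : ∀ t ∈ Set.Icc (0:ℝ) T, ∀ x, u t x ≤ M := by
  intro t1 ht1 x1
  by_contra hcon
  push Not at hcon
  have ht1p : 0 < t1 := by
    rcases eq_or_lt_of_le ht1.1 with h | h
    · rw [← h] at hcon; linarith [h0 x1]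
    · exact h
  set a := u t1 x1 - M with ha
  have hap : 0 < a := by simp only [ha]; linarith
  set η := a / (4 * t1) with hη
  have hηp : 0 < η := by positivity
  have hηt : η * t1 = a / 4 := by rw [hη]; field_simp
  set B := |C| + |M| + 1 with hB
  have hBp : 0 < B := by positivity
  -- choose ε
  obtain ⟨ε, hε, he1, he2⟩ : ∃ ε > 0, ε * ‖x1‖ ^ 2 ≤ a / 4 ∧
      ε * (2 * ν * d + 4 * lam * B) < η := by
    refine ⟨min (a / 4 / (‖x1‖ ^ 2 + 1)) (η / (2 * ν * d + 4 * lam * B + 1)), by positivity, ?_, ?_⟩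
    · calc _ ≤ a / 4 / (‖x1‖ ^ 2 + 1) * (‖x1‖ ^ 2 + 1) := by
            gcongr
            · exact min_le_left _ _
            · linarith
        _ = _ := by field_simp
    · have hq : 0 ≤ 2 * ν * d + 4 * lam * B := by positivity
      calc _ ≤ η / (2 * ν * d + 4 * lam * B + 1) * (2 * ν * d + 4 * lam * B) := by
            gcongr
            exact min_le_right _ _
        _ < η / (2 * ν * d + 4 * lam * B + 1) * (2 * ν * d + 4 * lam * B + 1) := by
            exact mul_lt_mul_of_pos_left (by linarith) (by positivity)
        _ = _ := by field_simp
  set Ψ : ℝ × EE d → ℝ := fun p => u p.1 p.2 - M - ε * ‖p.2‖ ^ 2 - η * p.1 with hΨ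
  have hpos1 : 0 < Ψ (t1, x1) := by
    simp only [hΨ]; linarith
  have hpt : ∀ t ∈ Set.Icc (0:ℝ) t1, ∀ x, 0 < Ψ (t, x) → ε * ‖x‖ ^ 2 ≤ B := by
    intro t htt x hx
    have := hb t ⟨htt.1, htt.2.trans ht1.2⟩ x
    have h2 := mul_nonneg hηp.le htt.1
    simp only [hΨ] at hx
    have := le_abs_self (u t x)
    have := le_abs_self C
    have := neg_abs_le M
    linarith
  set R := Real.sqrt (B / ε) with hR
  have hin : ∀ t ∈ Set.Icc (0:ℝ) t1, ∀ x, 0 < Ψ (t, x) → x ∈ Metric.closedBall (0 : EE d) R := by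
    intro t htt x hx
    have := hpt t htt x hx
    rw [mem_closedBall_zero_iff]
    apply Real.le_sqrt_of_sq_le
    rw [le_div_iff₀ hε]; linarith
  have hcont : ContinuousOn Ψ (Set.Icc 0 t1 ×ˢ Metric.closedBall (0 : EE d) R) := by
    have h1 : ContinuousOn (fun p : ℝ × EE d => u p.1 p.2)
      (Set.Icc 0 t1 ×ˢ Metric.closedBall (0 : EE d) R) :=
      hc.mono (Set.prod_mono (Set.Icc_subset_Icc_right ht1.2) (Set.subset_univ _))
    exact ((h1.sub continuousOn_const).sub (by fun_prop)).sub (by fun_prop)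
  have hmem1 : (t1, x1) ∈ (Set.Icc 0 t1 ×ˢ Metric.closedBall (0 : EE d) R) :=
    ⟨⟨ht1p.le, le_rfl⟩, hin t1 ⟨ht1p.le, le_rfl⟩ x1 hpos1⟩
  obtain ⟨⟨t, x⟩, hmem, hmax⟩ := (isCompact_Icc.prod (isCompact_closedBall _ _)).exists_isMaxOn
    ⟨_, hmem1⟩ hcont
  have hposm : 0 < Ψ (t, x) := hpos1.trans_le (hmax hmem1)
  have hmax' : ∀ s ∈ Set.Icc (0:ℝ) t1, ∀ z, Ψ (s, z) ≤ Ψ (t, x) := by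
    intro s hs z
    by_cases hz : 0 < Ψ (s, z)
    · exact hmax ⟨hs, hin s hs z hz⟩
    · linarith
  have htI : t ∈ Set.Icc 0 t1 := hmem.1
  have htp : 0 < t := by
    rcases eq_or_lt_of_le htI.1 with h | h
    · exfalso
      rw [← h] at hposm
      simp only [hΨ] at hposm
      have := h0 x
      have : 0 ≤ ε * ‖x‖ ^ 2 := by positivity
      linarith
    · exact h
  have htT : t ∈ Set.Ioc 0 T := ⟨htp, htI.2.trans ht1.2⟩
  have hT : 0 ≤ deriv (fun s => u s x) t - η := by
    have hd : HasDerivAt (fun s => u s x - M - ε * ‖x‖ ^ 2 - η * s)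
        (deriv (fun s => u s x) t - η) t := by
      have := (((ht x t htT).hasDerivAt.sub_const M).sub_const (ε * ‖x‖ ^ 2)).sub
        ((hasDerivAt_id t).const_mul η)
      exact this.congr_deriv (by simp)
    exact time_test hd htp fun s hs => hmax' s ⟨hs.1, hs.2.trans htI.2⟩ x
  have hS := trans_test (hs t htT) (contDiff_const (c := (0:ℝ))) 0 ε x x (fun z => by
    have := hmax' t htI (x + z)
    simp only [hΨ] at this
    simp only [zero_mul, add_zero]
    linarith)
  simp only [zero_smul, zero_mul, add_zero] at hS
  have hP := hp t htT x
  rw [hS.1, norm_smul, mul_pow] at hP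
  have h2 : ‖2 * ε‖ ^ 2 * ‖x‖ ^ 2 ≤ 4 * ε * B := by
    have := hpt t htI x hposm
    rw [Real.norm_eq_abs, sq_abs]
    nlinarith
  have h3 := mul_le_mul_of_nonneg_left hS.2 hν.le
  have h4 := mul_le_mul_of_nonneg_left h2 hl.le
  nlinarith

lemma W_diff {d : ℕ} (hd : 1 ≤ d) {V : EuclideanSpace ℝ (Fin d) → ℝ} {W : ℝ → ℝ}
    (h : IsDepositionRate d V W) {y : ℝ} (hy : 0 < y) : HasDerivAt W (deriv W y) y := by
  let e : EuclideanSpace ℝ (Fin d) := EuclideanSpace.single ⟨0, hd⟩ (1:ℝ)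
  have he : ‖e‖ = 1 := by simp [e]
  have h1 : DifferentiableAt ℝ (fun s : ℝ => V (s • e)) y := by
    have := h.smooth.differentiable (by norm_num)
    fun_prop
  have h2 : W =ᶠ[nhds y] fun s : ℝ => V (s • e) := by
    filter_upwards [lt_mem_nhds hy] with s hs
    rw [h.isotropic, norm_smul, he, mul_one, Real.norm_eq_abs, abs_of_pos hs]
  exact (h1.congr_of_eventuallyEq h2).hasDerivAt

lemma W_ineq {d : ℕ} (hd : 1 ≤ d) {V : EuclideanSpace ℝ (Fin d) → ℝ} {W : ℝ → ℝ}
    (h : IsDepositionRate d V W) {q C₀ : ℝ} (hq : q ∈ Set.Ioc (1:ℝ) 2) (hC₀ : 0 < C₀)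
    (hW : ∀ y : ℝ, 0 ≤ y → C₀ * min (y ^ 2) (y ^ q) ≤ y * deriv W y - W y)
    {s E : ℝ} (hs : 0 < s) (hE : 1 ≤ E) :
    C₀ * min (s ^ 2) (s ^ q) * (E * Real.log E) ≤ W (E * s) - E * W s := by
  set m := min (s ^ 2) (s ^ q) with hm
  have hder : ∀ θ : ℝ, 0 < θ → HasDerivAt (fun θ => W (θ * s) / θ - C₀ * m * Real.log θ)
      ((deriv W (θ * s) * s * θ - W (θ * s)) / θ ^ 2 - C₀ * m * θ⁻¹) θ := by
    intro θ hθ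
    have h1 : HasDerivAt (fun θ => W (θ * s)) (deriv W (θ * s) * s) θ := by
      have h2 : HasDerivAt (fun θ : ℝ => θ * s) s θ := by
        simpa using (hasDerivAt_id θ).mul_const s
      exact (W_diff hd h (mul_pos hθ hs)).comp θ h2
    have h3 := (h1.div (hasDerivAt_id θ) hθ.ne').sub
      ((Real.hasDerivAt_log hθ.ne').const_mul (C₀ * m))
    exact h3.congr_deriv (by simp)
  have hmono : MonotoneOn (fun θ => W (θ * s) / θ - C₀ * m * Real.log θ) (Set.Ici 1) := by
    apply monotoneOn_of_deriv_nonneg (convex_Ici 1)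
    · intro θ hθ
      exact (hder θ (by linarith [Set.mem_Ici.1 hθ])).continuousAt.continuousWithinAt
    · intro θ hθ
      rw [interior_Ici] at hθ
      exact (hder θ (by linarith [Set.mem_Ioi.1 hθ])).differentiableAt.differentiableWithinAt
    · intro θ hθ
      rw [interior_Ici] at hθ
      have h1 : 1 < θ := hθ
      have h0 : 0 < θ := by linarith
      rw [(hder θ h0).deriv]
      have h2 := hW (θ * s) (by positivity)
      have h3 : θ * m ≤ min ((θ * s) ^ 2) ((θ * s) ^ q) := by
        apply le_min
        · calc θ * m ≤ θ ^ 2 * s ^ 2 := by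
                gcongr
                · nlinarith
                · exact min_le_left _ _
            _ = _ := by ring
        · rw [Real.mul_rpow h0.le hs.le]
          have : θ ≤ θ ^ q := by
            simpa using Real.rpow_le_rpow_of_exponent_le h1.le hq.1.le
          gcongr
          exact min_le_right _ _
      have h4 := mul_le_mul_of_nonneg_left h3 hC₀.le
      rw [sub_nonneg, le_div_iff₀ (by positivity)]
      have : C₀ * m * θ⁻¹ * θ ^ 2 = C₀ * (θ * m) := by field_simp
      rw [this]; linarith
  have := hmono (Set.mem_Ici.2 le_rfl) (Set.mem_Ici.2 hE) hE
  simp at this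
  have hE0 : 0 < E := by linarith
  have h5 := mul_le_mul_of_nonneg_left this hE0.le
  have h6 : E * (W (E * s) / E - C₀ * m * Real.log E) =
    W (E * s) - C₀ * m * (E * Real.log E) := by field_simp
  rw [h6] at h5
  linarith

/-- the profile -/
def GG (q A M lam : ℝ) (t : ℝ) : ℝ :=
  A * ((M / (lam * t)) ^ (1/q) + (M / (lam * t)) ^ ((1:ℝ)/2))

lemma pow_der {a c t : ℝ} (hc : 0 < c) (ht : 0 < t) :
    HasDerivAt (fun t => (c / t) ^ a) (-(a * (c / t) ^ a / t)) t := by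
  have h1 : HasDerivAt (fun t : ℝ => c / t) (-(c / t ^ 2)) t := by
    have := (hasDerivAt_inv ht.ne').const_mul c
    simpa [div_eq_mul_inv] using this
  have h2 := h1.rpow_const (p := a) (Or.inl (by positivity))
  refine h2.congr_deriv ?_
  rw [Real.rpow_sub_one (by positivity)]
  field_simp

lemma GG_der {q A M lam t : ℝ} (hq : q ∈ Set.Ioc (1:ℝ) 2) (hA : 0 < A) (hM : 0 < M)
    (hl : 0 < lam) (ht : 0 < t) :
    ∃ D, HasDerivAt (GG q A M lam) D t ∧ - D ≤ GG q A M lam t / t := by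
  have e : ∀ a : ℝ, (fun t => (M / (lam * t)) ^ a) = fun t => ((M / lam) / t) ^ a := by
    intro a; funext t; rw [div_div]
  have h1 := pow_der (a := 1/q) (div_pos hM hl) ht
  have h2 := pow_der (a := (1:ℝ)/2) (div_pos hM hl) ht
  rw [← e] at h1 h2
  refine ⟨_, (h1.add h2).const_mul A, ?_⟩
  unfold GG
  have hq1 : 1 / q ≤ 1 := by
    rw [div_le_one (by linarith [hq.1])]; exact hq.1.le
  rw [div_div]
  set x := (M / (lam * t)) ^ (1/q) with hx
  set y := (M / (lam * t)) ^ ((1:ℝ)/2) with hy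
  have hx0 : 0 < x := by positivity
  have hy0 : 0 < y := by positivity
  rw [le_div_iff₀ ht]
  have : -(A * (-(1 / q * x / t) + -((1:ℝ) / 2 * y / t))) * t = A * (1 / q * x + 1/2 * y) := by
    field_simp; ring
  rw [this]
  gcongr <;> nlinarith

lemma GG_low {q A M lam t : ℝ} (hq : q ∈ Set.Ioc (1:ℝ) 2) (hA : 1 ≤ A) (hM : 0 < M)
    (hl : 0 < lam) (ht : 0 < t) {s : ℝ} (hs : GG q A M lam t ≤ s) :
    A * (M / (lam * t)) ≤ min (s ^ 2) (s ^ q) := by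
  have hq0 : 0 < q := by linarith [hq.1]
  set r := M / (lam * t) with hr
  have hr0 : 0 < r := by positivity
  have h1 : A * r ^ (1/q) ≤ s := by
    refine le_trans ?_ hs
    unfold GG
    gcongr
    have : 0 ≤ r ^ ((1:ℝ)/2) := by positivity
    linarith
  have h2 : A * r ^ ((1:ℝ)/2) ≤ s := by
    refine le_trans ?_ hs
    unfold GG
    gcongr
    have : 0 ≤ r ^ (1/q) := by positivity
    linarith
  have hA0 : 0 < A := by linarith
  apply le_min
  · calc A * r ≤ A ^ 2 * r := by gcongr; nlinarith
      _ = (A * r ^ ((1:ℝ)/2)) ^ 2 := by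
        rw [mul_pow, ← Real.rpow_natCast (r ^ ((1:ℝ)/2)), ← Real.rpow_mul hr0.le]; norm_num
      _ ≤ _ := by gcongr
  · calc A * r ≤ A ^ q * r := by
          gcongr; simpa using Real.rpow_le_rpow_of_exponent_le hA hq.1.le
      _ = (A * r ^ (1/q)) ^ q := by
        rw [Real.mul_rpow hA0.le (by positivity), ← Real.rpow_mul hr0.le,
          one_div_mul_cancel hq0.ne', Real.rpow_one]
      _ ≤ _ := by gcongr

lemma GG_anti {q A M lam s t : ℝ} (hq : q ∈ Set.Ioc (1:ℝ) 2) (hA : 0 < A) (hM : 0 < M)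
    (hl : 0 < lam) (hs : 0 < s) (hst : s ≤ t) : GG q A M lam t ≤ GG q A M lam s := by
  have hq0 : 0 < q := by linarith [hq.1]
  have ht : 0 < t := by linarith
  unfold GG
  gcongr

lemma GG_pos {q A M lam t : ℝ} (hA : 0 < A) (hM : 0 < M)
    (hl : 0 < lam) (ht : 0 < t) : 0 < GG q A M lam t := by
  unfold GG
  positivity

lemma GG_large {q A M lam : ℝ} (hA : 1 ≤ A) (hM : 0 < M)
    (hl : 0 < lam) {t : ℝ} (ht : 0 < t) (Γ : ℝ) : ∃ t0, 0 < t0 ∧ t0 < t ∧ Γ ≤ GG q A M lam t0 := by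
  set c := M / (lam * (|Γ| + 1) ^ 2) with hc
  have hc0 : 0 < c := by positivity
  refine ⟨min c (t/2), by positivity, (min_le_right _ _).trans_lt (by linarith), ?_⟩
  have h0 : 0 < min c (t/2) := by positivity
  have h1 : (|Γ| + 1) ^ 2 ≤ M / (lam * min c (t/2)) := by
    calc _ = M / (lam * c) := by rw [hc]; field_simp
      _ ≤ _ := by gcongr; exact min_le_left _ _
  have h2 : |Γ| + 1 ≤ (M / (lam * min c (t/2))) ^ ((1:ℝ)/2) := by
    rw [← Real.sqrt_eq_rpow]; exact Real.le_sqrt_of_sq_le h1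
  have h3 : 0 ≤ (M / (lam * min c (t/2))) ^ (1/q) := by positivity
  unfold GG
  have := le_abs_self Γ
  have := abs_nonneg Γ
  nlinarith

lemma sol_bound {d : ℕ} {V : EE d → ℝ} {W : ℝ → ℝ}
    (hV : IsDepositionRate d V W) {ν lam T M : ℝ} (hν : 0 < ν) (hl : 0 < lam)
    {h₀ : EE d → ℝ} {h : ℝ → EE d → ℝ} (hs : IsClassicalSolution ν lam T V h₀ h)
    (h0 : ∀ x, |h₀ x| ≤ M) : ∀ t ∈ Set.Icc (0:ℝ) T, ∀ x, |h t x| ≤ M := by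
  obtain ⟨C, hC⟩ := hs.bdd
  have hup := maxprin (M := M) hν hl hs.cont hs.space_reg hs.time_reg hC (fun t ht x => by
    rw [hs.pde t ht x]
    have := hV.quadGrowth ‖gradient (h t) x‖ (norm_nonneg _)
    rw [hV.isotropic]
    gcongr) (fun x => by rw [hs.init]; exact (le_abs_self _).trans (h0 x))
  have hdn := maxprin (M := M) (u := fun t x => - h t x) hν hl hs.cont.neg
    (fun t ht => (hs.space_reg t ht).neg) (fun x t ht => (hs.time_reg x t ht).neg)
    (fun t ht x => by rw [abs_neg]; exact hC t ht x) (fun t ht x => by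
    have e : deriv (fun s => - h s x) t = - deriv (fun s => h s x) t := deriv.fun_neg
    rw [e, hs.pde t ht x, lapl_neg', grad_neg', norm_neg]
    have h1 := hV.nonneg ‖gradient (h t) x‖ (norm_nonneg _)
    rw [hV.isotropic]
    have h2 := mul_nonneg hl.le h1
    have h3 := mul_nonneg hl.le (sq_nonneg ‖gradient (h t) x‖)
    linarith) (fun x => by rw [hs.init]; exact (neg_le_abs _).trans (h0 x))
  intro t ht x
  rw [abs_le]
  exact ⟨by linarith [hdn t ht x], hup t ht x⟩

lemma grad_lip {d : ℕ} {f : EE d → ℝ} (hf : Differentiable ℝ f) {Γ : ℝ}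
    (hΓ : ∀ x, ‖gradient f x‖ ≤ Γ) (x y : EE d) : |f x - f y| ≤ Γ * ‖x - y‖ := by
  have := Convex.norm_image_sub_le_of_norm_fderiv_le (𝕜 := ℝ) (f := f) (s := Set.univ) (C := Γ)
    (fun x _ => hf x) (fun x _ => by
      have := hΓ x
      unfold gradient at this
      rwa [LinearIsometryEquiv.norm_map] at this) convex_univ (Set.mem_univ y) (Set.mem_univ x)
  simpa using this

set_option maxHeartbeats 2000000 in
lemma doubling {d : ℕ} (hd : 1 ≤ d) {q C₀ A : ℝ} (hq : q ∈ Set.Ioc (1:ℝ) 2) (hC₀ : 0 < C₀)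
    (hA : 1 ≤ A) (hAC : 4 ≤ A * C₀)
    {V : EE d → ℝ} {W : ℝ → ℝ} (hV : IsDepositionRate d V W)
    (hW : ∀ y : ℝ, 0 ≤ y → C₀ * min (y ^ 2) (y ^ q) ≤ y * deriv W y - W y)
    {ν lam T M : ℝ} (hν : 0 < ν) (hl : 0 < lam) (hM : 0 < M)
    {h₀ : EE d → ℝ} {h : ℝ → EE d → ℝ} (hs : IsClassicalSolution ν lam T V h₀ h)
    (h0 : ∀ x, |h₀ x| ≤ M) {t1 : ℝ} (ht1 : t1 ∈ Set.Ioc 0 T) (x1 y1 : EE d) :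
    3 * M - h t1 y1 ≤ Real.exp (GG q A M lam t1 / (2 * M) * ‖x1 - y1‖) * (3 * M - h t1 x1) := by
  have hA0 : 0 < A := by linarith
  have hbd := sol_bound hV hν hl hs h0
  obtain ⟨Γ, hΓ⟩ := hs.grad_bdd
  obtain ⟨t0, ht0, ht01, hGt0⟩ := GG_large (q := q) hA hM hl ht1.1 Γ
  by_contra hcon
  push Not at hcon
  set L : ℝ → ℝ := fun t => GG q A M lam t / (2 * M) with hL
  have hLpos : ∀ t, 0 < t → 0 < L t := fun t ht => div_pos (GG_pos hA0 hM hl ht) (by positivity)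
  have hLanti : ∀ s t, 0 < s → s ≤ t → L t ≤ L s := fun s t h1 h2 => by
    simp only [hL]
    have := GG_anti hq hA0 hM hl h1 h2
    gcongr
  set a := (3 * M - h t1 y1) - Real.exp (L t1 * ‖x1 - y1‖) * (3 * M - h t1 x1) with ha
  have hap : 0 < a := by simp only [ha, hL]; linarith
  set η := a / (4 * t1) with hη
  have ht1p := ht1.1
  have hηp : 0 < η := by positivity
  have hηt : η * t1 = a / 4 := by rw [hη]; field_simp
  have hΓ0 : 0 ≤ Γ := (norm_nonneg _).trans (hΓ t1 ⟨ht1.1.le, ht1.2⟩ 0)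
  -- uniform continuity of V
  have hUC : UniformContinuousOn V (Metric.closedBall (0 : EE d) (Γ + 1)) :=
    (isCompact_closedBall _ _).uniformContinuousOn_of_continuous hV.smooth.continuous.continuousOn
  obtain ⟨δ, hδ, hVδ⟩ := Metric.uniformContinuousOn_iff.1 hUC (η / (4 * lam)) (by positivity)
  set δ' := min δ 1 with hδ'
  have hδ'p : 0 < δ' := by positivity
  obtain ⟨ε, hε, he1, he2, he3⟩ : ∃ ε > 0, ε * ‖y1‖ ^ 2 ≤ a / 4 ∧
      ν * (2 * ε * d) ≤ η / 4 ∧ 16 * ε * M < δ' ^ 2 := by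
    refine ⟨min (a / 4 / (‖y1‖ ^ 2 + 1)) (min (η / 4 / (2 * ν * d + 1)) (δ' ^ 2 / (32 * M))),
      by positivity, ?_, ?_, ?_⟩
    · calc _ ≤ a / 4 / (‖y1‖ ^ 2 + 1) * (‖y1‖ ^ 2 + 1) := by
            gcongr
            · exact min_le_left _ _
            · linarith
        _ = _ := by field_simp
    · calc _ ≤ ν * (2 * (η / 4 / (2 * ν * d + 1)) * d) := by
            gcongr
            exact (min_le_right _ _).trans (min_le_left _ _)
        _ = η / 4 / (2 * ν * d + 1) * (2 * ν * d) := by ring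
        _ ≤ η / 4 / (2 * ν * d + 1) * (2 * ν * d + 1) := by gcongr; linarith
        _ = _ := by field_simp
    · calc _ ≤ 16 * (δ' ^ 2 / (32 * M)) * M := by
            gcongr
            exact (min_le_right _ _).trans (min_le_right _ _)
        _ = δ' ^ 2 / 2 := by field_simp; norm_num
        _ < _ := by have := pow_pos hδ'p 2; linarith
  set Ψ : ℝ × EE d × EE d → ℝ := fun p => (3 * M - h p.1 p.2.2)
    - Real.exp (L p.1 * ‖p.2.1 - p.2.2‖) * (3 * M - h p.1 p.2.1)
    - ε * ‖p.2.2‖ ^ 2 - η * p.1 with hΨ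
  have hpos1 : 0 < Ψ (t1, x1, y1) := by
    simp only [hΨ]; linarith
  have hIcc : ∀ t ∈ Set.Icc t0 t1, t ∈ Set.Ioc 0 T := fun t ht =>
    ⟨ht0.trans_le ht.1, ht.2.trans ht1.2⟩
  have hwb : ∀ t ∈ Set.Icc t0 t1, ∀ x, 2 * M ≤ 3 * M - h t x ∧ 3 * M - h t x ≤ 4 * M := by
    intro t ht x
    have h1 := hIcc t ht
    have := abs_le.1 (hbd t ⟨h1.1.le, h1.2⟩ x)
    constructor <;> linarith [this.1, this.2]
  have hpt : ∀ t ∈ Set.Icc t0 t1, ∀ x y, 0 < Ψ (t, x, y) →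
      ε * ‖y‖ ^ 2 ≤ 4 * M ∧ L t1 * ‖x - y‖ ≤ 1 ∧
      0 < (3 * M - h t y) - Real.exp (L t * ‖x - y‖) * (3 * M - h t x) := by
    intro t ht x y hpos
    have hx := hwb t ht x
    have hy := hwb t ht y
    have h1 := hIcc t ht
    simp only [hΨ] at hpos
    have h2 : 0 ≤ η * t := mul_nonneg hηp.le h1.1.le
    have h3 : 0 ≤ ε * ‖y‖ ^ 2 := by positivity
    have h4 : 0 ≤ Real.exp (L t * ‖x - y‖) * (3 * M - h t x) :=
      mul_nonneg (Real.exp_pos _).le (by linarith)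
    refine ⟨by linarith, ?_, by linarith⟩
    have h5 : L t1 * ‖x - y‖ ≤ L t * ‖x - y‖ :=
      mul_le_mul_of_nonneg_right (hLanti t t1 h1.1 ht.2) (norm_nonneg _)
    have h6 := Real.add_one_le_exp (L t * ‖x - y‖)
    have h7 : 0 ≤ L t * ‖x - y‖ := mul_nonneg (hLpos t h1.1).le (norm_nonneg _)
    by_contra hc
    push Not at hc
    nlinarith
  set R := Real.sqrt (4 * M / ε) with hR
  set R2 := R + 1 / L t1 with hR2
  have hin : ∀ t ∈ Set.Icc t0 t1, ∀ x y, 0 < Ψ (t, x, y) →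
      (x, y) ∈ Metric.closedBall (0 : EE d) R2 ×ˢ Metric.closedBall (0 : EE d) R := by
    intro t htt x y hx
    obtain ⟨h1, h2, -⟩ := hpt t htt x y hx
    have hy : ‖y‖ ≤ R := by
      apply Real.le_sqrt_of_sq_le
      rw [le_div_iff₀ hε]; linarith
    refine ⟨?_, by rw [mem_closedBall_zero_iff]; exact hy⟩
    rw [mem_closedBall_zero_iff]
    have h3 : ‖x - y‖ ≤ 1 / L t1 := by
      rw [le_div_iff₀ (hLpos t1 ht1p)]; linarith
    calc ‖x‖ = ‖y + (x - y)‖ := by congr 1; abel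
      _ ≤ ‖y‖ + ‖x - y‖ := norm_add_le _ _
      _ ≤ _ := by rw [hR2]; linarith
  set S := Set.Icc t0 t1 ×ˢ (Metric.closedBall (0 : EE d) R2 ×ˢ Metric.closedBall (0 : EE d) R)
    with hS
  have hLc : ContinuousOn L (Set.Icc t0 t1) := by
    intro t ht
    obtain ⟨D, hD, -⟩ := GG_der hq hA0 hM hl (hIcc t ht).1
    exact (hD.div_const (2 * M)).continuousAt.continuousWithinAt
  have hcont : ContinuousOn Ψ S := by
    have h1 : ContinuousOn (fun p : ℝ × EE d × EE d => h p.1 p.2.1) S :=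
      hs.cont.comp (f := fun p : ℝ × EE d × EE d => (p.1, p.2.1)) (by fun_prop)
        (fun p hp => ⟨⟨(hIcc _ hp.1).1.le, (hIcc _ hp.1).2⟩, Set.mem_univ _⟩)
    have h2 : ContinuousOn (fun p : ℝ × EE d × EE d => h p.1 p.2.2) S :=
      hs.cont.comp (f := fun p : ℝ × EE d × EE d => (p.1, p.2.2)) (by fun_prop)
        (fun p hp => ⟨⟨(hIcc _ hp.1).1.le, (hIcc _ hp.1).2⟩, Set.mem_univ _⟩)
    have h3 : ContinuousOn (fun p : ℝ × EE d × EE d => L p.1) S :=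
      hLc.comp (by fun_prop) (fun p hp => hp.1)
    have h4 : ContinuousOn (fun p : ℝ × EE d × EE d => Real.exp (L p.1 * ‖p.2.1 - p.2.2‖)) S :=
      (h3.mul (by fun_prop)).rexp
    exact (((continuousOn_const.sub h2).sub (h4.mul (continuousOn_const.sub h1))).sub
      (by fun_prop)).sub (by fun_prop)
  have ht1m : t1 ∈ Set.Icc t0 t1 := ⟨ht01.le, le_rfl⟩
  have hmem1 : (t1, x1, y1) ∈ S := ⟨ht1m, hin t1 ht1m x1 y1 hpos1⟩
  obtain ⟨⟨t, x, y⟩, hmem, hmax⟩ := (isCompact_Icc.prod ((isCompact_closedBall _ _).prod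
    (isCompact_closedBall _ _))).exists_isMaxOn ⟨_, hmem1⟩ hcont
  have hposm : 0 < Ψ (t, x, y) := hpos1.trans_le (hmax hmem1)
  have hmax' : ∀ s ∈ Set.Icc t0 t1, ∀ z w, Ψ (s, z, w) ≤ Ψ (t, x, y) := by
    intro s hs z w
    by_cases hz : 0 < Ψ (s, z, w)
    · exact hmax ⟨hs, hin s hs z w hz⟩
    · linarith
  have htI : t ∈ Set.Icc t0 t1 := hmem.1
  have htT := hIcc t htI
  obtain ⟨hey, -, hgap⟩ := hpt t htI x y hposm
  have hwx := hwb t htI x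
  have hwy := hwb t htI y
  set r := ‖x - y‖ with hr
  set E := Real.exp (L t * r) with hE
  have hE1 : 1 ≤ E := Real.one_le_exp (mul_nonneg (hLpos t htT.1).le (norm_nonneg _))
  have hrp : 0 < r := by
    rcases eq_or_lt_of_le (norm_nonneg (x - y)) with h1 | h1
    · exfalso
      have : x = y := by rw [← sub_eq_zero, ← norm_eq_zero, ← h1]
      rw [this] at hgap
      nlinarith
    · exact h1
  have htp : t0 < t := by
    rcases eq_or_lt_of_le htI.1 with h1 | h1
    · exfalso
      have h2 := grad_lip ((hs.space_reg t htT).differentiable (by norm_num))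
        (hΓ t ⟨htT.1.le, htT.2⟩) x y
      have h3 := (abs_le.1 h2).2
      have h4 := Real.add_one_le_exp (L t * r)
      have h5 : Γ ≤ L t * (2 * M) := by
        rw [← h1]; simp only [hL]; rw [div_mul_cancel₀ _ (by positivity)]; exact hGt0
      have h6 : Γ * r ≤ L t * r * (3 * M - h t x) := by
        calc Γ * r ≤ L t * (2 * M) * r := by gcongr
          _ = L t * r * (2 * M) := by ring
          _ ≤ _ := mul_le_mul_of_nonneg_left hwx.1 (mul_nonneg (hLpos t htT.1).le hrp.le)
      have h7 : (L t * r + 1) * (3 * M - h t x) ≤ E * (3 * M - h t x) :=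
        mul_le_mul_of_nonneg_right h4 (by linarith)
      linarith
    · exact h1
  -- time derivative
  obtain ⟨D, hD, hDle⟩ := GG_der hq hA0 hM hl htT.1
  have hT : 0 ≤ - deriv (fun s => h s y) t - (E * (D / (2 * M) * r) * (3 * M - h t x)
      + E * (- deriv (fun s => h s x) t)) - η := by
    have hd1 : HasDerivAt (fun s => (3 * M - h s y) - Real.exp (L s * r) * (3 * M - h s x)
        - ε * ‖y‖ ^ 2 - η * s)
        (- deriv (fun s => h s y) t - (E * (D / (2 * M) * r) * (3 * M - h t x)
      + E * (- deriv (fun s => h s x) t)) - η) t := by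
      have e1 := (hs.time_reg y t htT).hasDerivAt.const_sub (3 * M)
      have e2 := (hs.time_reg x t htT).hasDerivAt.const_sub (3 * M)
      have e3 := ((hD.div_const (2 * M)).mul_const r).exp
      have := ((e1.sub (e3.mul e2)).sub_const (ε * ‖y‖ ^ 2)).sub ((hasDerivAt_id t).const_mul η)
      exact this.congr_deriv (by simp [hE, hL])
    exact time_test hd1 htp fun s hs => hmax' s ⟨hs.1, hs.2.trans htI.2⟩ x y
  -- translations
  have hTr := trans_test (f := fun z => - h t z) (g := h t) (hs.space_reg t htT).neg
    (hs.space_reg t htT) E ε x y (fun z => by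
      have := hmax' t htI (x + z) (y + z)
      simp only [hΨ, add_sub_add_right_eq_sub] at this
      rw [← hr, ← hE] at this
      linarith)
  rw [grad_neg', lapl_neg'] at hTr
  -- radial
  set p := gradient (h t) x with hp
  have hrad : L t * (3 * M - h t x) ≤ ‖p‖ := by
    have hloc : IsLocalMax (fun s : ℝ => - (Real.exp (L t * ((1 - s) * r)) *
        (3 * M - h t (x + s • (y - x))))) 0 := by
      filter_upwards [gt_mem_nhds (show (0:ℝ) < 1 by norm_num)] with s hs1
      have h1 := hmax' t htI (x + s • (y - x)) y
      have h2 : ‖x + s • (y - x) - y‖ = (1 - s) * r := by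
        have : x + s • (y - x) - y = (1 - s) • (x - y) := by module
        rw [this, norm_smul, Real.norm_eq_abs, abs_of_pos (by linarith)]
      simp only [hΨ] at h1
      rw [h2] at h1
      simp only [sub_zero, one_mul, zero_smul, add_zero]
      linarith
    have hder : HasDerivAt (fun s : ℝ => - (Real.exp (L t * ((1 - s) * r)) *
        (3 * M - h t (x + s • (y - x))))) (-(E * (L t * (-r)) * (3 * M - h t x)
          + E * (- fderiv ℝ (h t) x (y - x)))) 0 := by
      have e1 := (((((hasDerivAt_id (0:ℝ)).const_sub 1).mul_const r).const_mul (L t)).exp)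
      have e2 := (line1 (hs.space_reg t htT) x (y - x) 0).const_sub (3 * M)
      exact (e1.mul e2).neg.congr_deriv (by simp [hE])
    have h1 := hloc.hasDerivAt_eq_zero hder
    have h2 : fderiv ℝ (h t) x (y - x) = inner ℝ p (y - x) := by
      rw [hp, gradient, InnerProductSpace.toDual_symm_apply]
    have h3 : - inner ℝ p (y - x) ≤ ‖p‖ * r := by
      have := (neg_le_abs _).trans (abs_real_inner_le_norm p (y - x))
      rwa [norm_sub_rev y x] at this
    rw [h2] at h1
    have h4 : E * (L t * (3 * M - h t x) * r + inner ℝ p (y - x)) = 0 := by linarith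
    have h5 := (mul_eq_zero.1 h4).resolve_left (by positivity)
    have h6 : L t * (3 * M - h t x) * r ≤ ‖p‖ * r := by linarith
    exact le_of_mul_le_mul_right h6 hrp
  have hGp : GG q A M lam t ≤ ‖p‖ := by
    refine le_trans ?_ hrad
    calc GG q A M lam t = L t * (2 * M) := by
          simp only [hL]; rw [div_mul_cancel₀ _ (by positivity)]
      _ ≤ _ := mul_le_mul_of_nonneg_left hwx.1 (hLpos t htT.1).le
  have hpp : 0 < ‖p‖ := (GG_pos hA0 hM hl htT.1).trans_le hGp
  have hlow := GG_low hq hA hM hl htT.1 hGp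
  have hWi := W_ineq hd hV hq hC₀ hW hpp hE1
  rw [hE, Real.log_exp, ← hE] at hWi
  -- error
  have hgy : gradient (h t) y = E • p - (2 * ε) • y := by
    rw [← hTr.1]; abel
  have hsm : ‖(2 * ε) • y‖ < δ' := by
    apply lt_of_pow_lt_pow_left₀ 2 hδ'p.le
    rw [norm_smul, mul_pow, Real.norm_eq_abs, sq_abs]
    have e : (2 * ε) ^ 2 * ‖y‖ ^ 2 = 4 * ε * (ε * ‖y‖ ^ 2) := by ring
    have e' : 4 * ε * (ε * ‖y‖ ^ 2) ≤ 4 * ε * (4 * M) :=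
      mul_le_mul_of_nonneg_left hey (by positivity)
    linarith
  have hsmδ : ‖(2 * ε) • y‖ < δ := hsm.trans_le (min_le_left _ _)
  have hsm1 : ‖(2 * ε) • y‖ < 1 := hsm.trans_le (min_le_right _ _)
  have hgyn : ‖gradient (h t) y‖ ≤ Γ := hΓ t ⟨htT.1.le, htT.2⟩ y
  have hErr : V (E • p) - V (gradient (h t) y) < η / (4 * lam) := by
    have e : E • p = gradient (h t) y + (2 * ε) • y := by rw [hgy]; abel
    have := hVδ (E • p) (by
        rw [mem_closedBall_zero_iff, e]
        exact (norm_add_le _ _).trans (by linarith)) (gradient (h t) y) (by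
        rw [mem_closedBall_zero_iff]; linarith) (by
        rw [dist_eq_norm, e, add_sub_cancel_left]; exact hsmδ)
    rw [Real.dist_eq] at this
    exact (le_abs_self _).trans_lt this
  have hVE : V (E • p) = W (E * ‖p‖) := by
    rw [hV.isotropic, norm_smul, Real.norm_eq_abs, abs_of_pos (by positivity)]
  have hVp : V p = W ‖p‖ := hV.isotropic p
  rw [hs.pde t htT y, hs.pde t htT x, ← hp, hVp] at hT
  rw [hVE] at hErr
  set m := min (‖p‖ ^ 2) (‖p‖ ^ q) with hm
  have hLap := mul_le_mul_of_nonneg_left hTr.2 hν.le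
  have hErr' : lam * (W (E * ‖p‖) - V (gradient (h t) y)) ≤ η / 4 := by
    calc _ ≤ lam * (η / (4 * lam)) := mul_le_mul_of_nonneg_left hErr.le hl.le
      _ = _ := by field_simp
  have hWi' := mul_le_mul_of_nonneg_left hWi hl.le
  -- the bracket
  have ht := htT.1
  have hbr : E * (-D / (2 * M) * r) * (3 * M - h t x) ≤ lam * (C₀ * m * (E * (L t * r))) := by
    have h1 : -D / (2 * M) ≤ L t / t := by
      simp only [hL]
      rw [div_right_comm]
      gcongr
    have h2 : 4 * M / t ≤ lam * (C₀ * m) := by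
      calc 4 * M / t ≤ A * C₀ * M / t := by gcongr
        _ = lam * (C₀ * (A * (M / (lam * t)))) := by field_simp
        _ ≤ _ := by gcongr
    have hLt := hLpos t ht
    calc E * (-D / (2 * M) * r) * (3 * M - h t x)
        ≤ E * (L t / t * r) * (3 * M - h t x) := by
          have : 0 ≤ 3 * M - h t x := by linarith
          gcongr
      _ ≤ E * (L t / t * r) * (4 * M) := by
          gcongr; exact hwx.2
      _ = (4 * M / t) * (E * (L t * r)) := by ring
      _ ≤ lam * (C₀ * m) * (E * (L t * r)) := by gcongr
      _ = _ := by ring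
  have e1 : E * (-D / (2 * M) * r) * (3 * M - h t x) =
    - (E * (D / (2 * M) * r) * (3 * M - h t x)) := by ring
  rw [e1] at hbr
  linarith

lemma grad_bound {d : ℕ} (hd : 1 ≤ d) {q C₀ A : ℝ} (hq : q ∈ Set.Ioc (1:ℝ) 2) (hC₀ : 0 < C₀)
    (hA : 1 ≤ A) (hAC : 4 ≤ A * C₀)
    {V : EE d → ℝ} {W : ℝ → ℝ} (hV : IsDepositionRate d V W)
    (hW : ∀ y : ℝ, 0 ≤ y → C₀ * min (y ^ 2) (y ^ q) ≤ y * deriv W y - W y)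
    {ν lam T M : ℝ} (hν : 0 < ν) (hl : 0 < lam) (hM : 0 < M)
    {h₀ : EE d → ℝ} {h : ℝ → EE d → ℝ} (hs : IsClassicalSolution ν lam T V h₀ h)
    (h0 : ∀ x, |h₀ x| ≤ M) {t : ℝ} (ht : t ∈ Set.Ioc 0 T) (x : EE d) :
    ‖gradient (h t) x‖ ≤ 4 * GG q A M lam t := by
  have hA0 : 0 < A := by linarith
  have hG := GG_pos (q := q) hA0 hM hl ht.1
  set L := GG q A M lam t / (2 * M) with hL
  have hLp : 0 < L := by positivity
  have hdb := doubling hd hq hC₀ hA hAC hV hW hν hl hM hs h0 ht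
  have hbd := sol_bound hV hν hl hs h0 t ⟨ht.1.le, ht.2⟩
  have key : ∀ y z : EE d, Real.exp (L * ‖y - z‖) ≤ 2 →
      h t y - h t z ≤ 4 * GG q A M lam t * ‖y - z‖ := by
    intro y z hyz
    have h1 := hdb y z
    rw [← hL] at h1
    have h2 := abs_le.1 (hbd y)
    set u := L * ‖y - z‖ with hu
    have hu0 : 0 ≤ u := by positivity
    have h3 : Real.exp u - 1 ≤ 2 * u := by
      have h4 := Real.one_sub_le_exp_neg u
      have h5 : Real.exp u * Real.exp (-u) = 1 := by rw [← Real.exp_add]; simp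
      have h6 := Real.exp_pos u
      nlinarith
    have h7 : (Real.exp u - 1) * (3 * M - h t y) ≤ 2 * u * (4 * M) := by
      gcongr
      · linarith
      · linarith
    have h8 : 2 * u * (4 * M) = 4 * GG q A M lam t * ‖y - z‖ := by
      rw [hu, hL]; field_simp
    linarith
  have hev : ∀ᶠ z in nhds x, ‖h t z - h t x‖ ≤ 4 * GG q A M lam t * ‖z - x‖ := by
    have hc : Filter.Tendsto (fun z : EE d => Real.exp (L * ‖z - x‖)) (nhds x) (nhds 1) := by
      have : Continuous (fun z : EE d => Real.exp (L * ‖z - x‖)) := by fun_prop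
      simpa using this.tendsto x
    filter_upwards [hc.eventually_lt_const (show (1:ℝ) < 2 by norm_num)] with z hz
    rw [Real.norm_eq_abs, abs_le]
    have h1 := key z x hz.le
    have h2 := key x z (by rw [norm_sub_rev]; exact hz.le)
    rw [norm_sub_rev x z] at h2
    constructor <;> linarith
  have := norm_fderiv_le_of_lip' (𝕜 := ℝ) (f := h t) (by positivity) hev
  unfold gradient
  rwa [LinearIsometryEquiv.norm_map]

/-- If moreover `y W'(y) - W(y) ≥ C₀ min(y², y^q)` for some `C₀ > 0` and
`q ∈ (1,2]`, there is `C > 0` depending only on `d`, `q`, `C₀` (independent of `ν`, `λ`) with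
`‖∇h(t,·)‖_∞ ≤ C (‖h₀‖_∞/(λt))^{1/q}` for `t ∈ (0,T]`, `t ≤ ‖h₀‖_∞/λ`, and
`‖∇h(t,·)‖_∞ ≤ C (‖h₀‖_∞/(λt))^{1/2}` for `t ∈ (0,T]`, `t ≥ ‖h₀‖_∞/λ`. -/
theorem statement4 {d : ℕ} (hd : 1 ≤ d) (q C₀ : ℝ) (hq : q ∈ Set.Ioc (1:ℝ) 2) (hC₀ : 0 < C₀) :
    ∃ C > (0:ℝ),
      ∀ (V : EuclideanSpace ℝ (Fin d) → ℝ) (W : ℝ → ℝ), IsDepositionRate d V W →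
      (∀ y : ℝ, 0 ≤ y → C₀ * min (y ^ 2) (y ^ q) ≤ y * deriv W y - W y) →
      ∀ (ν lam T : ℝ), 0 < ν → 0 < lam → 0 < T →
      ∀ (h₀ : EuclideanSpace ℝ (Fin d) → ℝ) (h : ℝ → EuclideanSpace ℝ (Fin d) → ℝ),
        MemW1inf h₀ → IsClassicalSolution ν lam T V h₀ h →
        ∀ t ∈ Set.Ioc (0:ℝ) T,
          (t ≤ (⨆ x, |h₀ x|) / lam →
            (⨆ x, ‖gradient (h t) x‖) ≤ C * ((⨆ x, |h₀ x|) / (lam * t)) ^ (1/q)) ∧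
          ((⨆ x, |h₀ x|) / lam ≤ t →
            (⨆ x, ‖gradient (h t) x‖) ≤ C * ((⨆ x, |h₀ x|) / (lam * t)) ^ ((1:ℝ)/2)) := by
  have hq0 : 0 < q := by linarith [hq.1]
  set A := 1 + 4 / C₀ with hA
  have hA1 : 1 ≤ A := by
    have : 0 < 4 / C₀ := by positivity
    linarith
  have hAC : 4 ≤ A * C₀ := by
    have : A * C₀ = C₀ + 4 := by rw [hA]; field_simp
    linarith
  refine ⟨8 * A, by positivity, ?_⟩
  intro V W hV hW ν lam T hν hl hT h₀ h hh₀ hs t ht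
  set M := ⨆ x, |h₀ x| with hM
  have hbdd : BddAbove (Set.range fun x => |h₀ x|) := by
    obtain ⟨C, hC⟩ := hh₀.bdd
    exact ⟨C, by rintro _ ⟨x, rfl⟩; exact hC x⟩
  have hle : ∀ x, |h₀ x| ≤ M := fun x => le_ciSup hbdd x
  have hM0 : 0 ≤ M := (abs_nonneg _).trans (hle 0)
  have htp := ht.1
  have hmain : ∀ x, ‖gradient (h t) x‖ ≤ 4 * GG q A M lam t := by
    intro x
    have hcont : Continuous (fun m => 4 * GG q A m lam t) := by
      unfold GG
      have h1 : Continuous (fun m : ℝ => (m / (lam * t)) ^ (1/q)) :=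
        (Real.continuous_rpow_const (by positivity)).comp (continuous_id.div_const _)
      have h2 : Continuous (fun m : ℝ => (m / (lam * t)) ^ ((1:ℝ)/2)) :=
        (Real.continuous_rpow_const (by positivity)).comp (continuous_id.div_const _)
      exact continuous_const.mul (continuous_const.mul (h1.add h2))
    refine ge_of_tendsto (hcont.continuousWithinAt (s := Set.Ioi M) (x := M)) ?_
    filter_upwards [self_mem_nhdsWithin] with m hm
    have hm' : M < m := hm
    exact grad_bound hd hq hC₀ hA1 hAC hV hW hν hl (by linarith) hs
      (fun x => (hle x).trans hm'.le) ht x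
  have hsup : (⨆ x, ‖gradient (h t) x‖) ≤ 4 * GG q A M lam t := ciSup_le hmain
  have hr0 : 0 ≤ M / (lam * t) := by positivity
  have hqq : (1:ℝ)/2 ≤ 1/q := one_div_le_one_div_of_le hq0 hq.2
  unfold GG at hsup
  constructor
  · intro h1
    have hr1 : 1 ≤ M / (lam * t) := by
      rw [le_div_iff₀ (by positivity)]
      rw [le_div_iff₀ hl] at h1
      linarith
    have h2 := Real.rpow_le_rpow_of_exponent_le hr1 hqq
    have h3 := mul_le_mul_of_nonneg_left h2 (show 0 ≤ A by linarith)
    linarith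
  · intro h1
    have hr1 : M / (lam * t) ≤ 1 := by
      rw [div_le_iff₀ (by positivity)]
      rw [div_le_iff₀ hl] at h1
      linarith
    have h2 := Real.rpow_le_rpow_of_exponent_ge_of_imp hr0 hr1 hqq (by
      intro _ h; exact absurd h (by positivity))
    have h3 := mul_le_mul_of_nonneg_left h2 (show 0 ≤ A by linarith)
    linarith
end
end
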